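/- arXiv:2603.27639 — 6 statements merged into one kernel-verified Lean document; each statement's English description precedes it below -/
import Mathlib

section
/- Let q ≥ 2 be an integer and let r = (r_{−(q−1)},...,r_{q−1}) be a probability vector indexed by {−(q−1),...,q−1} (so r_k ≥ 0 and ∑_k r_k = 1) satisfying r_0 ≥ 1/q. Then its Shannon entropy satisfies −∑_{k=−(q−1)}^{q−1} r_k log₂ r_k ≤ (1/q) log₂ q + ((q−1)/q) log₂(2q), with the convention 0·log₂ 0 = 0. -/
theorem gibbs_aux (x s : ℝ) (hx : 0 ≤ x) (hs : 0 < s) :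
    -(x * Real.log x) ≤ -(x * Real.log s) + s - x := by
  rcases hx.eq_or_lt with h | h
  · subst h
    simp [hs.le]
  · have h1 := Real.log_le_sub_one_of_pos (div_pos hs h)
    rw [Real.log_div hs.ne' h.ne'] at h1
    have h2 := mul_le_mul_of_nonneg_left h1 hx
    have h3 : x * (s / x - 1) = s - x := by field_simp
    rw [h3] at h2
    linarith

/-- Let `q ≥ 2` and let `r` be a probability vector indexed by `{−(q−1),…,q−1}` with
`r_0 ≥ 1/q`.  Then its Shannon entropy satisfies
`−∑_k r_k log₂ r_k ≤ (1/q) log₂ q + ((q−1)/q) log₂(2q)`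
(with the convention `0 · log₂ 0 = 0`, which holds automatically since `Real.logb 2 0 = 0`). -/
theorem entropy_upper_bound_collision
    (q : ℕ) (hq : 2 ≤ q) (r : ℤ → ℝ)
    (hr0 : ∀ k ∈ Finset.Icc (-(q : ℤ) + 1) ((q : ℤ) - 1), 0 ≤ r k)
    (hr1 : ∑ k ∈ Finset.Icc (-(q : ℤ) + 1) ((q : ℤ) - 1), r k = 1)
    (hcol : 1 / (q : ℝ) ≤ r 0) :
    -∑ k ∈ Finset.Icc (-(q : ℤ) + 1) ((q : ℤ) - 1), r k * Real.logb 2 (r k)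
      ≤ (1 / (q : ℝ)) * Real.logb 2 q + (((q : ℝ) - 1) / q) * Real.logb 2 (2 * q) := by
  have hq' : (2 : ℝ) ≤ q := by exact_mod_cast hq
  have hq0 : (0 : ℝ) < q := by linarith
  have hmem : (0 : ℤ) ∈ Finset.Icc (-(q : ℤ) + 1) ((q : ℤ) - 1) := by
    rw [Finset.mem_Icc]
    constructor <;> omega
  set S := Finset.Icc (-(q : ℤ) + 1) ((q : ℤ) - 1) with hS
  have hcard : ((S.erase 0).card : ℝ) = 2 * q - 2 := by
    have : (S.erase 0).card + 2 = 2 * q := by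
      rw [Finset.card_erase_of_mem hmem, hS, Int.card_Icc]
      omega
    have h : (((S.erase 0).card + 2 : ℕ) : ℝ) = ((2 * q : ℕ) : ℝ) := by rw [this]
    push_cast at h
    linarith
  have hl2 : 0 < Real.log 2 := Real.log_pos (by norm_num)
  have hlog : Real.log (2 * q) = Real.log 2 + Real.log q :=
    Real.log_mul (by norm_num) hq0.ne'
  have hsum : r 0 + ∑ k ∈ S.erase 0, r k = 1 := by
    rw [Finset.add_sum_erase S r hmem, hr1]
  have h0 := gibbs_aux (r 0) (1 / q) (hr0 0 hmem) (by positivity)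
  have h1 : ∑ k ∈ S.erase 0, -(r k * Real.log (r k)) ≤
      ∑ k ∈ S.erase 0, (r k * (Real.log (2 * q) - 1) + 1 / (2 * q)) := by
    refine Finset.sum_le_sum fun k hk => ?_
    have h := gibbs_aux (r k) (1 / (2 * q)) (hr0 k (Finset.mem_of_mem_erase hk)) (by positivity)
    rw [one_div, Real.log_inv] at h
    rw [one_div]
    linarith
  rw [Finset.sum_add_distrib, ← Finset.sum_mul, Finset.sum_const, nsmul_eq_mul, hcard,
    Finset.sum_neg_distrib] at h1
  have hs : ∑ k ∈ S.erase 0, r k = 1 - r 0 := by linarith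
  rw [hs, hlog] at h1
  rw [one_div, Real.log_inv] at h0
  have hc : (2 * (q : ℝ) - 2) * (1 / (2 * q)) = 1 - (q : ℝ)⁻¹ := by field_simp
  rw [hc] at h1
  have hm := mul_le_mul_of_nonneg_right hcol hl2.le
  have key : -∑ k ∈ S, r k * Real.log (r k) ≤
      1 / (q : ℝ) * Real.log q + ((q : ℝ) - 1) / q * Real.log (2 * q) := by
    rw [← Finset.add_sum_erase S _ hmem, hlog]
    have e : 1 / (q : ℝ) * Real.log q + ((q : ℝ) - 1) / q * (Real.log 2 + Real.log q)
        = Real.log q + Real.log 2 - 1 / (q : ℝ) * Real.log 2 := by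
      field_simp
      ring
    rw [e]
    linarith
  have hd := div_le_div_of_nonneg_right key hl2.le
  simp only [Real.logb]
  calc _ = _ := ?_
    _ ≤ _ := hd
    _ = _ := by ring
  rw [neg_div, Finset.sum_div]
  simp only [mul_div_assoc]
end

section
/- For every integer q ≥ 2, we have h_q^⋆ ≤ h_q^F ≤ (1/q) log₂ q + ((q−1)/q) log₂(2q), where h_q^⋆ is the supremum over all probability vectors p on {0,...,q−1} of the Shannon entropy of the difference X − Y of two independent random variables X, Y each distributed according to p, and h_q^F is the optimal value of the Fourier-analytic program. -/
/-- The constraints of the Fourier-analytic convex program for `q`-ary `B₂` codes: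
`r` is a symmetric probability vector supported on `{−(q−1),…,q−1}` with `r_0 ≥ 1/q`
whose Fourier series `∑_k r_k e^{ikθ} = ∑_k r_k cos(kθ)` is nonnegative on `[0, 2π]`. -/
def FourierFeasible (q : ℕ) (r : ℤ → ℝ) : Prop :=
  (∀ k : ℤ, 0 ≤ r k) ∧
  (∀ k : ℤ, k ∉ Finset.Icc (-(q : ℤ) + 1) ((q : ℤ) - 1) → r k = 0) ∧
  (∑ k ∈ Finset.Icc (-(q : ℤ) + 1) ((q : ℤ) - 1), r k) = 1 ∧
  (∀ k : ℤ, r (-k) = r k) ∧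
  1 / (q : ℝ) ≤ r 0 ∧
  (∀ θ ∈ Set.Icc (0 : ℝ) (2 * Real.pi),
    0 ≤ ∑ k ∈ Finset.Icc (-(q : ℤ) + 1) ((q : ℤ) - 1), r k * Real.cos (k * θ))

/-- `h_q^F`: the optimal value of the Fourier-analytic convex program, i.e. the supremum of
the Shannon entropy (in bits) over all Fourier-feasible vectors `r`. -/
noncomputable def hqF (q : ℕ) : ℝ :=
  sSup {H : ℝ | ∃ r : ℤ → ℝ, FourierFeasible q r ∧
    H = -∑ k ∈ Finset.Icc (-(q : ℤ) + 1) ((q : ℤ) - 1), r k * Real.logb 2 (r k)}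

/-- `h_q^⋆`: the supremum over all probability vectors `p` on `{0,…,q−1}` of the Shannon
entropy (in bits) of the difference `X − Y` of two independent random variables each
distributed according to `p`; the pmf of `X − Y` is the autocorrelation
`r_k = ∑_i p_i p_{i+k}`. -/
noncomputable def hqStar (q : ℕ) : ℝ :=
  sSup {H : ℝ | ∃ p : ℤ → ℝ, (∀ j, 0 ≤ p j) ∧
    (∀ j : ℤ, j ∉ Finset.Icc (0 : ℤ) ((q : ℤ) - 1) → p j = 0) ∧
    (∑ j ∈ Finset.range q, p j = 1) ∧
    H = -∑ k ∈ Finset.Icc (-(q : ℤ) + 1) ((q : ℤ) - 1),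
          (∑ i ∈ Finset.range q, p i * p (i + k)) *
            Real.logb 2 (∑ i ∈ Finset.range q, p i * p (i + k))}

/-- Entropy bound for feasible vectors. -/
lemma aux_upper (q : ℕ) (hq : 2 ≤ q) (r : ℤ → ℝ) (h : FourierFeasible q r) :
    -∑ k ∈ Finset.Icc (-(q : ℤ) + 1) ((q : ℤ) - 1), r k * Real.logb 2 (r k) ≤
      (1 / (q : ℝ)) * Real.logb 2 q + (((q : ℝ) - 1) / q) * Real.logb 2 (2 * q) := by
  obtain ⟨h0, -, h1, -, h2, -⟩ := h
  have hq0 : (0 : ℝ) < q := by positivity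
  have hL : 0 < Real.log 2 := Real.log_pos (by norm_num)
  set K := Finset.Icc (-(q : ℤ) + 1) ((q : ℤ) - 1) with hK
  have h0K : (0 : ℤ) ∈ K := by
    rw [hK, Finset.mem_Icc]; constructor <;> omega
  have hcard : (K.card : ℝ) = 2 * q - 1 := by
    have : (K.card : ℤ) = 2 * q - 1 := by
      rw [hK, Int.card_Icc]; omega
    exact_mod_cast this
  set s : ℤ → ℝ := fun k => 1 / (2 * (q : ℝ)) + if k = 0 then 1 / (2 * (q : ℝ)) else 0 with hs
  have hspos : ∀ k, 0 < s k := by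
    intro k
    simp only [hs]
    split_ifs <;> positivity
  have hssum : ∑ k ∈ K, s k = 1 := by
    simp only [hs, Finset.sum_add_distrib, Finset.sum_const, nsmul_eq_mul, hcard,
      Finset.sum_ite_eq', h0K, if_true]
    field_simp
    ring
  have hlogs : ∀ k, Real.log (s k) = -Real.log (2 * q) + if k = 0 then Real.log 2 else 0 := by
    intro k
    simp only [hs]
    split_ifs
    · have : (1 / (2 * (q : ℝ)) + 1 / (2 * (q : ℝ)) : ℝ) = (2 * (q : ℝ))⁻¹ * 2 := by field_simp; ring
      rw [this, Real.log_mul (by positivity) (by norm_num), Real.log_inv]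
    · simp only [add_zero]
      rw [one_div, Real.log_inv]
  have hterm : ∀ k ∈ K, -(r k * Real.log (r k)) ≤ s k - r k - r k * Real.log (s k) := by
    intro k _
    rcases (h0 k).eq_or_lt with h | h
    · rw [← h]; simp [(hspos k).le]
    · have h3 := Real.log_le_sub_one_of_pos (div_pos (hspos k) h)
      rw [Real.log_div (hspos k).ne' h.ne'] at h3
      have h4 := mul_le_mul_of_nonneg_left h3 h.le
      have h5 : r k * (s k / r k - 1) = s k - r k := by field_simp
      linarith
  have hsum := Finset.sum_le_sum hterm
  rw [Finset.sum_sub_distrib, Finset.sum_sub_distrib, hssum, h1] at hsum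
  have h6 : ∑ k ∈ K, r k * Real.log (s k) = -Real.log (2 * q) + r 0 * Real.log 2 := by
    simp only [hlogs, mul_add, Finset.sum_add_distrib, ← Finset.sum_mul, h1, mul_ite, mul_zero,
      Finset.sum_ite_eq', h0K, if_true, one_mul]
  rw [h6, Finset.sum_neg_distrib] at hsum
  have h7 : -∑ k ∈ K, r k * Real.logb 2 (r k) =
      (-∑ k ∈ K, r k * Real.log (r k)) / Real.log 2 := by
    rw [neg_div, Finset.sum_div]
    simp only [Real.logb, mul_div_assoc]
  have h8 : (1 / (q : ℝ)) * Real.logb 2 q + (((q : ℝ) - 1) / q) * Real.logb 2 (2 * q) =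
      (Real.log (2 * q) - 1 / q * Real.log 2) / Real.log 2 := by
    simp only [Real.logb]
    rw [Real.log_mul (by norm_num) hq0.ne']
    field_simp
    ring
  rw [h7, h8]
  apply div_le_div_of_nonneg_right _ hL.le
  have := mul_le_mul_of_nonneg_right h2 hL.le
  linarith

/-- Pushing sums against the autocorrelation. -/
lemma aux_corr (q : ℕ) (p : ℤ → ℝ)
    (hp : ∀ j : ℤ, j ∉ Finset.Icc (0 : ℤ) ((q : ℤ) - 1) → p j = 0) (g : ℤ → ℝ) :
    ∑ k ∈ Finset.Icc (-(q : ℤ) + 1) ((q : ℤ) - 1),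
      (∑ i ∈ Finset.range q, p i * p (i + k)) * g k =
    ∑ i ∈ Finset.range q, ∑ j ∈ Finset.range q, p i * p j * g ((j : ℤ) - i) := by
  simp only [Finset.sum_mul]
  rw [Finset.sum_comm]
  refine Finset.sum_congr rfl fun i hi => ?_
  rw [Finset.mem_range] at hi
  symm
  refine Finset.sum_of_injOn (fun j : ℕ => (j : ℤ) - i) ?_ ?_ ?_ ?_
  · intro a _ b _ hab
    simp only at hab
    omega
  · intro a ha
    simp only [Finset.coe_range, Set.mem_Iio] at ha
    simp only [Finset.coe_Icc, Set.mem_Icc]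
    omega
  · intro k _ hk
    have : p (i + k) = 0 := by
      apply hp
      intro hmem
      rw [Finset.mem_Icc] at hmem
      apply hk
      refine ⟨((i : ℤ) + k).toNat, ?_, ?_⟩
      · simp only [Finset.coe_range, Set.mem_Iio]; omega
      · simp only; omega
    rw [this]; ring
  · intro j _
    simp

/-- The autocorrelation is feasible. -/
lemma aux_feas (q : ℕ) (hq : 2 ≤ q) (p : ℤ → ℝ) (h0 : ∀ j, 0 ≤ p j)
    (hp : ∀ j : ℤ, j ∉ Finset.Icc (0 : ℤ) ((q : ℤ) - 1) → p j = 0)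
    (h1 : ∑ j ∈ Finset.range q, p j = 1) :
    FourierFeasible q (fun k => ∑ i ∈ Finset.range q, p i * p (i + k)) := by
  have hq0 : (0 : ℝ) < q := by positivity
  have hsupp : ∀ k : ℤ, k ∉ Finset.Icc (-(q : ℤ) + 1) ((q : ℤ) - 1) →
      ∑ i ∈ Finset.range q, p i * p (i + k) = 0 := by
    intro k hk
    refine Finset.sum_eq_zero fun i hi => ?_
    rw [Finset.mem_range] at hi
    rw [hp (i + k), mul_zero]
    rw [Finset.mem_Icc] at hk ⊢
    omega
  have hform : ∀ k : ℤ, ∑ i ∈ Finset.range q, p i * p (i + k) =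
      ∑ i ∈ Finset.range q, ∑ j ∈ Finset.range q,
        p i * p j * (if (j : ℤ) - i = k then 1 else 0) := by
    intro k
    by_cases hk : k ∈ Finset.Icc (-(q : ℤ) + 1) ((q : ℤ) - 1)
    · rw [← aux_corr q p hp (fun l => if l = k then 1 else 0)]
      simp only [mul_ite, mul_one, mul_zero, Finset.sum_ite_eq', hk, if_true]
    · rw [hsupp k hk]
      symm
      refine Finset.sum_eq_zero fun i hi => Finset.sum_eq_zero fun j hj => ?_
      rw [Finset.mem_range] at hi hj
      rw [Finset.mem_Icc] at hk
      rw [if_neg (by omega), mul_zero]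
  refine ⟨fun k => Finset.sum_nonneg fun i _ => mul_nonneg (h0 _) (h0 _), hsupp, ?_, ?_, ?_, ?_⟩
  · have := aux_corr q p hp (fun _ => 1)
    simp only [mul_one] at this
    rw [this]
    simp only [← Finset.mul_sum, h1, mul_one]
  · intro k
    simp only
    rw [hform, hform, Finset.sum_comm]
    refine Finset.sum_congr rfl fun i _ => Finset.sum_congr rfl fun j _ => ?_
    rw [mul_comm (p j)]
    congr 1
    apply if_congr _ rfl rfl
    omega
  · have := sq_sum_le_card_mul_sum_sq (s := Finset.range q) (f := fun i : ℕ => p i)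
    rw [h1, Finset.card_range] at this
    rw [div_le_iff₀ hq0]
    simp only [add_zero, ← pow_two]
    linarith
  · intro θ _
    have := aux_corr q p hp (fun k => Real.cos (k * θ))
    simp only at this ⊢
    rw [this]
    have h2 : ∑ i ∈ Finset.range q, ∑ j ∈ Finset.range q,
        p i * p j * Real.cos (((j : ℤ) - i : ℤ) * θ) =
        (∑ i ∈ Finset.range q, p i * Real.cos (i * θ)) ^ 2 +
        (∑ i ∈ Finset.range q, p i * Real.sin (i * θ)) ^ 2 := by
      rw [pow_two, pow_two, Finset.sum_mul_sum, Finset.sum_mul_sum, ← Finset.sum_add_distrib]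
      refine Finset.sum_congr rfl fun i _ => ?_
      rw [← Finset.sum_add_distrib]
      refine Finset.sum_congr rfl fun j _ => ?_
      push_cast
      rw [sub_mul, Real.cos_sub]
      ring
    rw [h2]
    positivity

/-- For every `q ≥ 2`, `h_q^⋆ ≤ h_q^F ≤ (1/q) log₂ q + ((q−1)/q) log₂(2q)`. -/
theorem hqStar_le_hqF_le_coarse (q : ℕ) (hq : 2 ≤ q) :
    hqStar q ≤ hqF q ∧
    hqF q ≤ (1 / (q : ℝ)) * Real.logb 2 q + (((q : ℝ) - 1) / q) * Real.logb 2 (2 * q) := by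
  have hne : ∃ p : ℤ → ℝ, (∀ j, 0 ≤ p j) ∧
      (∀ j : ℤ, j ∉ Finset.Icc (0 : ℤ) ((q : ℤ) - 1) → p j = 0) ∧
      (∑ j ∈ Finset.range q, p j = 1) := by
    refine ⟨fun j => if j = 0 then 1 else 0, ?_, ?_, ?_⟩
    · intro j; simp only; split_ifs <;> norm_num
    · intro j hj
      rw [Finset.mem_Icc] at hj
      exact if_neg (by omega)
    · simp only [Nat.cast_eq_zero, Finset.sum_ite_eq', Finset.mem_range]
      exact if_pos (by omega)
  obtain ⟨p, hp0, hp, hp1⟩ := hne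
  constructor
  · apply csSup_le_csSup
    · refine ⟨(1 / (q : ℝ)) * Real.logb 2 q + (((q : ℝ) - 1) / q) * Real.logb 2 (2 * q), ?_⟩
      rintro H ⟨r, hr, rfl⟩
      exact aux_upper q hq r hr
    · exact ⟨_, p, hp0, hp, hp1, rfl⟩
    · rintro H ⟨p, hp0, hp, hp1, rfl⟩
      exact ⟨_, aux_feas q hq p hp0 hp hp1, rfl⟩
  · apply csSup_le
    · exact ⟨_, _, aux_feas q hq p hp0 hp hp1, rfl⟩
    · rintro H ⟨r, hr, rfl⟩
      exact aux_upper q hq r hr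
end

section
/- Let q ≥ 2 and n ≥ 1 be integers, let C ⊆ {0,1,...,q−1}^n be a q-ary B_2 code with M = |C| ≥ 2, and let e = ⌊log_q(2M) − log_q(log₂ M)⌋. Assume 0 ≤ e ≤ n. For each prefix ℓ ∈ {0,...,q−1}^e let M_ℓ be the number of codewords of C whose first e coordinates equal ℓ. Then log₂( ∑_ℓ M_ℓ² ) ≤ (n − e) · h_q^F + 2. -/
/-- A code `C ⊆ ℤ^n` is a `B₂` code if all pairwise sums `c_i + c_j` (`i ≤ j`), computed
over the integers, are distinct. -/
def IsB2 {n : ℕ} (C : Finset (Fin n → ℤ)) : Prop :=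
  ∀ c₁ ∈ C, ∀ c₂ ∈ C, ∀ c₃ ∈ C, ∀ c₄ ∈ C,
    c₁ + c₂ = c₃ + c₄ → (c₁ = c₃ ∧ c₂ = c₄) ∨ (c₁ = c₄ ∧ c₂ = c₃)

namespace B2Aux

open Finset

section
variable {α β : Type*} [DecidableEq α] [DecidableEq β]

/-- pairs with the same label -/
def prs (C : Finset α) (L : α → β) : Finset (α × α) :=
  (C ×ˢ C).filter (fun p => L p.1 = L p.2)

lemma prs_sum (C : Finset α) (L : α → β) (T : Finset β) (hT : ∀ c ∈ C, L c ∈ T)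
    (g : α × α → ℝ) :
    ∑ p ∈ prs C L, g p =
      ∑ l ∈ T, ∑ c ∈ C.filter (fun c => L c = l), ∑ d ∈ C.filter (fun c => L c = l), g (c, d) := by
  rw [← Finset.sum_fiberwise_of_maps_to (s := prs C L) (t := T) (g := fun p => L p.1)]
  · refine Finset.sum_congr rfl fun l _ => ?_
    rw [← Finset.sum_product']
    refine Finset.sum_congr ?_ fun _ _ => rfl
    ext p
    simp only [prs, Finset.mem_filter, Finset.mem_product]
    constructor
    · rintro ⟨⟨⟨h1, h2⟩, h3⟩, h4⟩
      exact ⟨⟨h1, h4⟩, h2, h3 ▸ h4⟩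
    · rintro ⟨⟨h1, h2⟩, h3, h4⟩
      exact ⟨⟨⟨h1, h3⟩, h2.trans h4.symm⟩, h2⟩
  · intro p hp
    simp only [prs, Finset.mem_filter, Finset.mem_product] at hp
    exact hT _ hp.1.1

lemma prs_card (C : Finset α) (L : α → β) (T : Finset β) (hT : ∀ c ∈ C, L c ∈ T) :
    ((prs C L).card : ℝ) = ∑ l ∈ T, ((C.filter (fun c => L c = l)).card : ℝ) ^ 2 := by
  have := prs_sum C L T hT (fun _ => 1)
  simp only [Finset.sum_const, nsmul_eq_mul, mul_one] at this
  rw [this]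
  exact Finset.sum_congr rfl fun l _ => by ring

lemma card_sq_le (A : Finset α) (f : α → β) (T : Finset β) (hT : ∀ c ∈ A, f c ∈ T) :
    (A.card : ℝ) ^ 2 ≤ T.card * ∑ l ∈ T, ((A.filter (fun c => f c = l)).card : ℝ) ^ 2 := by
  have h := sq_sum_le_card_mul_sum_sq (s := T)
    (f := fun l => ((A.filter (fun c => f c = l)).card : ℝ))
  have h2 : (A.card : ℝ) = ∑ l ∈ T, ((A.filter (fun c => f c = l)).card : ℝ) := by
    exact_mod_cast Finset.card_eq_sum_card_fiberwise (f := f) (s := A) (t := T) hT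
  rw [h2]
  exact h

lemma pair_le (A : Finset α) (f : α → β) (T : Finset β) (hT : ∀ c ∈ A, f c ∈ T) :
    (A.card : ℝ) ^ 2 ≤ T.card * ∑ c ∈ A, ∑ d ∈ A, (if f c = f d then (1 : ℝ) else 0) := by
  have h := card_sq_le A f T hT
  rw [← prs_card A f T hT] at h
  have : ((prs A f).card : ℝ) = ∑ c ∈ A, ∑ d ∈ A, (if f c = f d then (1 : ℝ) else 0) := by
    rw [prs, Finset.card_filter, ← Finset.sum_product']
    push_cast
    rfl
  rwa [this] at h

lemma cos_nonneg_sum (A : Finset α) (f : α → ℝ) :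
    0 ≤ ∑ c ∈ A, ∑ d ∈ A, Real.cos (f c - f d) := by
  have : ∑ c ∈ A, ∑ d ∈ A, Real.cos (f c - f d) =
      (∑ c ∈ A, Real.cos (f c)) ^ 2 + (∑ c ∈ A, Real.sin (f c)) ^ 2 := by
    simp only [Real.cos_sub, Finset.sum_add_distrib, sq, Finset.sum_mul_sum]
  rw [this]
  positivity

end

section
variable {n : ℕ} {β : Type*} [DecidableEq β]

/-- distribution of coordinate `i` of the difference -/
noncomputable def rr (P : Finset ((Fin n → ℤ) × (Fin n → ℤ))) (i : Fin n) (k : ℤ) : ℝ :=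
  ((P.filter (fun p => p.1 i - p.2 i = k)).card : ℝ) / P.card

lemma rr_sum (P : Finset ((Fin n → ℤ) × (Fin n → ℤ))) (i : Fin n) (K : Finset ℤ)
    (hK : ∀ p ∈ P, p.1 i - p.2 i ∈ K) (g : ℤ → ℝ) :
    ∑ k ∈ K, rr P i k * g k = (∑ p ∈ P, g (p.1 i - p.2 i)) / P.card := by
  rw [← Finset.sum_fiberwise_of_maps_to (s := P) (t := K) (g := fun p => p.1 i - p.2 i) hK,
    Finset.sum_div]
  refine Finset.sum_congr rfl fun k _ => ?_
  have : ∑ p ∈ P.filter (fun p => p.1 i - p.2 i = k), g (p.1 i - p.2 i)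
      = ∑ p ∈ P.filter (fun p => p.1 i - p.2 i = k), g k :=
    Finset.sum_congr rfl fun p hp => by rw [(Finset.mem_filter.1 hp).2]
  rw [this, Finset.sum_const, nsmul_eq_mul, rr]
  ring

lemma feasible (q : ℕ) (hq : 2 ≤ q) (C : Finset (Fin n → ℤ))
    (hrange : ∀ c ∈ C, ∀ i : Fin n, c i ∈ Finset.Icc (0 : ℤ) ((q : ℤ) - 1))
    (L : (Fin n → ℤ) → β) (hne : C.Nonempty) (i : Fin n) :
    FourierFeasible q (rr (prs C L) i) := by
  have hT : ∀ c ∈ C, L c ∈ C.image L := fun c hc => Finset.mem_image_of_mem _ hc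
  have hK : ∀ p ∈ prs C L, p.1 i - p.2 i ∈ Finset.Icc (-(q : ℤ) + 1) ((q : ℤ) - 1) := by
    intro p hp
    simp only [prs, Finset.mem_filter, Finset.mem_product] at hp
    have h1 := hrange _ hp.1.1 i
    have h2 := hrange _ hp.1.2 i
    simp only [Finset.mem_Icc] at *
    omega
  have hpos : (0 : ℝ) < (prs C L).card := by
    obtain ⟨c, hc⟩ := hne
    have : (c, c) ∈ prs C L := by simp [prs, hc]
    exact_mod_cast Finset.card_pos.2 ⟨_, this⟩
  have hq0 : (0 : ℝ) < q := by positivity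
  refine ⟨fun k => by unfold rr; positivity, ?_, ?_, ?_, ?_, ?_⟩
  · intro k hk
    have : (prs C L).filter (fun p => p.1 i - p.2 i = k) = ∅ := by
      refine Finset.filter_eq_empty_iff.2 fun p hp h => hk (h ▸ hK p hp)
    simp [rr, this]
  · have := rr_sum (prs C L) i _ hK (fun _ => 1)
    simp only [mul_one] at this
    rw [this]
    simp [hpos.ne']
  · intro k
    unfold rr
    congr 2
    refine Finset.card_bij (fun p _ => (p.2, p.1)) ?_ ?_ ?_
    · intro p hp
      simp only [prs, Finset.mem_filter, Finset.mem_product] at hp ⊢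
      refine ⟨⟨⟨hp.1.1.2, hp.1.1.1⟩, hp.1.2.symm⟩, by omega⟩
    · rintro ⟨a, b⟩ _ ⟨c, d⟩ _ h
      simp only [Prod.mk.injEq] at h ⊢
      exact ⟨h.2, h.1⟩
    · rintro ⟨a, b⟩ hp
      simp only [prs, Finset.mem_filter, Finset.mem_product] at hp
      refine ⟨(b, a), ?_, rfl⟩
      simp only [prs, Finset.mem_filter, Finset.mem_product]
      refine ⟨⟨⟨hp.1.1.2, hp.1.1.1⟩, hp.1.2.symm⟩, by omega⟩
  · have h1 : (((prs C L).filter (fun p => p.1 i - p.2 i = 0)).card : ℝ)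
        = ∑ p ∈ prs C L, (if p.1 i = p.2 i then (1 : ℝ) else 0) := by
      rw [Finset.card_filter]
      push_cast
      simp only [sub_eq_zero]
    rw [rr, div_le_div_iff₀ hq0 hpos, one_mul, h1, prs_sum C L _ hT, prs_card C L _ hT,
      mul_comm, Finset.mul_sum]
    refine Finset.sum_le_sum fun l _ => ?_
    have := pair_le (C.filter (fun c => L c = l)) (fun c => c i) (Finset.Icc (0 : ℤ) ((q : ℤ) - 1))
      (fun c hc => hrange c (Finset.mem_filter.1 hc).1 i)
    simpa using this
  · intro θ _
    rw [rr_sum (prs C L) i _ hK (fun k => Real.cos (k * θ))]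
    refine div_nonneg ?_ hpos.le
    rw [prs_sum C L _ hT]
    refine Finset.sum_nonneg fun l _ => ?_
    have := cos_nonneg_sum (C.filter (fun c => L c = l)) (fun c => (c i : ℝ) * θ)
    simpa [sub_mul] using this

lemma bdd (q : ℕ) : BddAbove {H : ℝ | ∃ r : ℤ → ℝ, FourierFeasible q r ∧
    H = -∑ k ∈ Finset.Icc (-(q : ℤ) + 1) ((q : ℤ) - 1), r k * Real.logb 2 (r k)} := by
  refine ⟨∑ k ∈ Finset.Icc (-(q : ℤ) + 1) ((q : ℤ) - 1), 1 / Real.log 2, ?_⟩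
  rintro H ⟨r, hr, rfl⟩
  rw [← Finset.sum_neg_distrib]
  refine Finset.sum_le_sum fun k _ => ?_
  have h2 : 0 < Real.log 2 := Real.log_pos (by norm_num)
  have h0 := hr.1 k
  rw [Real.logb, ← mul_div_assoc, ← neg_div]
  refine div_le_div_of_nonneg_right ?_ h2.le
  rcases h0.eq_or_lt with h | h
  · rw [← h]; simp
  · have := Real.one_sub_inv_le_log_of_pos h
    have h3 : r k * (1 - (r k)⁻¹) ≤ r k * Real.log (r k) := mul_le_mul_of_nonneg_left this h0
    rw [mul_sub, mul_inv_cancel₀ h.ne'] at h3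
    linarith

lemma gibbs (K : Finset ℤ) (C : Finset (Fin n → ℤ)) (hB2 : IsB2 C) (hne : C.Nonempty)
    (P : Finset ((Fin n → ℤ) × (Fin n → ℤ))) (hP : P ⊆ C ×ˢ C) (hPne : P.Nonempty)
    (hdiag : (P.filter (fun p => p.1 - p.2 = 0)).card = C.card)
    (hK : ∀ p ∈ P, ∀ i, p.1 i - p.2 i ∈ K) :
    Real.log P.card ≤ ∑ i, -(∑ k ∈ K, rr P i k * Real.log (rr P i k))
      + (C.card / P.card) * Real.log C.card := by
  have hS : (0 : ℝ) < P.card := by exact_mod_cast Finset.card_pos.2 hPne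
  have hM : (0 : ℝ) < C.card := by exact_mod_cast Finset.card_pos.2 hne
  set w : (Fin n → ℤ) → ℝ := fun z => if z = 0 then (C.card : ℝ) else 1 with hw
  have hwpos : ∀ z, 0 < w z := by
    intro z; simp only [hw]; split_ifs <;> positivity
  set Q : (Fin n → ℤ) → ℝ := fun z => ∏ i, rr P i (z i) with hQ
  have hQnn : ∀ z, 0 ≤ Q z := fun z => Finset.prod_nonneg fun i _ => by unfold rr; positivity
  have hrpos : ∀ p ∈ P, ∀ i, 0 < rr P i (p.1 i - p.2 i) := by
    intro p hp i
    unfold rr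
    refine div_pos ?_ hS
    have : 0 < (P.filter (fun p' => p'.1 i - p'.2 i = p.1 i - p.2 i)).card :=
      Finset.card_pos.2 ⟨p, Finset.mem_filter.2 ⟨hp, rfl⟩⟩
    exact_mod_cast this
  have hQpos : ∀ p ∈ P, 0 < Q (p.1 - p.2) := fun p hp =>
    Finset.prod_pos fun i _ => hrpos p hp i
  have hfib : ∀ z, ((P.filter (fun p => p.1 - p.2 = z)).card : ℝ) ≤ w z := by
    intro z
    by_cases hz : z = 0
    · subst hz
      simp [hw, hdiag]
    · simp only [hw, hz, if_false]
      have : (P.filter (fun p => p.1 - p.2 = z)).card ≤ 1 := by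
        rw [Finset.card_le_one]
        rintro ⟨a, b⟩ hp ⟨c, d⟩ hp'
        simp only [Finset.mem_filter] at hp hp'
        have h1 := Finset.mem_product.1 (hP hp.1)
        have h2 := Finset.mem_product.1 (hP hp'.1)
        have h3 : a + d = c + b := by
          have := hp.2.trans hp'.2.symm
          exact sub_eq_sub_iff_add_eq_add.1 this
        rcases hB2 a h1.1 d h2.2 c h2.1 b h1.2 h3 with h | h
        · rw [h.1, h.2]
        · exact absurd (by rw [← hp.2, h.1, sub_self]) hz
      exact_mod_cast this
  have hsum : ∑ p ∈ P, Q (p.1 - p.2) / w (p.1 - p.2) ≤ 1 := by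
    rw [← Finset.sum_fiberwise_of_maps_to (s := P) (t := Fintype.piFinset fun _ : Fin n => K)
      (g := fun p => p.1 - p.2) (by
        intro p hp
        simp only [Fintype.mem_piFinset]
        exact hK p hp)]
    calc _ ≤ ∑ z ∈ Fintype.piFinset fun _ : Fin n => K, Q z := by
          refine Finset.sum_le_sum fun z _ => ?_
          have : ∑ p ∈ P.filter (fun p => p.1 - p.2 = z), Q (p.1 - p.2) / w (p.1 - p.2)
            = ∑ p ∈ P.filter (fun p => p.1 - p.2 = z), Q z / w z :=
            Finset.sum_congr rfl fun p hp => by rw [(Finset.mem_filter.1 hp).2]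
          rw [this, Finset.sum_const, nsmul_eq_mul, ← mul_div_assoc, div_le_iff₀ (hwpos z),
            mul_comm]
          exact mul_le_mul_of_nonneg_left (hfib z) (hQnn z)
      _ = ∏ i, ∑ k ∈ K, rr P i k := by
          rw [Finset.prod_univ_sum]
      _ = 1 := by
          refine Finset.prod_eq_one fun i _ => ?_
          have := rr_sum P i K (fun p hp => hK p hp i) (fun _ => 1)
          simp only [mul_one] at this
          rw [this]
          simp [hS.ne']
  have hlog : ∀ p ∈ P, Real.log P.card + ∑ i, Real.log (rr P i (p.1 i - p.2 i))
      - Real.log (w (p.1 - p.2)) ≤ P.card * (Q (p.1 - p.2) / w (p.1 - p.2)) - 1 := by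
    intro p hp
    have h := Real.log_le_sub_one_of_pos
      (mul_pos hS (div_pos (hQpos p hp) (hwpos (p.1 - p.2))))
    rw [Real.log_mul hS.ne' (div_pos (hQpos p hp) (hwpos (p.1 - p.2))).ne',
      Real.log_div (hQpos p hp).ne' (hwpos _).ne'] at h
    have h5 : Real.log (Q (p.1 - p.2)) = ∑ i, Real.log (rr P i (p.1 i - p.2 i)) :=
      Real.log_prod (fun i _ => (hrpos p hp i).ne')
    rw [h5] at h
    linarith
  have htot := Finset.sum_le_sum hlog
  rw [Finset.sum_sub_distrib, Finset.sum_add_distrib, Finset.sum_sub_distrib, ← Finset.mul_sum,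
    Finset.sum_const, Finset.sum_const, Finset.sum_comm] at htot
  simp only [nsmul_eq_mul, mul_one] at htot
  have hwl : ∑ p ∈ P, Real.log (w (p.1 - p.2)) = C.card * Real.log C.card := by
    have : ∀ p ∈ P, Real.log (w (p.1 - p.2)) = if p.1 - p.2 = 0 then Real.log C.card else 0 := by
      intro p _
      simp only [hw]
      split_ifs <;> simp
    rw [Finset.sum_congr rfl this, ← Finset.sum_filter, Finset.sum_const, hdiag, nsmul_eq_mul]
  have hent : ∑ i, -(∑ k ∈ K, rr P i k * Real.log (rr P i k))
      = - (∑ i, ∑ p ∈ P, Real.log (rr P i (p.1 i - p.2 i))) / P.card := by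
    rw [neg_div, Finset.sum_div, ← Finset.sum_neg_distrib]
    refine Finset.sum_congr rfl fun i _ => ?_
    rw [rr_sum P i K (fun p hp => hK p hp i) (fun k => Real.log (rr P i k))]
  rw [hwl] at htot
  rw [hent]
  rw [div_mul_eq_mul_div, ← add_div, le_div_iff₀ hS]
  have := mul_le_mul_of_nonneg_left hsum hS.le
  linarith

end

end B2Aux

open scoped Classical in
/-- Let `C` be a `q`-ary `B₂` code of length `n` with `M = |C| ≥ 2` and let
`e = ⌊log_q(2M) − log_q(log₂ M)⌋`, assumed to satisfy `0 ≤ e ≤ n`.  For each prefix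
`ℓ ∈ {0,…,q−1}^e` let `M_ℓ` be the number of codewords whose first `e` coordinates equal
`ℓ`.  Then `log₂(∑_ℓ M_ℓ²) ≤ (n − e) h_q^F + 2`. -/
theorem prefix_class_entropy_bound
    (q n e : ℕ) (hq : 2 ≤ q) (hn : 1 ≤ n)
    (C : Finset (Fin n → ℤ))
    (hrange : ∀ c ∈ C, ∀ i : Fin n, c i ∈ Finset.Icc (0 : ℤ) ((q : ℤ) - 1))
    (hB2 : IsB2 C)
    (hM : 2 ≤ C.card)
    (he : (e : ℤ) = ⌊Real.logb q (2 * (C.card : ℝ)) - Real.logb q (Real.logb 2 (C.card))⌋)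
    (hen : e ≤ n) :
    Real.logb 2
        (∑ ℓ ∈ Fintype.piFinset (fun _ : Fin e => Finset.Icc (0 : ℤ) ((q : ℤ) - 1)),
          ((C.filter (fun c => ∀ i : Fin e, c (Fin.castLE hen i) = ℓ i)).card : ℝ) ^ 2)
      ≤ ((n : ℝ) - (e : ℝ)) * hqF q + 2 := by
  set L : (Fin n → ℤ) → (Fin e → ℤ) := fun c i => c (Fin.castLE hen i) with hL
  set T := Fintype.piFinset (fun _ : Fin e => Finset.Icc (0 : ℤ) ((q : ℤ) - 1)) with hTdef
  have hT : ∀ c ∈ C, L c ∈ T := fun c hc => by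
    rw [hTdef, Fintype.mem_piFinset]
    exact fun i => hrange c hc _
  have hne : C.Nonempty := Finset.card_pos.1 (by omega)
  set K := Finset.Icc (-(q : ℤ) + 1) ((q : ℤ) - 1) with hKdef
  set P := B2Aux.prs C L with hPdef
  have hS : (∑ ℓ ∈ T,
      ((C.filter (fun c => ∀ i : Fin e, c (Fin.castLE hen i) = ℓ i)).card : ℝ) ^ 2)
      = P.card := by
    rw [hPdef, B2Aux.prs_card C L T hT]
    refine Finset.sum_congr rfl fun l _ => ?_
    congr 3
    ext c
    simp only [Finset.mem_filter, hL, funext_iff]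
  rw [hS]
  have hPsub : P ⊆ C ×ˢ C := Finset.filter_subset _ _
  have hmemP : ∀ p, p ∈ P ↔ (p.1 ∈ C ∧ p.2 ∈ C) ∧ L p.1 = L p.2 := by
    intro p
    simp only [hPdef, B2Aux.prs, Finset.mem_filter, Finset.mem_product]
  have hPne : P.Nonempty := by
    obtain ⟨c, hc⟩ := hne
    exact ⟨(c, c), (hmemP _).2 ⟨⟨hc, hc⟩, rfl⟩⟩
  have hS0 : (0 : ℝ) < P.card := by exact_mod_cast Finset.card_pos.2 hPne
  have hdiag : (P.filter (fun p => p.1 - p.2 = 0)).card = C.card := by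
    refine Finset.card_bij (fun p _ => p.1) ?_ ?_ ?_
    · intro p hp
      exact ((hmemP _).1 (Finset.mem_filter.1 hp).1).1.1
    · rintro ⟨a, b⟩ h ⟨c, d⟩ h' hac
      have h1 := (Finset.mem_filter.1 h).2
      have h2 := (Finset.mem_filter.1 h').2
      simp only [sub_eq_zero] at h1 h2 hac
      subst h1; subst h2; subst hac; rfl
    · intro c hc
      exact ⟨(c, c), Finset.mem_filter.2 ⟨(hmemP _).2 ⟨⟨hc, hc⟩, rfl⟩, sub_self _⟩, rfl⟩
  have hK : ∀ p ∈ P, ∀ i, p.1 i - p.2 i ∈ K := by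
    intro p hp i
    have hp := (hmemP p).1 hp
    have h1 := hrange _ hp.1.1 i
    have h2 := hrange _ hp.1.2 i
    simp only [hKdef, Finset.mem_Icc] at *
    omega
  have hg := B2Aux.gibbs K C hB2 hne P hPsub hPne hdiag hK
  have hl2 : 0 < Real.log 2 := Real.log_pos (by norm_num)
  have hg2 : Real.logb 2 P.card ≤
      ∑ i, -(∑ k ∈ K, B2Aux.rr P i k * Real.logb 2 (B2Aux.rr P i k))
      + (C.card / P.card) * Real.logb 2 C.card := by
    have := div_le_div_of_nonneg_right hg hl2.le
    refine this.trans (le_of_eq ?_)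
    simp only [Real.logb, add_div, Finset.sum_div, neg_div, mul_div_assoc]
  have hM1 : (2 : ℝ) ≤ C.card := by exact_mod_cast hM
  have hM0 : (0 : ℝ) < C.card := by linarith
  have hlogM : 0 < Real.logb 2 C.card := Real.logb_pos (by norm_num) (by linarith)
  have hq1 : (1 : ℝ) < q := by exact_mod_cast hq
  have hqe : (q : ℝ) ^ e ≤ 2 * C.card / Real.logb 2 C.card := by
    have h1 : (e : ℝ) ≤ Real.logb q (2 * (C.card : ℝ) / Real.logb 2 C.card) := by
      rw [Real.logb_div (by positivity) hlogM.ne']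
      have := Int.floor_le (Real.logb q (2 * (C.card : ℝ)) - Real.logb q (Real.logb 2 (C.card)))
      rw [← he] at this
      exact_mod_cast this
    rw [Real.le_logb_iff_rpow_le hq1 (by positivity)] at h1
    exact_mod_cast h1
  have hcs : (C.card : ℝ) ^ 2 ≤ (q : ℝ) ^ e * P.card := by
    have := B2Aux.card_sq_le C L T hT
    rw [← B2Aux.prs_card C L T hT] at this
    have hc : (T.card : ℝ) = (q : ℝ) ^ e := by
      rw [hTdef, Fintype.card_piFinset]
      simp
    rwa [hc] at this
  have htwo : (C.card / P.card : ℝ) * Real.logb 2 C.card ≤ 2 := by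
    rw [le_div_iff₀ hlogM] at hqe
    rw [div_mul_eq_mul_div, div_le_iff₀ hS0]
    have h1 := mul_le_mul_of_nonneg_right hcs hlogM.le
    have h2 := mul_le_mul_of_nonneg_right hqe hS0.le
    have h3 : (C.card : ℝ) * (C.card * Real.logb 2 C.card) ≤ C.card * (2 * P.card) := by
      nlinarith
    exact le_of_mul_le_mul_left h3 hM0
  have hterm : ∀ i : Fin n, -(∑ k ∈ K, B2Aux.rr P i k * Real.logb 2 (B2Aux.rr P i k))
      ≤ if (i : ℕ) < e then 0 else hqF q := by
    intro i
    split_ifs with hi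
    · rw [B2Aux.rr_sum P i K (fun p hp => hK p hp i) (fun k => Real.logb 2 (B2Aux.rr P i k))]
      have hz : ∀ p ∈ P, p.1 i - p.2 i = 0 := by
        intro p hp
        have := congrFun ((hmemP p).1 hp).2 ⟨i, hi⟩
        exact sub_eq_zero.2 this
      have hr1 : B2Aux.rr P i 0 = 1 := by
        unfold B2Aux.rr
        rw [Finset.filter_true_of_mem hz, div_self hS0.ne']
      rw [Finset.sum_eq_zero]
      · simp
      · intro p hp
        simp [hz p hp, hr1]
    · exact le_csSup (B2Aux.bdd q) ⟨_, B2Aux.feasible q hq C hrange L hne i, rfl⟩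
  have hsum := Finset.sum_le_sum (s := Finset.univ) fun i _ => hterm i
  have hcount : ∑ i : Fin n, (if (i : ℕ) < e then 0 else hqF q) = ((n : ℝ) - e) * hqF q := by
    obtain ⟨m, rfl⟩ := Nat.exists_eq_add_of_le hen
    rw [Fin.sum_univ_add]
    simp
  linarith
end

section
/- Let q ≥ 2 be an integer. For every ε > 0 there exists n₀ such that for all n ≥ n₀, every q-ary B_2 code C ⊆ {0,1,...,q−1}^n satisfies (1/n) · log_q |C| ≤ h_q^F / (log₂ q + h_q^F) + ε. In particular, the asymptotic rate R_b = limsup_{n→∞} (1/n) log_q |C_n| of any family of q-ary B_2 codes satisfies R_b ≤ h_q^F / (log₂ q + h_q^F). -/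
open Finset in
lemma pairs_sum_eq {α β : Type*} [DecidableEq α] [DecidableEq β] (C : Finset α) (f : α → β)
    (F : α → α → ℝ) :
    ∑ p ∈ (C ×ˢ C).filter (fun p => f p.1 = f p.2), F p.1 p.2
      = ∑ a ∈ C.image f, ∑ c ∈ C.filter (fun c => f c = a),
          ∑ d ∈ C.filter (fun c => f c = a), F c d := by
  rw [Finset.sum_filter, Finset.sum_product]
  rw [← Finset.sum_fiberwise_of_maps_to (s := C) (t := C.image f) (g := f)
    (fun x hx => Finset.mem_image_of_mem f hx)]
  refine Finset.sum_congr rfl fun a _ => Finset.sum_congr rfl fun c hc => ?_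
  rw [Finset.sum_filter]
  refine Finset.sum_congr rfl fun d _ => ?_
  have : f c = a := (Finset.mem_filter.1 hc).2
  subst this
  simp only [eq_comm]

lemma pairs_nonneg {α β : Type*} [DecidableEq α] [DecidableEq β] (C : Finset α) (f : α → β)
    (g : α → ℝ) :
    0 ≤ ∑ p ∈ (C ×ˢ C).filter (fun p => f p.1 = f p.2), g p.1 * g p.2 := by
  rw [pairs_sum_eq C f (fun x y => g x * g y)]
  refine Finset.sum_nonneg fun a _ => ?_
  rw [← Finset.sum_mul_sum]
  exact mul_self_nonneg _

lemma pairs_card {α β : Type*} [DecidableEq α] [DecidableEq β] (C : Finset α) (f : α → β) :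
    (((C ×ˢ C).filter (fun p => f p.1 = f p.2)).card : ℝ)
      = ∑ a ∈ C.image f, ((C.filter (fun c => f c = a)).card : ℝ) ^ 2 := by
  have := pairs_sum_eq C f (fun _ _ => (1 : ℝ))
  simp only [Finset.sum_const, nsmul_eq_mul, mul_one] at this
  rw [this]
  exact Finset.sum_congr rfl fun a _ => by ring

lemma pairs_cs {α β : Type*} [DecidableEq α] [DecidableEq β] (C : Finset α) (f : α → β)
    (K : Finset β) (hK : ∀ c ∈ C, f c ∈ K) :
    (C.card : ℝ) ^ 2 ≤ K.card * ((C ×ˢ C).filter (fun p => f p.1 = f p.2)).card := by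
  rw [pairs_card]
  have h1 : (C.card : ℝ) = ∑ a ∈ C.image f, ((C.filter (fun c => f c = a)).card : ℝ) := by
    have := Finset.card_eq_sum_card_image f C
    exact_mod_cast this
  have h2 : C.image f ⊆ K := by
    intro x hx
    obtain ⟨c, hc, rfl⟩ := Finset.mem_image.1 hx
    exact hK c hc
  rw [h1]
  refine (sq_sum_le_card_mul_sum_sq).trans ?_
  gcongr

lemma pairs_cs2 {α β γ : Type*} [DecidableEq α] [DecidableEq β] [DecidableEq γ]
    (C : Finset α) (f : α → β) (g : α → γ)
    (K : Finset γ) (hK : ∀ c ∈ C, g c ∈ K) :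
    (((C ×ˢ C).filter (fun p => f p.1 = f p.2)).card : ℝ) ≤
      K.card * (((C ×ˢ C).filter (fun p => f p.1 = f p.2)).filter
        (fun p => g p.1 = g p.2)).card := by
  rw [pairs_card]
  have h := pairs_sum_eq C f (fun x y => if g x = g y then (1 : ℝ) else 0)
  rw [← Finset.sum_filter] at h
  simp only [Finset.sum_const, nsmul_eq_mul, mul_one] at h
  rw [h, Finset.mul_sum]
  refine Finset.sum_le_sum fun a _ => ?_
  refine (pairs_cs (C.filter (fun c => f c = a)) g K
    (fun c hc => hK c (Finset.mem_filter.1 hc).1)).trans (le_of_eq ?_)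
  congr 1
  rw [← Finset.sum_product', ← Finset.sum_filter]
  simp

lemma hqF_bdd (q : ℕ) : BddAbove {H : ℝ | ∃ r : ℤ → ℝ, FourierFeasible q r ∧
    H = -∑ k ∈ Finset.Icc (-(q : ℤ) + 1) ((q : ℤ) - 1), r k * Real.logb 2 (r k)} := by
  refine ⟨∑ k ∈ Finset.Icc (-(q : ℤ) + 1) ((q : ℤ) - 1), 1 / Real.log 2, ?_⟩
  rintro H ⟨r, hr, rfl⟩
  rw [← Finset.sum_neg_distrib]
  refine Finset.sum_le_sum fun k _ => ?_
  have h0 := hr.1 k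
  have hl : 0 < Real.log 2 := Real.log_pos (by norm_num)
  rw [Real.logb, ← mul_div_assoc, ← neg_div]
  gcongr
  rcases h0.eq_or_lt with h | h
  · rw [← h]; simp
  · have := Real.log_le_sub_one_of_pos (inv_pos.2 h)
    rw [Real.log_inv] at this
    have h3 : r k * (-Real.log (r k)) ≤ r k * ((r k)⁻¹ - 1) := by gcongr
    rw [mul_sub, mul_inv_cancel₀ h.ne'] at h3
    linarith

lemma le_hqF (q : ℕ) (r : ℤ → ℝ) (hr : FourierFeasible q r) :
    -∑ k ∈ Finset.Icc (-(q : ℤ) + 1) ((q : ℤ) - 1), r k * Real.log (r k)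
      ≤ hqF q * Real.log 2 := by
  have h := le_csSup (hqF_bdd q) ⟨r, hr, rfl⟩
  have hl : 0 < Real.log 2 := Real.log_pos (by norm_num)
  rw [← div_le_iff₀ hl]
  refine le_trans (le_of_eq ?_) h
  rw [neg_div, Finset.sum_div]
  simp only [Real.logb, mul_div_assoc]

lemma hqF_nonneg (q : ℕ) (hq : 2 ≤ q) : 0 ≤ hqF q := by
  have hl : 0 < Real.log 2 := Real.log_pos (by norm_num)
  have hm : (0:ℤ) ∈ Finset.Icc (-(q : ℤ) + 1) ((q : ℤ) - 1) := by
    rw [Finset.mem_Icc]; omega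
  have h := le_hqF q (fun k => if k = 0 then 1 else 0) ?_
  · have h2 : (0:ℝ) ≤ hqF q * Real.log 2 := by
      refine le_trans (le_of_eq ?_) h
      rw [Finset.sum_eq_zero, neg_zero]
      intro k _
      split_ifs <;> simp
    exact nonneg_of_mul_nonneg_left h2 hl
  · refine ⟨fun k => by dsimp only; split_ifs <;> norm_num, fun k hk => ?_, ?_, fun k => by simp, ?_, ?_⟩
    · dsimp only
      rw [if_neg]; rintro rfl; exact hk hm
    · rw [Finset.sum_ite_eq' , if_pos hm]
    · simp only [if_true]
      rw [div_le_one (by positivity)]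
      exact_mod_cast (by omega : 1 ≤ q)
    · intro θ _
      refine Finset.sum_nonneg fun k _ => ?_
      dsimp only
      split_ifs with h
      · simp [h]
      · simp

/-- key map -/
def keyMap {n : ℕ} (t : ℕ) (c : Fin n → ℤ) : Fin n → ℤ := fun i => if i.val < t then c i else 0

lemma feasible_aux (q : ℕ) (hq : 2 ≤ q) {α β : Type*} [DecidableEq α] [DecidableEq β]
    (C : Finset α) (f : α → β) (g : α → ℤ) (hg : ∀ c ∈ C, g c ∈ Finset.Icc (0 : ℤ) ((q : ℤ) - 1))
    (P : Finset (α × α)) (hP : P = (C ×ˢ C).filter (fun p => f p.1 = f p.2))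
    (hN : 0 < P.card) :
    FourierFeasible q (fun k => ((P.filter (fun p => g p.1 - g p.2 = k)).card : ℝ) / P.card) := by
  have hN' : (0 : ℝ) < P.card := by exact_mod_cast hN
  have hmap : ∀ p ∈ P, g p.1 - g p.2 ∈ Finset.Icc (-(q : ℤ) + 1) ((q : ℤ) - 1) := by
    intro p hp
    rw [hP, Finset.mem_filter, Finset.mem_product] at hp
    have h1 := Finset.mem_Icc.1 (hg _ hp.1.1)
    have h2 := Finset.mem_Icc.1 (hg _ hp.1.2)
    rw [Finset.mem_Icc]; omega
  refine ⟨fun k => by positivity, ?_, ?_, ?_, ?_, ?_⟩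
  · intro k hk
    dsimp only
    rw [Finset.filter_false_of_mem]
    · simp
    · intro p hp h
      exact hk (h ▸ hmap p hp)
  · rw [← Finset.sum_div, div_eq_one_iff_eq hN'.ne']
    have := Finset.card_eq_sum_card_fiberwise (f := fun p : α × α => g p.1 - g p.2) hmap
    exact_mod_cast this.symm
  · intro k
    dsimp only
    congr 2
    refine Finset.card_bij' (fun p _ => p.swap) (fun p _ => p.swap) ?_ ?_ ?_ ?_
    · intro p hp
      simp only [hP, Finset.mem_filter, Finset.mem_product, Prod.fst_swap, Prod.snd_swap] at hp ⊢
      exact ⟨⟨⟨hp.1.1.2, hp.1.1.1⟩, hp.1.2.symm⟩, by omega⟩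
    · intro p hp
      simp only [hP, Finset.mem_filter, Finset.mem_product, Prod.fst_swap, Prod.snd_swap] at hp ⊢
      exact ⟨⟨⟨hp.1.1.2, hp.1.1.1⟩, hp.1.2.symm⟩, by omega⟩
    · intro p _; simp
    · intro p _; simp
  · have h := pairs_cs2 C f g _ hg
    rw [← hP] at h
    simp only [sub_eq_zero]
    rw [div_le_div_iff₀ (by positivity) hN', one_mul]
    refine h.trans (le_of_eq ?_)
    rw [mul_comm]
    congr 1
    simp
  · intro θ _
    have h1 := pairs_nonneg C f (fun c => Real.cos (g c * θ))
    have h2 := pairs_nonneg C f (fun c => Real.sin (g c * θ))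
    have h3 : 0 ≤ ∑ p ∈ P, Real.cos (((g p.1 - g p.2 : ℤ) : ℝ) * θ) := by
      rw [hP]
      refine (add_nonneg h1 h2).trans (le_of_eq ?_)
      rw [← Finset.sum_add_distrib]
      refine Finset.sum_congr rfl fun p _ => ?_
      rw [← Real.cos_sub]; push_cast; ring_nf
    have h4 : ∑ k ∈ Finset.Icc (-(q : ℤ) + 1) ((q : ℤ) - 1),
        ((P.filter (fun p => g p.1 - g p.2 = k)).card : ℝ) / P.card * Real.cos (k * θ)
        = (∑ p ∈ P, Real.cos (((g p.1 - g p.2 : ℤ) : ℝ) * θ)) / P.card := by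
      rw [← Finset.sum_fiberwise_of_maps_to hmap, Finset.sum_div]
      refine Finset.sum_congr rfl fun k _ => ?_
      rw [Finset.sum_congr rfl (g := fun _ => Real.cos (k * θ))]
      · simp; ring
      · intro p hp
        rw [(Finset.mem_filter.1 hp).2]
    rw [h4]
    positivity

lemma sum_log_aux (q : ℕ) {α : Type*} [DecidableEq α]
    (P : Finset α) (u : α → ℤ)
    (hmap : ∀ p ∈ P, u p ∈ Finset.Icc (-(q : ℤ) + 1) ((q : ℤ) - 1)) (hN : 0 < P.card)
    (r : ℤ → ℝ) (hr : ∀ k, r k = ((P.filter (fun p => u p = k)).card : ℝ) / P.card) :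
    ∑ p ∈ P, Real.log (r (u p)) =
      P.card * ∑ k ∈ Finset.Icc (-(q : ℤ) + 1) ((q : ℤ) - 1), r k * Real.log (r k) := by
  have hN' : (0 : ℝ) < P.card := by exact_mod_cast hN
  rw [← Finset.sum_fiberwise_of_maps_to hmap, Finset.mul_sum]
  refine Finset.sum_congr rfl fun k _ => ?_
  rw [Finset.sum_congr rfl (g := fun _ => Real.log (r k))]
  · rw [Finset.sum_const, nsmul_eq_mul, ← mul_assoc]
    congr 1
    rw [hr]; field_simp
  · intro p hp
    rw [(Finset.mem_filter.1 hp).2]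

/-- Jensen/Gibbs step. -/
lemma gibbs_aux_s12 {α : Type*} (S : Finset α) (w : α → ℝ) (hw : ∀ p ∈ S, 0 < w p)
    (hs : ∑ p ∈ S, w p ≤ 1) :
    (S.card : ℝ) * Real.log S.card ≤ - ∑ p ∈ S, Real.log (w p) := by
  rcases S.eq_empty_or_nonempty with rfl | hS
  · simp
  have hc : (0 : ℝ) < S.card := by exact_mod_cast hS.card_pos
  have h : ∀ p ∈ S, Real.log (w p) + Real.log S.card ≤ S.card * w p - 1 := by
    intro p hp
    rw [← Real.log_mul (hw p hp).ne' hc.ne', mul_comm]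
    exact Real.log_le_sub_one_of_pos (mul_pos hc (hw p hp))
  have h2 := Finset.sum_le_sum h
  rw [Finset.sum_add_distrib, Finset.sum_sub_distrib, ← Finset.mul_sum] at h2
  simp only [Finset.sum_const, nsmul_eq_mul, mul_one] at h2
  nlinarith

lemma core (q : ℕ) (hq : 2 ≤ q) (n t : ℕ) (ht : t ≤ n) (C : Finset (Fin n → ℤ))
    (hC : ∀ c ∈ C, ∀ i : Fin n, c i ∈ Finset.Icc (0 : ℤ) ((q : ℤ) - 1)) (hB : IsB2 C)
    (hne : C.Nonempty) :
    ∃ N N' : ℝ, (C.card : ℝ) ^ 2 ≤ (q : ℝ) ^ t * N ∧ N' + C.card = N ∧ 0 ≤ N' ∧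
      N' * Real.log N' ≤ N * ((n - t) * (hqF q * Real.log 2)) := by
  classical
  set P := (C ×ˢ C).filter (fun p => keyMap t p.1 = keyMap t p.2) with hP
  set P' := P.filter (fun p => p.1 ≠ p.2) with hP'
  have hdiag : (P.filter (fun p => p.1 = p.2)).card = C.card := by
    symm
    refine Finset.card_bij (fun c _ => (c, c)) ?_ ?_ ?_
    · intro c hc; simp [hP, hc]
    · intro a _ b _ h; exact (Prod.ext_iff.1 h).1
    · rintro ⟨a, b⟩ h
      simp only [hP, Finset.mem_filter, Finset.mem_product] at h
      exact ⟨a, h.1.1.1, by rw [← h.2]⟩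
  have hsum : P'.card + C.card = P.card := by
    rw [← hdiag, hP', add_comm]
    exact Finset.card_filter_add_card_filter_not (s := P) (fun p => p.1 = p.2)
  have hN : 0 < P.card := by have := hne.card_pos; omega
  have hN' : (0 : ℝ) < P.card := by exact_mod_cast hN
  refine ⟨P.card, P'.card, ?_, by exact_mod_cast hsum, by positivity, ?_⟩
  · have hK := pairs_cs C (keyMap t) (Fintype.piFinset (fun i : Fin n =>
      if i.val < t then Finset.Icc (0 : ℤ) ((q : ℤ) - 1) else {0})) (by
        intro c hc
        rw [Fintype.mem_piFinset]
        intro i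
        unfold keyMap
        split_ifs
        · exact hC c hc i
        · simp)
    refine hK.trans (le_of_eq ?_)
    congr 1
    rw [Fintype.card_piFinset]
    have : ∀ i : Fin n, (if i.val < t then Finset.Icc (0 : ℤ) ((q : ℤ) - 1) else {0}).card
        = if i.val < t then q else 1 := by
      intro i; split_ifs <;> simp
    simp only [this]
    rw [Finset.prod_ite]
    simp only [Finset.prod_const, one_pow, mul_one]
    rw [Fin.card_filter_val_lt, min_eq_right ht]
    push_cast; rfl
  · set r : Fin n → ℤ → ℝ := fun i k =>
      ((P.filter (fun p => p.1 i - p.2 i = k)).card : ℝ) / P.card with hr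
    have hf : ∀ i, FourierFeasible q (r i) := fun i =>
      feasible_aux q hq C (keyMap t) (fun c => c i) (fun c hc => hC c hc i) P hP hN
    have hmap : ∀ i, ∀ p ∈ P, p.1 i - p.2 i ∈ Finset.Icc (-(q : ℤ) + 1) ((q : ℤ) - 1) := by
      intro i p hp
      rw [hP, Finset.mem_filter, Finset.mem_product] at hp
      have h1 := Finset.mem_Icc.1 (hC _ hp.1.1 i)
      have h2 := Finset.mem_Icc.1 (hC _ hp.1.2 i)
      rw [Finset.mem_Icc]; omega
    have hpos : ∀ i, ∀ p ∈ P, 0 < r i (p.1 i - p.2 i) := by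
      intro i p hp
      refine div_pos ?_ hN'
      have : 0 < (P.filter (fun p' => p'.1 i - p'.2 i = p.1 i - p.2 i)).card :=
        Finset.card_pos.2 ⟨p, by simp [hp]⟩
      exact_mod_cast this
    have hle : ∀ i k, r i k ≤ 1 := by
      intro i k
      refine (div_le_one hN').2 ?_
      exact_mod_cast Finset.card_filter_le _ _
    set w : (Fin n → ℤ) × (Fin n → ℤ) → ℝ := fun p => ∏ i, r i (p.1 i - p.2 i) with hw
    have hwpos : ∀ p ∈ P, 0 < w p := fun p hp => Finset.prod_pos fun i _ => hpos i p hp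
    have hw1 : ∀ p ∈ P, w p ≤ 1 := fun p hp =>
      Finset.prod_le_one (fun i _ => (hpos i p hp).le) (fun i _ => hle i _)
    have hsub : P' ⊆ P := Finset.filter_subset _ _
    have hinj : Set.InjOn (fun p : (Fin n → ℤ) × (Fin n → ℤ) => p.1 - p.2) P' := by
      rintro ⟨a, b⟩ hp ⟨c, d⟩ hp' h
      simp only [hP', hP, Finset.coe_filter, Finset.mem_filter, Finset.mem_product,
        Set.mem_ofPred_eq] at hp hp' h
      have h' : a + d = c + b := by
        rw [sub_eq_sub_iff_add_eq_add] at h; exact h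
      rcases hB a hp.1.1.1 d hp'.1.1.2 c hp'.1.1.1 b hp.1.1.2 h' with ⟨h1, h2⟩ | ⟨h1, h2⟩
      · rw [h1, h2]
      · exact absurd h1 hp.2
    have hws : ∑ p ∈ P', w p ≤ 1 := by
      have e1 : ∑ p ∈ P', w p = ∑ d ∈ P'.image (fun p => p.1 - p.2), ∏ i, r i (d i) := by
        rw [Finset.sum_image hinj]
        rfl
      rw [e1]
      have e2 : ∑ d ∈ Fintype.piFinset (fun _ : Fin n =>
          Finset.Icc (-(q : ℤ) + 1) ((q : ℤ) - 1)), ∏ i, r i (d i) = 1 := by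
        rw [← Finset.prod_univ_sum]
        exact Finset.prod_eq_one fun i _ => (hf i).2.2.1
      rw [← e2]
      refine Finset.sum_le_sum_of_subset_of_nonneg ?_ ?_
      · intro d hd
        obtain ⟨p, hp, rfl⟩ := Finset.mem_image.1 hd
        rw [Fintype.mem_piFinset]
        exact fun i => hmap i p (hsub hp)
      · intro d _ _
        exact Finset.prod_nonneg fun i _ => (hf i).1 _
    refine (gibbs_aux_s12 P' w (fun p hp => hwpos p (hsub hp)) hws).trans ?_
    have s1 : ∑ p ∈ P, Real.log (w p) ≤ ∑ p ∈ P', Real.log (w p) := by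
      rw [← Finset.sum_sdiff hsub]
      have : ∑ p ∈ P \ P', Real.log (w p) ≤ 0 := Finset.sum_nonpos fun p hp => by
        have hp' := (Finset.mem_sdiff.1 hp).1
        exact Real.log_nonpos (hwpos p hp').le (hw1 p hp')
      linarith
    have s2 : ∑ p ∈ P, Real.log (w p) = ∑ i, ∑ p ∈ P, Real.log (r i (p.1 i - p.2 i)) := by
      rw [Finset.sum_comm]
      refine Finset.sum_congr rfl fun p hp => ?_
      exact Real.log_prod (fun i _ => (hpos i p hp).ne')
    have s3 : ∀ i : Fin n, -∑ p ∈ P, Real.log (r i (p.1 i - p.2 i)) ≤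
        if i.val < t then 0 else P.card * (hqF q * Real.log 2) := by
      intro i
      split_ifs with hi
      · rw [Finset.sum_eq_zero, neg_zero]
        intro p hp
        have hz : ∀ p ∈ P, p.1 i - p.2 i = 0 := by
          intro p hp
          rw [hP, Finset.mem_filter] at hp
          have := congrFun hp.2 i
          simp only [keyMap, hi, if_true] at this
          omega
        rw [hz p hp, hr]
        dsimp only
        rw [Finset.filter_true_of_mem hz, div_self hN'.ne', Real.log_one]
      · rw [sum_log_aux q P (fun p => p.1 i - p.2 i) (hmap i) hN (r i) (fun k => rfl),
          ← mul_neg]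
        gcongr
        exact le_hqF q _ (hf i)
    have s4 := Finset.sum_le_sum (fun i (_ : i ∈ Finset.univ) => s3 i)
    rw [Finset.sum_neg_distrib, ← s2, Finset.sum_ite] at s4
    have hcard : ((Finset.univ.filter (fun i : Fin n => ¬ i.val < t)).card : ℝ) = n - t := by
      have h := Finset.card_filter_add_card_filter_not (s := (Finset.univ : Finset (Fin n)))
        (fun i => i.val < t)
      rw [Fin.card_filter_val_lt, min_eq_right ht, Finset.card_univ, Fintype.card_fin] at h
      have h' : (t : ℝ) + ((Finset.univ.filter (fun i : Fin n => ¬ i.val < t)).card : ℝ) = n := by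
        exact_mod_cast h
      linarith
    rw [Finset.sum_const_zero, zero_add, Finset.sum_const, nsmul_eq_mul, hcard] at s4
    linarith

lemma main1 (q : ℕ) (hq : 2 ≤ q) :
    ∀ ε : ℝ, 0 < ε → ∃ n₀ : ℕ, ∀ n : ℕ, n₀ ≤ n → ∀ C : Finset (Fin n → ℤ),
      (∀ c ∈ C, ∀ i : Fin n, c i ∈ Finset.Icc (0 : ℤ) ((q : ℤ) - 1)) → IsB2 C →
      (1 / (n : ℝ)) * Real.logb q (C.card)
        ≤ hqF q / (Real.logb 2 q + hqF q) + ε := by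
  intro ε hε
  have hl2 : 0 < Real.log 2 := Real.log_pos (by norm_num)
  have hq1 : (1 : ℝ) < q := by exact_mod_cast (by omega : 1 < q)
  have hlq : 0 < Real.log q := Real.log_pos hq1
  have hh := hqF_nonneg q hq
  set l := Real.log q with hl
  -- natural-log entropy
  set h := hqF q * Real.log 2 with hdef
  have hh' : 0 ≤ h := by positivity
  have hβ : hqF q / (Real.logb 2 q + hqF q) = h / (l + h) := by
    rw [Real.logb, ← hl, hdef]; field_simp
  rw [hβ]
  set β := h / (l + h) with hβd
  have hlh : 0 < l + h := by positivity
  have hβ0 : 0 ≤ β := by positivity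
  have hβ1 : β ≤ 1 := by rw [hβd, div_le_one hlh]; linarith
  have hβe : (1 - β) * h = β * l := by rw [hβd]; field_simp; ring
  -- δ
  have hev : ∀ᶠ n : ℕ in Filter.atTop, Real.exp (-(ε * l * n)) ≤ min (1 / 2) (ε / (1 + 2 * ε)) := by
    have ht : Filter.Tendsto (fun n : ℕ => Real.exp (-(ε * l * n))) Filter.atTop (nhds 0) := by
      refine Real.tendsto_exp_neg_atTop_nhds_zero.comp ?_
      exact Filter.Tendsto.const_mul_atTop (by positivity) tendsto_natCast_atTop_atTop
    exact ht.eventually_le_const (by positivity)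
  have hev2 : ∀ᶠ n : ℕ in Filter.atTop, h + 1 < ε * l * n := by
    have ht : Filter.Tendsto (fun n : ℕ => ε * l * (n : ℝ)) Filter.atTop Filter.atTop :=
      Filter.Tendsto.const_mul_atTop (by positivity) tendsto_natCast_atTop_atTop
    exact ht.eventually_gt_atTop _
  obtain ⟨n₀, hn₀⟩ := Filter.eventually_atTop.1 (hev.and (hev2.and (Filter.eventually_ge_atTop 1)))
  refine ⟨n₀, fun n hn C hC hB => ?_⟩
  obtain ⟨hδ, hbig, hn1⟩ := hn₀ n hn
  have hnpos : (0 : ℝ) < n := by exact_mod_cast hn1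
  by_contra! hcon
  rw [Real.logb, ← hl, one_div, inv_mul_eq_div, lt_div_iff₀ hnpos, lt_div_iff₀ hlq] at hcon
  have hlogpos : 0 < Real.log C.card := lt_of_le_of_lt (by positivity) hcon
  have hne : C.Nonempty := by
    rw [Finset.nonempty_iff_ne_empty]; rintro rfl; simp at hlogpos
  have hM : (0 : ℝ) < C.card := by exact_mod_cast hne.card_pos
  set t := ⌊β * n⌋₊ with htd
  have ht1 : (t : ℝ) ≤ β * n := Nat.floor_le (by positivity)
  have ht2 : β * n < t + 1 := Nat.lt_floor_add_one _
  have htn : t ≤ n := by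
    have : (t : ℝ) ≤ n := ht1.trans (by nlinarith)
    exact_mod_cast this
  obtain ⟨N, N', h1, h2, h3, h4⟩ := core q hq n t htn C hC hB hne
  set M : ℝ := (C.card : ℝ) with hMd
  set δ := Real.exp (-(ε * l * n)) with hδd
  have hδ0 : 0 < δ := Real.exp_pos _
  have hδ1 : δ ≤ 1 / 2 := hδ.trans (min_le_left _ _)
  have hδ2 : δ * (1 + 2 * ε) ≤ ε := by
    rw [← le_div_iff₀ (by positivity)]; exact hδ.trans (min_le_right _ _)
  have hqt : (q : ℝ) ^ t = Real.exp (t * l) := by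
    rw [hl, Real.exp_nat_mul, Real.exp_log (by positivity)]
  have hqtM : (q : ℝ) ^ t ≤ δ * M := by
    rw [hqt, hδd, ← Real.exp_log hM, ← Real.exp_add]
    apply Real.exp_le_exp.2
    nlinarith
  have hN0 : 0 < N := by linarith
  have hMN : M ≤ δ * N := by
    have : M * M ≤ (δ * N) * M := by
      calc M * M = M ^ 2 := by ring
        _ ≤ q ^ t * N := h1
        _ ≤ (δ * M) * N := by gcongr
        _ = _ := by ring
    exact le_of_mul_le_mul_right this hM
  have hN'N : (1 - δ) * N ≤ N' := by linarith
  have hN'0 : 0 < N' := lt_of_lt_of_le (by apply mul_pos _ hN0; linarith) hN'N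
  have hlogN : 2 * Real.log M - t * l ≤ Real.log N := by
    have := Real.log_le_log (by positivity) h1
    rw [Real.log_pow, Real.log_mul (by positivity) hN0.ne', Real.log_pow, ← hl] at this
    push_cast at this
    linarith
  have hlogN' : Real.log N - 1 ≤ Real.log N' := by
    have a : N / 2 ≤ N' := by nlinarith
    have b := Real.log_le_log (by positivity) a
    rw [Real.log_div hN0.ne' (by norm_num)] at b
    have := Real.log_two_lt_d9
    linarith
  -- combine
  have hX : (β + 2 * ε) * n * l - 1 ≤ Real.log N' := by
    have a1 : (t : ℝ) * l ≤ β * n * l := by gcongr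
    linarith
  have hX0 : 0 ≤ Real.log N' := by
    have : 0 ≤ β * n * l := by positivity
    linarith
  have k1 : (1 - δ) * Real.log N' ≤ (n - t) * h := by
    have : N * ((1 - δ) * Real.log N') ≤ N * ((n - t) * h) := by
      calc _ = ((1 - δ) * N) * Real.log N' := by ring
        _ ≤ N' * Real.log N' := by gcongr
        _ ≤ _ := h4
    exact le_of_mul_le_mul_left this hN0
  have k2 : (n - t) * h ≤ β * l * n + h := by
    calc (n - t) * h ≤ (n - β * n + 1) * h := by gcongr; linarith
      _ = ((1 - β) * h) * n + h := by ring
      _ = _ := by rw [hβe]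
  have k3 : (1 - δ) * ((β + 2 * ε) * n * l - 1) ≤ β * l * n + h := by
    refine le_trans ?_ (k1.trans k2)
    gcongr
    linarith
  have k4 : δ * (β + 2 * ε) ≤ ε := le_trans (by gcongr) hδ2
  have k5 : (δ * (β + 2 * ε)) * (n * l) ≤ ε * (n * l) := by gcongr
  linarith

/-- For every `q ≥ 2` and every `ε > 0`, all sufficiently long `q`-ary `B₂` codes `C`
satisfy `(1/n) log_q |C| ≤ h_q^F/(log₂ q + h_q^F) + ε`; in particular, the asymptotic
rate of any family of `q`-ary `B₂` codes is at most `h_q^F/(log₂ q + h_q^F)`. -/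
theorem rate_upper_bound_B2
    (q : ℕ) (hq : 2 ≤ q) :
    (∀ ε : ℝ, 0 < ε → ∃ n₀ : ℕ, ∀ n : ℕ, n₀ ≤ n → ∀ C : Finset (Fin n → ℤ),
      (∀ c ∈ C, ∀ i : Fin n, c i ∈ Finset.Icc (0 : ℤ) ((q : ℤ) - 1)) → IsB2 C →
      (1 / (n : ℝ)) * Real.logb q (C.card)
        ≤ hqF q / (Real.logb 2 q + hqF q) + ε) ∧
    (∀ Cfam : (n : ℕ) → Finset (Fin n → ℤ),
      (∀ n : ℕ, (∀ c ∈ Cfam n, ∀ i : Fin n, c i ∈ Finset.Icc (0 : ℤ) ((q : ℤ) - 1)) ∧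
        IsB2 (Cfam n)) →
      Filter.limsup (fun n : ℕ => (1 / (n : ℝ)) * Real.logb q ((Cfam n).card))
          Filter.atTop
        ≤ hqF q / (Real.logb 2 q + hqF q)) := by
  refine ⟨main1 q hq, fun Cfam hfam => ?_⟩
  refine le_of_forall_pos_le_add fun ε hε => ?_
  obtain ⟨n₀, hn₀⟩ := main1 q hq ε hε
  refine Filter.limsup_le_of_le ?_ ?_
  · refine Filter.isCoboundedUnder_le_of_le Filter.atTop (x := 0) fun n => ?_
    refine mul_nonneg (by positivity) ?_
    have hlq : 0 ≤ Real.log q := Real.log_natCast_nonneg q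
    exact div_nonneg (Real.log_natCast_nonneg _) hlq
  · filter_upwards [Filter.eventually_ge_atTop n₀] with n hn
    exact hn₀ n hn (Cfam n) (hfam n).1 (hfam n).2
end

section
/- Let α ∈ (0,1) and let Ψ_α(ξ) = (1/2)[h(2ξ) + 2ξ + h(α) − α·h(ξ/α) − (1−α)·h(ξ/(1−α))]. Then Ψ_α is monotone nondecreasing on the interval [0, min{α, 1−α}]; that is, for all 0 ≤ ξ₁ ≤ ξ₂ ≤ min{α, 1−α}, Ψ_α(ξ₁) ≤ Ψ_α(ξ₂). -/
/-- The binary entropy function `h(x) = −x log₂ x − (1−x) log₂(1−x)` (in bits), with the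
convention `h(0) = h(1) = 0` (automatic since `Real.logb 2 0 = 0`). -/
noncomputable def binH (x : ℝ) : ℝ :=
  -(x * Real.logb 2 x) - (1 - x) * Real.logb 2 (1 - x)

/-- `Ψ_α(ξ) = (1/2)[h(2ξ) + 2ξ + h(α) − α h(ξ/α) − (1−α) h(ξ/(1−α))]`. -/
noncomputable def Psi (α ξ : ℝ) : ℝ :=
  (1 / 2) * (binH (2 * ξ) + 2 * ξ + binH α
    - α * binH (ξ / α) - (1 - α) * binH (ξ / (1 - α)))

lemma binH_eq_aux (x : ℝ) : binH x = Real.binEntropy x / Real.log 2 := by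
  simp only [binH, Real.binEntropy, Real.logb, Real.log_inv]
  ring

lemma psi_aux_deriv (α x : ℝ) (hx : 0 < x) (h1 : x < α) (h2 : x < 1 - α) :
    HasDerivAt (fun ξ : ℝ => Real.binEntropy (2 * ξ) + 2 * ξ * Real.log 2
      - α * Real.binEntropy (ξ / α) - (1 - α) * Real.binEntropy (ξ / (1 - α)))
      (2 * Real.log (1 - 2 * x) - Real.log (α - x) - Real.log (1 - α - x)) x := by
  have ha : 0 < α := by linarith
  have hb : 0 < 1 - α := by linarith
  have d1 := (Real.hasDerivAt_binEntropy (p := 2 * x) (by linarith) (by linarith)).comp x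
    ((hasDerivAt_id x).const_mul 2)
  have key : ∀ c : ℝ, 0 < c → x < c →
      HasDerivAt (fun ξ : ℝ => c * Real.binEntropy (ξ / c)) (Real.log (c - x) - Real.log x) x := by
    intro c hc hxc
    have hne : x / c ≠ 1 := ((div_lt_one hc).2 hxc).ne
    have d := ((Real.hasDerivAt_binEntropy (p := x / c) (by positivity) hne).comp x
      ((hasDerivAt_id x).div_const c)).const_mul c
    refine d.congr_deriv ?_
    have e : 1 - x / c = (c - x) / c := by field_simp
    rw [e, Real.log_div (by linarith) hc.ne', Real.log_div hx.ne' hc.ne']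
    field_simp
    ring
  have d2 := ((hasDerivAt_id x).const_mul 2).mul_const (Real.log 2)
  refine (((d1.add d2).sub (key α ha h1)).sub (key (1 - α) hb h2)).congr_deriv ?_
  rw [Real.log_mul (by norm_num) hx.ne']
  ring

lemma psi_aux_mono (α : ℝ) :
    MonotoneOn (fun ξ : ℝ => Real.binEntropy (2 * ξ) + 2 * ξ * Real.log 2
      - α * Real.binEntropy (ξ / α) - (1 - α) * Real.binEntropy (ξ / (1 - α)))
      (Set.Icc 0 (min α (1 - α))) := by
  apply monotoneOn_of_hasDerivWithinAt_nonneg (convex_Icc _ _)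
    (f' := fun x => 2 * Real.log (1 - 2 * x) - Real.log (α - x) - Real.log (1 - α - x))
  · apply Continuous.continuousOn
    fun_prop
  · intro x hx
    rw [interior_Icc] at hx
    obtain ⟨h0, h⟩ := hx
    rw [lt_min_iff] at h
    exact (psi_aux_deriv α x h0 h.1 h.2).hasDerivWithinAt
  · intro x hx
    rw [interior_Icc] at hx
    obtain ⟨h0, h⟩ := hx
    rw [lt_min_iff] at h
    have := Real.log_le_log (x := α - x) (y := 1 - 2 * x) (by linarith) (by linarith)
    have := Real.log_le_log (x := 1 - α - x) (y := 1 - 2 * x) (by linarith) (by linarith)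
    linarith

/-- For `α ∈ (0,1)`, `Ψ_α` is monotone nondecreasing on `[0, min{α, 1−α}]`. -/
theorem psi_monotoneOn
    (α : ℝ) (hα0 : 0 < α) (hα1 : α < 1) :
    ∀ ξ₁ ξ₂ : ℝ, 0 ≤ ξ₁ → ξ₁ ≤ ξ₂ → ξ₂ ≤ min α (1 - α) → Psi α ξ₁ ≤ Psi α ξ₂ := by
  intro x y hx hxy hy
  have hl : 0 < Real.log 2 := Real.log_pos (by norm_num)
  have hm := psi_aux_mono α ⟨hx, hxy.trans hy⟩ ⟨hx.trans hxy, hy⟩ hxy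
  have key : ∀ ξ, Psi α ξ = (Real.binEntropy (2 * ξ) + 2 * ξ * Real.log 2
      - α * Real.binEntropy (ξ / α) - (1 - α) * Real.binEntropy (ξ / (1 - α)))
      / (2 * Real.log 2) + binH α / 2 := by
    intro ξ
    simp only [Psi, binH_eq_aux]
    field_simp
    ring
  rw [key, key]
  gcongr
end

section
/- Let α ∈ (0,1). Define δ_LP(R,α) = inf{ 2(α(1−α) − β(1−β)) / (1 + 2√(β(1−β))) : 0 ≤ β ≤ α, h(β) = R } and ρ(α) = sup{ R ∈ ℝ : R = Ψ_α(δ_LP(R,α)/2) }. Let (C_n)_{n≥1} be a sequence where C_n ⊆ {0,1}^n is a binary B_2 code all of whose codewords have Hamming weight exactly w_n, with w_n/n → α as n → ∞. Then limsup_{n→∞} (1/n) log₂ |C_n| ≤ ρ(α). -/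
/-- The constant-weight linear-programming bound on the relative minimum distance:
`δ_LP(R, α) = inf { 2(α(1−α) − β(1−β))/(1 + 2√(β(1−β))) : 0 ≤ β ≤ α, h(β) = R }`. -/
noncomputable def deltaLP (R α : ℝ) : ℝ :=
  sInf {v : ℝ | ∃ β : ℝ, 0 ≤ β ∧ β ≤ α ∧ binH β = R ∧
    v = 2 * (α * (1 - α) - β * (1 - β)) / (1 + 2 * Real.sqrt (β * (1 - β)))}

/-- `ρ(α)`: the largest real solution `R` of `R = Ψ_α(δ_LP(R, α)/2)`. -/
noncomputable def rho (α : ℝ) : ℝ :=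
  sSup {R : ℝ | R = Psi α (deltaLP R α / 2)}

namespace B2LP

/-- zonal polynomials in terms of the profile counts -/
def ee : ℕ → ℝ → ℝ → ℝ → ℝ → ℝ
  | 0, _, _, _, _ => 1
  | i + 1, k, m, m', l =>
      2 * (k * l * ee i (k - 1) m m' (l - 1) - m * m' * ee i k (m - 1) (m' - 1) l)

lemma ee_succ (i : ℕ) (k m m' l : ℝ) : ee (i + 1) k m m' l =
    2 * (k * l * ee i (k - 1) m m' (l - 1) - m * m' * ee i k (m - 1) (m' - 1) l) := rfl

lemma ee_P (ν ω : ℝ) (h0 : ν ≠ 0) (h1 : ν ≠ 1) (h2 : ν ≠ 2) (i : ℕ) :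
    ∀ k m l : ℝ, k + 2 * m + l = ν + 2 * i → k + m = ω + i →
    2 * k * l * ee i (k - 1) m m (l - 1) =
      (2 * (ω * (ν - ω)) ^ 2 / (ν * (ν - 1))) * ee i k m m l
      + (1 / 2 + (ν - 2 * ω) ^ 2 / (2 * ν * (ν - 2))) * ee (i + 1) k m m l
      + (1 / (2 * (ν - 1) * (ν - 2))) * ee (i + 2) k m m l := by
  have h1' : ν - 1 ≠ 0 := sub_ne_zero.mpr h1
  have h2' : ν - 2 ≠ 0 := sub_ne_zero.mpr h2
  induction i with
  | zero =>
    intro k m l h h'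
    simp only [ee, Nat.cast_zero, mul_zero, add_zero] at *
    obtain rfl : m = ω - k := by linarith
    obtain rfl : l = ν - 2 * ω + k := by linarith
    field_simp
    ring
  | succ i ih =>
    intro k m l h h'
    push_cast at h h'
    have a := ih (k - 1) m (l - 1) (by linarith) (by linarith)
    have b := ih k (m - 1) l (by linarith) (by linarith)
    set q0 := (2 * (ω * (ν - ω)) ^ 2 / (ν * (ν - 1)))
    set q1 := (1 / 2 + (ν - 2 * ω) ^ 2 / (2 * ν * (ν - 2)))
    set q2 := (1 / (2 * (ν - 1) * (ν - 2)))
    have c := ee_succ i (k - 1) m m (l - 1)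
    rw [ee_succ (i + 2) k m m l, ee_succ (i + 1) k m m l, ee_succ i k m m l]
    linear_combination (2 * k * l) * a - 2 * m * m * b + 2 * k * l * c

/-- the extra term -/
def pp : ℕ → ℝ → ℝ → ℝ → ℝ
  | 0, _, _, _ => 0
  | i + 1, k, m, l => 2 * k * l * ee i (k - 1) m m (l - 1)

lemma ee_K (ν ω : ℝ) (h0 : ν ≠ 0) (i : ℕ) :
    ∀ k m l : ℝ, k + 2 * m + l = ν + 2 * i → k + m = ω + i →
    k * ee i k m m l =
      (ω ^ 2 / ν) * ee i k m m l + (1 / (2 * ν)) * ee (i + 1) k m m l + i * pp i k m l := by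
  induction i with
  | zero =>
    intro k m l h h'
    simp only [ee, pp, Nat.cast_zero, mul_zero, add_zero] at *
    obtain rfl : m = ω - k := by linarith
    obtain rfl : l = ν - 2 * ω + k := by linarith
    field_simp
    ring
  | succ i ih =>
    intro k m l h h'
    push_cast at h h' ⊢
    have a := ih (k - 1) m (l - 1) (by linarith) (by linarith)
    have b := ih k (m - 1) l (by linarith) (by linarith)
    have c : (i : ℝ) * (2 * k * l * pp i (k - 1) m (l - 1) - 2 * m * m * pp i k (m - 1) l)
        = i * pp (i + 1) k m l := by
      cases i with
      | zero => simp
      | succ i => simp only [pp, ee_succ i (k - 1)]; ring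
    have d : pp (i + 1) k m l = 2 * k * l * ee i (k - 1) m m (l - 1) := rfl
    rw [ee_succ (i + 1) k, ee_succ i k]
    linear_combination (2 * k * l) * a - 2 * m * m * b + c - d

noncomputable def cC (n _w i : ℝ) : ℝ := 1 / (2 * (n - 2 * i)) + i / (2 * (n - 2 * i) * (n - 2 * i + 1))
noncomputable def cB (n w i : ℝ) : ℝ :=
  (w - i) ^ 2 / (n - 2 * i) + i / 2 + i * (n - 2 * w) ^ 2 / (2 * (n - 2 * i) * (n - 2 * i + 2))
noncomputable def cA (n w i : ℝ) : ℝ :=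
  2 * i * (w - i + 1) ^ 2 * (n - w - i + 1) ^ 2 / ((n - 2 * i + 2) * (n - 2 * i + 1))

lemma ee_rec (n w : ℝ) (i : ℕ) (h : 2 * ((i : ℝ) + 1) < n) (k : ℝ) :
    k * ee (i + 1) k (w - k) (w - k) (n - 2 * w + k) =
      cC n w (i + 1) * ee (i + 2) k (w - k) (w - k) (n - 2 * w + k)
      + cB n w (i + 1) * ee (i + 1) k (w - k) (w - k) (n - 2 * w + k)
      + cA n w (i + 1) * ee i k (w - k) (w - k) (n - 2 * w + k) := by
  have a := ee_K (n - 2 * (i + 1)) (w - (i + 1)) (by linarith) (i + 1) k (w - k) (n - 2 * w + k)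
    (by push_cast; ring) (by push_cast; ring)
  have b := ee_P (n - 2 * i) (w - i) (by linarith) (by linarith) (by linarith) i k (w - k)
    (n - 2 * w + k) (by push_cast; ring) (by push_cast; ring)
  rw [a]
  simp only [pp]
  rw [b]
  unfold cC cB cA
  have e1 : n - 2 * (i + 1) ≠ 0 := by linarith
  have e2 : n - 2 * (i + 1) + 1 ≠ 0 := by linarith
  have e3 : n - 2 * (i + 1) + 2 ≠ 0 := by linarith
  have e4 : n - 2 * (i : ℝ) = n - 2 * (i + 1) + 2 := by ring
  have e5 : n - 2 * (i : ℝ) - 1 = n - 2 * (i + 1) + 1 := by ring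
  have e6 : n - 2 * (i : ℝ) - 2 = n - 2 * (i + 1) := by ring
  rw [e5, e6, e4]
  push_cast
  generalize hν : n - 2 * ((i:ℝ) + 1) = ν at *
  obtain rfl : n = ν + 2 * (i + 1) := by linarith
  field_simp
  ring

end B2LP

namespace B2LP

/-- Kernels that are finite sums of rank-one kernels `u ⊗ u`, `u ∈ U`. -/
inductive FK {X : Type} (U : Submodule ℝ (X → ℝ)) : (X → X → ℝ) → Prop
  | zero : FK U (fun _ _ => 0)
  | one (u : X → ℝ) (hu : u ∈ U) : FK U (fun x y => u x * u y)
  | add (K L : X → X → ℝ) (hK : FK U K) (hL : FK U L) : FK U (fun x y => K x y + L x y)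

variable {X : Type}

lemma FK.sum {U : Submodule ℝ (X → ℝ)} {ι : Type*} (s : Finset ι) (K : ι → X → X → ℝ)
    (h : ∀ i ∈ s, FK U (K i)) : FK U (fun x y => ∑ i ∈ s, K i x y) := by
  classical
  induction s using Finset.induction_on with
  | empty => simpa using FK.zero
  | insert a s ha ih =>
    simp only [Finset.sum_insert ha]
    exact FK.add _ _ (h a (by simp)) (ih fun i hi => h i (by simp [hi]))

lemma FK.smul {U : Submodule ℝ (X → ℝ)} {K : X → X → ℝ} (h : FK U K) (c : ℝ) (hc : 0 ≤ c) :
    FK U (fun x y => c * K x y) := by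
  induction h with
  | zero => simpa using FK.zero
  | one u hu =>
    have := FK.one (U := U) (Real.sqrt c • u) (U.smul_mem _ hu)
    convert this using 3 with x y
    simp only [Pi.smul_apply, smul_eq_mul]
    linear_combination (-(u x * u y)) * Real.mul_self_sqrt hc
  | add K L _ _ hK hL =>
    simp only [mul_add]
    exact FK.add _ _ hK hL

lemma FK.conj {U V : Submodule ℝ (X → ℝ)} {K : X → X → ℝ} (h : FK U K) (f : X → ℝ)
    (hf : ∀ u ∈ U, f * u ∈ V) :
    FK V (fun x y => f x * f y * K x y) := by
  induction h with
  | zero => simpa using FK.zero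
  | one u hu =>
    have := FK.one (U := V) (f * u) (hf u hu)
    convert this using 3 with x y
    simp only [Pi.mul_apply]
    ring
  | add K L _ _ hK hL =>
    simp only [mul_add]
    exact FK.add _ _ hK hL

lemma FK.mono {U V : Submodule ℝ (X → ℝ)} {K : X → X → ℝ} (h : FK U K) (hUV : U ≤ V) :
    FK V K := by
  induction h with
  | zero => exact FK.zero
  | one u hu => exact FK.one u (hUV hu)
  | add K L _ _ hK hL => exact FK.add _ _ hK hL

lemma FK.mul {U V : Submodule ℝ (X → ℝ)} {K L : X → X → ℝ} (h : FK U K) (h' : FK V L) :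
    FK ⊤ (fun x y => K x y * L x y) := by
  induction h with
  | zero => simpa using FK.zero
  | one u hu => exact h'.conj u (fun _ _ => trivial)
  | add K L _ _ hK hL =>
    simp only [add_mul]
    exact FK.add _ _ hK hL

lemma FK.nonneg {U : Submodule ℝ (X → ℝ)} {K : X → X → ℝ} (h : FK U K) (s : Finset X)
    (c : X → ℝ) : 0 ≤ ∑ x ∈ s, ∑ y ∈ s, c x * c y * K x y := by
  induction h with
  | zero => simp
  | one u hu =>
    have : ∑ x ∈ s, ∑ y ∈ s, c x * c y * (u x * u y) = (∑ x ∈ s, c x * u x) ^ 2 := by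
      rw [sq, Finset.sum_mul_sum]
      refine Finset.sum_congr rfl fun x _ => Finset.sum_congr rfl fun y _ => by ring
    rw [this]; positivity
  | add K L _ _ hK hL =>
    simp only [mul_add, Finset.sum_add_distrib]
    exact add_nonneg hK hL

lemma FK.col {U : Submodule ℝ (X → ℝ)} {K : X → X → ℝ} (h : FK U K) (y : X) :
    (fun x => K x y) ∈ U := by
  induction h with
  | zero => exact U.zero_mem
  | one u hu =>
    have := U.smul_mem (u y) hu
    convert this using 1
    ext x; simp [mul_comm]
  | add K L _ _ hK hL => exact U.add_mem hK hL

variable {n : ℕ}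

/-- indicator -/
def ind (a : Fin n) (x : Finset (Fin n)) : ℝ := if a ∈ x then 1 else 0

def s11 (S x y : Finset (Fin n)) : ℝ := ∑ a ∈ S, ind a x * ind a y
def s10 (S x y : Finset (Fin n)) : ℝ := ∑ a ∈ S, ind a x * (1 - ind a y)
def s01 (S x y : Finset (Fin n)) : ℝ := ∑ a ∈ S, (1 - ind a x) * ind a y
def s00 (S x y : Finset (Fin n)) : ℝ := ∑ a ∈ S, (1 - ind a x) * (1 - ind a y)

/-- the kernel attached to `ee i` on the coordinate set `S` -/
def kap (i : ℕ) (S x y : Finset (Fin n)) : ℝ := ee i (s11 S x y) (s10 S x y) (s01 S x y) (s00 S x y)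

lemma sum_erase2 (S : Finset (Fin n)) (a b : Fin n) (ha : a ∈ S) (hb : b ∈ S) (hab : a ≠ b)
    (f : Fin n → ℝ) : ∑ c ∈ (S.erase a).erase b, f c = ∑ c ∈ S, f c - f a - f b := by
  have h1 := Finset.add_sum_erase S f ha
  have h2 := Finset.add_sum_erase (S.erase a) f (Finset.mem_erase.mpr ⟨hab.symm, hb⟩)
  linarith

lemma kap_succ (i : ℕ) (S x y : Finset (Fin n)) :
    kap (i + 1) S x y = ∑ a ∈ S, ∑ b ∈ S,
      (ind a x - ind b x) * (ind a y - ind b y) * kap i ((S.erase a).erase b) x y := by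
  set E1 := ee i (s11 S x y - 1) (s10 S x y) (s01 S x y) (s00 S x y - 1) with hE1
  set E2 := ee i (s11 S x y) (s10 S x y - 1) (s01 S x y - 1) (s00 S x y) with hE2
  have key : ∀ a ∈ S, ∀ b ∈ S,
      (ind a x - ind b x) * (ind a y - ind b y) * kap i ((S.erase a).erase b) x y =
      (ind a x * ind a y) * ((1 - ind b x) * (1 - ind b y)) * E1
      + ((1 - ind a x) * (1 - ind a y)) * (ind b x * ind b y) * E1
      - (ind a x * (1 - ind a y)) * ((1 - ind b x) * ind b y) * E2
      - ((1 - ind a x) * ind a y) * (ind b x * (1 - ind b y)) * E2 := by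
    intro a ha b hb
    by_cases hab : a = b
    · subst hab
      by_cases h1 : a ∈ x <;> by_cases h2 : a ∈ y <;> simp [ind, h1, h2]
    · unfold kap
      rw [s11, s10, s01, s00, sum_erase2 S a b ha hb hab, sum_erase2 S a b ha hb hab,
        sum_erase2 S a b ha hb hab, sum_erase2 S a b ha hb hab]
      change _ * _ * ee i (s11 S x y - _ - _) (s10 S x y - _ - _) (s01 S x y - _ - _)
        (s00 S x y - _ - _) = _
      by_cases h1 : a ∈ x <;> by_cases h2 : a ∈ y <;> by_cases h3 : b ∈ x <;> by_cases h4 : b ∈ y <;>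
        simp [ind, h1, h2, h3, h4, hE1, hE2]
  rw [Finset.sum_congr rfl fun a ha => Finset.sum_congr rfl fun b hb => key a ha b hb]
  simp only [Finset.sum_sub_distrib, Finset.sum_add_distrib, ← Finset.sum_mul,
    ← Finset.mul_sum]
  change ee (i + 1) _ _ _ _ = s11 S x y * s00 S x y * E1 + s00 S x y * s11 S x y * E1
    - s10 S x y * s01 S x y * E2 - s01 S x y * s10 S x y * E2
  rw [ee_succ]
  ring

/-- monomials -/
def mono (S : Finset (Fin n)) (x : Finset (Fin n)) : ℝ := if S ⊆ x then 1 else 0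

/-- functions of degree at most `i` -/
def Udeg (n i : ℕ) : Submodule ℝ (Finset (Fin n) → ℝ) :=
  Submodule.span ℝ (((Finset.univ.filter fun S : Finset (Fin n) => S.card ≤ i).image mono : Finset _) : Set _)

lemma mono_mem {i : ℕ} {S : Finset (Fin n)} (h : S.card ≤ i) : mono S ∈ Udeg n i := by
  apply Submodule.subset_span
  simp only [Finset.coe_image, Set.mem_image]
  exact ⟨S, by simpa using h, rfl⟩

lemma Udeg_mono {i j : ℕ} (h : i ≤ j) : Udeg n i ≤ Udeg n j := by
  apply Submodule.span_mono
  intro f hf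
  simp only [Finset.coe_image, Set.mem_image] at *
  obtain ⟨S, hS, rfl⟩ := hf
  exact ⟨S, by simp at *; omega, rfl⟩

lemma ind_mul_mem {i : ℕ} (a : Fin n) (u) (hu : u ∈ Udeg n i) : ind a * u ∈ Udeg n (i + 1) := by
  induction hu using Submodule.span_induction with
  | mem f hf =>
    simp only [Finset.coe_image, Set.mem_image] at hf
    obtain ⟨S, hS, rfl⟩ := hf
    have : ind a * mono S = mono (insert a S) := by
      ext x
      by_cases h : a ∈ x <;> by_cases h' : S ⊆ x <;>
        simp [ind, mono, h, h', Finset.insert_subset_iff]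
    rw [this]
    refine mono_mem ((Finset.card_insert_le _ _).trans ?_)
    simp at hS; omega
  | zero => simp
  | add f g _ _ hf hg => rw [mul_add]; exact add_mem hf hg
  | smul c f _ hf => rw [mul_smul_comm]; exact Submodule.smul_mem _ _ hf

lemma kap_FK (i : ℕ) : ∀ S : Finset (Fin n), FK (Udeg n i) (fun x y => kap i S x y) := by
  induction i with
  | zero =>
    intro S
    have h := FK.one (U := Udeg n 0) (mono ∅) (mono_mem (by simp))
    convert h using 3 with x y
    simp [kap, ee, mono]
  | succ i ih =>
    intro S
    simp only [kap_succ]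
    refine FK.sum _ _ fun a _ => FK.sum _ _ fun b _ => ?_
    refine (ih ((S.erase a).erase b)).conj (fun x => ind a x - ind b x) ?_
    intro u hu
    have : (fun x => ind a x - ind b x) * u = ind a * u - ind b * u := by
      ext x; simp [sub_mul]
    rw [this]
    exact sub_mem (ind_mul_mem a u hu) (ind_mul_mem b u hu)

lemma Udeg_finrank (n i : ℕ) : Module.finrank ℝ (Udeg n i) ≤
    (Finset.univ.filter fun S : Finset (Fin n) => S.card ≤ i).card := by
  exact (finrank_span_finset_le_card _).trans Finset.card_image_le

/-- value on the slice -/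
def zz (n w i : ℕ) (k : ℕ) : ℝ := ee i k (w - k) (w - k) (n - 2 * w + k)

lemma kap_slice {w : ℕ} (i : ℕ) (x y : Finset (Fin n)) (hx : x.card = w) (hy : y.card = w) :
    kap i Finset.univ x y = zz n w i (x ∩ y).card := by
  have e11 : s11 Finset.univ x y = ((x ∩ y).card : ℝ) := by
    have : ∀ a, ind a x * ind a y = if a ∈ x ∩ y then 1 else 0 := by
      intro a
      by_cases h1 : a ∈ x <;> by_cases h2 : a ∈ y <;> simp [ind, h1, h2]
    simp [s11, this, Finset.inter_comm, -Finset.mem_inter]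
  have ex : ∀ x : Finset (Fin n), ∑ a : Fin n, ind a x = (x.card : ℝ) := by
    intro x; simp [ind]
  have e10 : s10 Finset.univ x y = w - ((x ∩ y).card : ℝ) := by
    rw [← e11, ← hx, ← ex, s11, s10, ← Finset.sum_sub_distrib]
    exact Finset.sum_congr rfl fun _ _ => by ring
  have e01 : s01 Finset.univ x y = w - ((x ∩ y).card : ℝ) := by
    rw [← e11, ← hy, ← ex, s11, s01, ← Finset.sum_sub_distrib]
    exact Finset.sum_congr rfl fun _ _ => by ring
  have e00 : s00 Finset.univ x y = n - 2 * w + ((x ∩ y).card : ℝ) := by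
    have : (∑ a : Fin n, (1 : ℝ)) = n := by simp
    have h1 : s00 Finset.univ x y = (∑ a : Fin n, (1 : ℝ)) - ∑ a, ind a x - ∑ a, ind a y
        + s11 Finset.univ x y := by
      rw [s11, s00, ← Finset.sum_sub_distrib, ← Finset.sum_sub_distrib, ← Finset.sum_add_distrib]
      exact Finset.sum_congr rfl fun _ _ => by ring
    rw [h1, this, ex, ex, hx, hy, e11]; ring
  rw [kap, e11, e10, e01, e00, zz]

end B2LP

namespace B2LP

lemma trace_ineq {X : Type} [Fintype X] (U : Submodule ℝ (X → ℝ)) (D : ℕ)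
    (hD : Module.finrank ℝ U ≤ D) (s : Finset X) (K : X → X → ℝ)
    (hK : ∀ y, (fun x => K x y) ∈ U) :
    (∑ x ∈ s, K x x) ^ 2 ≤ D * ∑ x ∈ s, ∑ y ∈ s, K x y ^ 2 := by
  classical
  let r : (X → ℝ) →ₗ[ℝ] EuclideanSpace ℝ s :=
    { toFun := fun f => WithLp.toLp 2 (fun x => f x)
      map_add' := fun _ _ => rfl
      map_smul' := fun _ _ => rfl }
  let V := U.map r
  have hV : Module.finrank ℝ V ≤ D := (Submodule.finrank_map_le r U).trans hD
  let b := stdOrthonormalBasis ℝ V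
  let g : s → V := fun y => ⟨r (fun x => K x y), Submodule.mem_map_of_mem (hK y)⟩
  let d := Module.finrank ℝ V
  have hg : ∀ y x : s, K x y = ∑ a, inner ℝ (b a) (g y) * (b a : EuclideanSpace ℝ s) x := by
    intro y x
    have h1 := b.sum_repr' (g y)
    have h2 : (g y : EuclideanSpace ℝ s) x = K x y := rfl
    rw [← h2]
    conv_lhs => rw [← h1]
    simp
  have hn : ∀ y : s, ∑ a, inner ℝ (b a) (g y) ^ 2 = ∑ x : s, K x y ^ 2 := by
    intro y
    have h1 := b.sum_sq_norm_inner_right (g y)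
    have h3 : ‖g y‖ ^ 2 = ∑ x : s, K x y ^ 2 := by
      rw [Submodule.coe_norm, EuclideanSpace.norm_sq_eq]
      refine Finset.sum_congr rfl fun x _ => ?_
      rw [Real.norm_eq_abs, sq_abs]; rfl
    rw [← h3, ← h1]
    simp
  have hb : ∀ a, ∑ x : s, ((b a : EuclideanSpace ℝ s) x) ^ 2 = 1 := by
    intro a
    have h1 : ‖b a‖ = 1 := b.orthonormal.1 a
    have h3 : ‖b a‖ ^ 2 = ∑ x : s, ((b a : EuclideanSpace ℝ s) x) ^ 2 := by
      rw [Submodule.coe_norm, EuclideanSpace.norm_sq_eq]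
      refine Finset.sum_congr rfl fun x _ => ?_
      rw [Real.norm_eq_abs, sq_abs]
    rw [← h3, h1]; simp
  have e1 : ∑ x ∈ s, K x x = ∑ p : s × Fin (Module.finrank ℝ V),
      inner ℝ (b p.2) (g p.1) * (b p.2 : EuclideanSpace ℝ s) p.1 := by
    rw [Fintype.sum_prod_type, ← Finset.sum_coe_sort s]
    exact Finset.sum_congr rfl fun y _ => hg y y
  have e2 : ∑ x ∈ s, ∑ y ∈ s, K x y ^ 2 = ∑ p : s × Fin (Module.finrank ℝ V),
      inner ℝ (b p.2) (g p.1) ^ 2 := by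
    rw [Fintype.sum_prod_type, Finset.sum_comm, ← Finset.sum_coe_sort s]
    refine Finset.sum_congr rfl fun y _ => ?_
    rw [hn y, ← Finset.sum_coe_sort s]
  have e3 : ∑ p : s × Fin (Module.finrank ℝ V), ((b p.2 : EuclideanSpace ℝ s) p.1) ^ 2
      = Module.finrank ℝ V := by
    rw [Fintype.sum_prod_type, Finset.sum_comm]
    rw [Finset.sum_congr rfl fun a _ => hb a]
    simp
  have := Finset.sum_mul_sq_le_sq_mul_sq Finset.univ
    (fun p : s × Fin (Module.finrank ℝ V) => inner ℝ (b p.2) (g p.1))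
    (fun p => (b p.2 : EuclideanSpace ℝ s) p.1)
  rw [← e1, ← e2, e3] at this
  refine this.trans ?_
  rw [mul_comm]
  refine mul_le_mul_of_nonneg_right (by exact_mod_cast hV) ?_
  exact Finset.sum_nonneg fun _ _ => Finset.sum_nonneg fun _ _ => sq_nonneg _

variable {n : ℕ}

lemma card_inter_eq (w k : ℕ) (hk : k ≤ w) (x : Finset (Fin n)) (hx : x.card = w) :
    ((Finset.powersetCard w (Finset.univ : Finset (Fin n))).filter
      fun y => (x ∩ y).card = k).card = w.choose k * (n - w).choose (w - k) := by
  have hc : xᶜ.card = n - w := by rw [Finset.card_compl, hx]; simp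
  have : (Finset.powersetCard k x ×ˢ Finset.powersetCard (w - k) xᶜ).card
      = w.choose k * (n - w).choose (w - k) := by
    rw [Finset.card_product, Finset.card_powersetCard, Finset.card_powersetCard, hx, hc]
  rw [← this]
  refine Finset.card_nbij' (fun y => (x ∩ y, y \ x)) (fun p => p.1 ∪ p.2) ?_ ?_ ?_ ?_
  · intro y hy
    simp only [Finset.coe_filter, Finset.mem_powersetCard, Set.mem_ofPred_eq] at hy
    have h := Finset.card_inter_add_card_sdiff y x
    rw [Finset.inter_comm] at h
    simp only [Finset.coe_product, Set.mem_prod, Finset.mem_coe, Finset.mem_powersetCard]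
    refine ⟨⟨Finset.inter_subset_left, hy.2⟩, ?_, by omega⟩
    intro a; simp
  · rintro ⟨p, q⟩ hpq
    simp only [Finset.coe_product, Set.mem_prod, Finset.mem_coe, Finset.mem_powersetCard] at hpq
    obtain ⟨⟨h1, h2⟩, h3, h4⟩ := hpq
    have hd : Disjoint x q := Finset.disjoint_left.mpr fun a ha hq => by
      have := h3 hq; simp at this; exact this ha
    have hd' : Disjoint p q := hd.mono_left h1
    simp only [Finset.coe_filter, Finset.mem_powersetCard, Set.mem_ofPred_eq, Finset.subset_univ,
      true_and]
    refine ⟨by rw [Finset.card_union_of_disjoint hd']; omega, ?_⟩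
    rw [Finset.inter_union_distrib_left, Finset.disjoint_iff_inter_eq_empty.mp hd,
      Finset.union_empty, Finset.inter_eq_right.mpr h1, h2]
  · intro y _
    ext a; simp; tauto
  · rintro ⟨p, q⟩ hpq
    simp only [Finset.coe_product, Set.mem_prod, Finset.mem_coe, Finset.mem_powersetCard] at hpq
    obtain ⟨⟨h1, h2⟩, h3, h4⟩ := hpq
    have h3' : ∀ a ∈ q, a ∉ x := fun a ha => by have := h3 ha; simpa using this
    ext a
    · simp only [Finset.mem_inter, Finset.mem_union]
      exact ⟨fun ⟨h, h'⟩ => h'.resolve_right fun hq => h3' a hq h, fun h => ⟨h1 h, Or.inl h⟩⟩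
    · simp only [Finset.mem_sdiff, Finset.mem_union]
      exact ⟨fun ⟨h, h'⟩ => h.resolve_left fun hq => h' (h1 hq), fun h => ⟨Or.inr h, h3' a h⟩⟩

/-- number of ordered pairs with intersection size `k` -/
def BB (C : Finset (Finset (Fin n))) (k : ℕ) : ℕ :=
  ((C ×ˢ C).filter fun p => (p.1 ∩ p.2).card = k).card

lemma sum_BB (C : Finset (Finset (Fin n))) (w : ℕ) (hC : ∀ x ∈ C, x.card = w) (φ : ℕ → ℝ) :
    ∑ x ∈ C, ∑ y ∈ C, φ (x ∩ y).card = ∑ k ∈ Finset.range (w + 1), BB C k * φ k := by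
  rw [← Finset.sum_product']
  rw [← Finset.sum_fiberwise_of_maps_to (s := C ×ˢ C) (t := Finset.range (w + 1))
    (g := fun p => (p.1 ∩ p.2).card)]
  · refine Finset.sum_congr rfl fun k _ => ?_
    rw [Finset.sum_congr rfl (g := fun _ => φ k), Finset.sum_const, nsmul_eq_mul, BB]
    intro p hp
    rw [(Finset.mem_filter.mp hp).2]
  · intro p hp
    rw [Finset.mem_product] at hp
    have := Finset.card_le_card (Finset.inter_subset_left (s₁ := p.1) (s₂ := p.2))
    rw [hC _ hp.1] at this
    simpa [Nat.lt_succ_iff] using this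

lemma sum_row (w : ℕ) (x : Finset (Fin n)) (hx : x.card = w) (φ : ℕ → ℝ) :
    ∑ y ∈ Finset.powersetCard w (Finset.univ : Finset (Fin n)), φ (x ∩ y).card
      = ∑ k ∈ Finset.range (w + 1), ((w.choose k * (n - w).choose (w - k) : ℕ) : ℝ) * φ k := by
  rw [← Finset.sum_fiberwise_of_maps_to (t := Finset.range (w + 1))
    (g := fun y => (x ∩ y).card)]
  · refine Finset.sum_congr rfl fun k hk => ?_
    rw [Finset.sum_congr rfl (g := fun _ => φ k), Finset.sum_const, nsmul_eq_mul, card_inter_eq w k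
      (by simpa [Nat.lt_succ_iff] using hk) x hx]
    intro p hp
    rw [(Finset.mem_filter.mp hp).2]
  · intro y hy
    have := Finset.card_le_card (Finset.inter_subset_left (s₁ := x) (s₂ := y))
    rw [hx] at this
    simpa [Nat.lt_succ_iff] using this

lemma BB_diag (C : Finset (Finset (Fin n))) (w : ℕ) (hC : ∀ x ∈ C, x.card = w) :
    BB C w = C.card := by
  rw [← Finset.diag_card C, BB]
  congr 1
  ext ⟨x, y⟩
  simp only [Finset.mem_filter, Finset.mem_product, Finset.mem_diag]
  constructor
  · rintro ⟨⟨hx, hy⟩, h⟩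
    refine ⟨hx, ?_⟩
    have h1 : x ∩ y = x := Finset.eq_of_subset_of_card_le Finset.inter_subset_left (by rw [h, hC x hx])
    have h2 : x ∩ y = y := Finset.eq_of_subset_of_card_le Finset.inter_subset_right (by rw [h, hC y hy])
    rw [← h1, h2]
  · rintro ⟨hx, rfl⟩
    exact ⟨⟨hx, hx⟩, by rw [Finset.inter_self, hC x hx]⟩

lemma avg_ineq (w : ℕ) (C : Finset (Finset (Fin n))) (hC : ∀ x ∈ C, x.card = w)
    (hne : C.Nonempty)
    (G : ℕ → ℝ) (g : Finset (Fin n) → Finset (Fin n) → ℝ) (U) (hg : FK U g)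
    (hgG : ∀ x y, x.card = w → y.card = w → g x y = G (x ∩ y).card) :
    (C.card : ℝ) ^ 2 * ∑ k ∈ Finset.range (w + 1), ((w.choose k * (n - w).choose (w - k) : ℕ) : ℝ) * G k
      ≤ n.choose w * ∑ x ∈ C, ∑ y ∈ C, G (x ∩ y).card := by
  classical
  set P := Finset.powersetCard w (Finset.univ : Finset (Fin n)) with hP
  set r := ∑ k ∈ Finset.range (w + 1), ((w.choose k * (n - w).choose (w - k) : ℕ) : ℝ) * G k
  have hCP : C ⊆ P := fun x hx => by simp [hP, hC x hx]
  have hPc : P.card = n.choose w := by simp [hP]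
  have hmem : ∀ x ∈ P, x.card = w := fun x hx => by simpa [hP] using hx
  have hNpos : (0 : ℝ) < n.choose w := by
    rw [← hPc]; exact_mod_cast (hne.mono hCP).card_pos
  set N : ℝ := ((n.choose w : ℕ) : ℝ)
  set c : ℝ := ((C.card : ℕ) : ℝ)
  have h := hg.nonneg P (fun x => (if x ∈ C then N else 0) - c)
  have e : ∀ x ∈ P, ∀ y ∈ P, ((if x ∈ C then N else 0) - c) * ((if y ∈ C then N else 0) - c) * g x y
      = (if x ∈ C then (if y ∈ C then N * N * G (x ∩ y).card else 0) else 0)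
        - (if x ∈ C then N * c * G (x ∩ y).card else 0) - (if y ∈ C then N * c * G (y ∩ x).card else 0)
        + c * c * G (x ∩ y).card := by
    intro x hx y hy
    rw [hgG x y (hmem x hx) (hmem y hy), Finset.inter_comm y x]
    split_ifs <;> ring
  rw [Finset.sum_congr rfl fun x hx => Finset.sum_congr rfl fun y hy => e x hx y hy] at h
  have hrow : ∀ x ∈ P, ∑ y ∈ P, G (x ∩ y).card = r := fun x hx => sum_row w x (hmem x hx) G
  have hPC : P.filter (· ∈ C) = C := by
    ext x; simp only [Finset.mem_filter]; exact ⟨fun h => h.2, fun h => ⟨hCP h, h⟩⟩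
  simp only [Finset.sum_add_distrib, Finset.sum_sub_distrib] at h
  have t1 : ∑ x ∈ P, ∑ y ∈ P, (if x ∈ C then (if y ∈ C then N * N * G (x ∩ y).card else 0) else 0)
      = N * N * ∑ x ∈ C, ∑ y ∈ C, G (x ∩ y).card := by
    have : ∀ x ∈ P, ∑ y ∈ P, (if x ∈ C then (if y ∈ C then N * N * G (x ∩ y).card else 0) else 0)
      = if x ∈ C then ∑ y ∈ C, N * N * G (x ∩ y).card else 0 := by
      intro x hx
      split_ifs
      · rw [← Finset.sum_filter, hPC]
      · simp
    rw [Finset.sum_congr rfl this, ← Finset.sum_filter, hPC, Finset.mul_sum]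
    simp only [Finset.mul_sum]
  have t2 : ∑ x ∈ P, ∑ y ∈ P, (if x ∈ C then N * c * G (x ∩ y).card else 0) = N * c * (c * r) := by
    have : ∀ x ∈ P, ∑ y ∈ P, (if x ∈ C then N * c * G (x ∩ y).card else 0)
      = if x ∈ C then N * c * r else 0 := by
      intro x hx
      split_ifs
      · rw [← Finset.mul_sum, hrow x hx]
      · simp
    rw [Finset.sum_congr rfl this, ← Finset.sum_filter, hPC, Finset.sum_const, nsmul_eq_mul]
    ring
  have t3 : ∑ x ∈ P, ∑ y ∈ P, (if y ∈ C then N * c * G (y ∩ x).card else 0) = N * c * (c * r) := by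
    rw [Finset.sum_comm]; exact t2
  have t4 : ∑ x ∈ P, ∑ y ∈ P, c * c * G (x ∩ y).card = N * (c * c * r) := by
    simp only [← Finset.mul_sum]
    rw [Finset.sum_congr rfl hrow, Finset.sum_const, nsmul_eq_mul, hPc]
    ring
  rw [t1, t2, t3, t4] at h
  have : 0 ≤ N * (N * (∑ x ∈ C, ∑ y ∈ C, G (x ∩ y).card) - c ^ 2 * r) := by
    linarith
  have := nonneg_of_mul_nonneg_right this hNpos
  linarith

lemma lp_core (w t : ℕ) (hwn : w ≤ n) (hn : 0 < n) (C : Finset (Finset (Fin n)))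
    (hC : ∀ x ∈ C, x.card = w) (hne : C.Nonempty)
    (G : ℕ → ℝ) (g H : Finset (Fin n) → Finset (Fin n) → ℝ) (lam : ℝ) (hlam : 1 ≤ lam)
    (V) (hg : FK (Udeg n t) g) (hH : FK V H)
    (hgG : ∀ x y, x.card = w → y.card = w → g x y = G (x ∩ y).card)
    (hHG : ∀ x y, x.card = w → y.card = w →
      H x y = ((x ∩ y).card - lam) * G (x ∩ y).card)
    (hG : G w ≠ 0)
    (hcard : 2 * n * (Finset.univ.filter fun S : Finset (Fin n) => S.card ≤ t).card ≤ C.card) :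
    ∃ k, k < w ∧ lam - 1 < k ∧ 0 < BB C k ∧
      (C.card : ℝ) ^ 2 * ((w.choose k * (n - w).choose (w - k) : ℕ) : ℝ)
        ≤ 4 * n * n.choose w * BB C k := by
  classical
  set D := (Finset.univ.filter fun S : Finset (Fin n) => S.card ≤ t).card
  set v : ℕ → ℝ := fun k => ((w.choose k * (n - w).choose (w - k) : ℕ) : ℝ) with hv
  set c : ℝ := ((C.card : ℕ) : ℝ) with hc
  have hcpos : 0 < c := by simpa [hc] using hne
  set N : ℝ := ((n.choose w : ℕ) : ℝ) with hN
  have hNpos : 0 < N := by simpa [hN] using Nat.choose_pos hwn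
  have hnpos : (0 : ℝ) < n := by exact_mod_cast hn
  set Q : ℝ := ∑ x ∈ C, ∑ y ∈ C, G (x ∩ y).card ^ 2 with hQ
  have h1 : 0 ≤ ∑ x ∈ C, ∑ y ∈ C, (((x ∩ y).card : ℝ) - lam) * G (x ∩ y).card ^ 2 := by
    have := (hH.mul hg).nonneg C (fun _ => 1)
    refine this.trans (le_of_eq ?_)
    refine Finset.sum_congr rfl fun x hx => Finset.sum_congr rfl fun y hy => ?_
    rw [hgG x y (hC x hx) (hC y hy), hHG x y (hC x hx) (hC y hy)]
    ring
  have h2 : (c * G w) ^ 2 ≤ D * Q := by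
    have := trace_ineq (Udeg n t) D (Udeg_finrank n t) C g (fun y => hg.col y)
    have e1 : ∑ x ∈ C, g x x = c * G w := by
      rw [Finset.sum_congr rfl (g := fun _ => G w), Finset.sum_const, nsmul_eq_mul]
      intro x hx
      rw [hgG x x (hC x hx) (hC x hx), Finset.inter_self, hC x hx]
    rw [e1] at this
    refine this.trans (le_of_eq ?_)
    congr 1
    refine Finset.sum_congr rfl fun x hx => Finset.sum_congr rfl fun y hy => ?_
    rw [hgG x y (hC x hx) (hC y hy)]
  have h3 : c ^ 2 * ∑ k ∈ Finset.range (w + 1), v k * G k ^ 2 ≤ N * Q := by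
    refine avg_ineq w C hC hne (fun k => G k ^ 2) (fun x y => g x y * g x y) ⊤ (hg.mul hg) ?_
    intro x y hx hy
    rw [hgG x y hx hy, sq]
  have h4 : Q ≤ ∑ k ∈ Finset.range (w + 1), BB C k * ((k - (lam - 1)) * G k ^ 2) := by
    rw [← sum_BB C w hC (fun k => (k - (lam - 1)) * G k ^ 2)]
    have : ∑ x ∈ C, ∑ y ∈ C, (((x ∩ y).card : ℝ) - (lam - 1)) * G (x ∩ y).card ^ 2
      = ∑ x ∈ C, ∑ y ∈ C, (((x ∩ y).card : ℝ) - lam) * G (x ∩ y).card ^ 2 + Q := by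
      rw [hQ]
      simp only [← Finset.sum_add_distrib]
      exact Finset.sum_congr rfl fun x hx => Finset.sum_congr rfl fun y hy => by ring
    rw [this]; linarith
  have hQpos : 0 < Q := by
    have : Q = ∑ k ∈ Finset.range (w + 1), BB C k * G k ^ 2 := sum_BB C w hC (fun k => G k ^ 2)
    rw [this]
    refine Finset.sum_pos' (fun k _ => by positivity) ⟨w, by simp, ?_⟩
    rw [BB_diag C w hC]
    positivity
  by_contra hcon
  push Not at hcon
  rw [Finset.sum_range_succ, BB_diag C w hC] at h4
  have hdiag : c * ((w - (lam - 1)) * G w ^ 2) ≤ Q / 2 := by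
    have a1 : c * ((w - (lam - 1)) * G w ^ 2) ≤ c * (n * G w ^ 2) := by
      have : (w : ℝ) ≤ n := by exact_mod_cast hwn
      gcongr
      linarith
    have a2 : c * (c * (n * G w ^ 2)) ≤ c * (Q / 2) := by
      have hcard' : 2 * (n : ℝ) * D ≤ c := by rw [hc]; exact_mod_cast hcard
      nlinarith
    have := le_of_mul_le_mul_left a2 hcpos
    linarith
  have hoff : ∑ k ∈ Finset.range w, BB C k * ((k - (lam - 1)) * G k ^ 2) ≤ Q / 4 := by
    have b1 : ∀ k ∈ Finset.range w, (BB C k : ℝ) * ((k - (lam - 1)) * G k ^ 2)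
        ≤ c ^ 2 / (4 * N) * (v k * G k ^ 2) := by
      intro k hk
      have hkw : k < w := by simpa using hk
      have rhs : 0 ≤ c ^ 2 / (4 * N) * (v k * G k ^ 2) := by positivity
      rcases le_or_gt (k : ℝ) (lam - 1) with hl | hl
      · refine le_trans ?_ rhs
        exact mul_nonpos_of_nonneg_of_nonpos (by positivity)
          (mul_nonpos_of_nonpos_of_nonneg (by linarith) (sq_nonneg _))
      rcases Nat.eq_zero_or_pos (BB C k) with hb | hb
      · rw [hb]; simpa using rhs
      · have := (hcon k hkw hl hb).le
        have hkn : (k : ℝ) - (lam - 1) ≤ n := by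
          have : (k : ℝ) ≤ n := by exact_mod_cast (hkw.le.trans hwn)
          linarith
        calc (BB C k : ℝ) * ((k - (lam - 1)) * G k ^ 2) ≤ BB C k * (n * G k ^ 2) := by gcongr
          _ = (4 * n * N * BB C k) * (G k ^ 2 / (4 * N)) := by field_simp
          _ ≤ (c ^ 2 * v k) * (G k ^ 2 / (4 * N)) := by gcongr
          _ = _ := by field_simp
    refine (Finset.sum_le_sum b1).trans ?_
    rw [← Finset.mul_sum]
    have b2 : ∑ k ∈ Finset.range w, v k * G k ^ 2 ≤ ∑ k ∈ Finset.range (w + 1), v k * G k ^ 2 := by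
      rw [Finset.sum_range_succ]
      have : 0 ≤ v w * G w ^ 2 := by positivity
      linarith
    calc c ^ 2 / (4 * N) * ∑ k ∈ Finset.range w, v k * G k ^ 2
        ≤ c ^ 2 / (4 * N) * ∑ k ∈ Finset.range (w + 1), v k * G k ^ 2 := by gcongr
      _ = (c ^ 2 * ∑ k ∈ Finset.range (w + 1), v k * G k ^ 2) / (4 * N) := by ring
      _ ≤ (N * Q) / (4 * N) := by gcongr
      _ = Q / 4 := by field_simp
  linarith

end B2LP

namespace B2LP

lemma ee_diag_pos (i : ℕ) : ∀ k l : ℝ, (i : ℝ) ≤ k → (i : ℝ) ≤ l → 0 < ee i k 0 0 l := by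
  induction i with
  | zero => intros; simp [ee]
  | succ i ih =>
    intro k l hk hl
    push_cast at hk hl
    have := ih (k - 1) (l - 1) (by linarith) (by linarith)
    have hi : (0 : ℝ) ≤ i := by positivity
    rw [ee_succ]
    have h1 : 0 < k := by linarith
    have h2 : 0 < l := by linarith
    have : 0 < k * l * ee i (k - 1) 0 0 (l - 1) := by positivity
    linarith

lemma zz_rec (n w j : ℕ) (hj : 1 ≤ j) (h : 2 * j < n) (k : ℕ) :
    (k : ℝ) * zz n w j k = cC n w j * zz n w (j + 1) k + cB n w j * zz n w j k
      + cA n w j * zz n w (j - 1) k := by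
  obtain ⟨i, rfl⟩ : ∃ i, j = i + 1 := ⟨j - 1, by omega⟩
  have h' : 2 * ((i : ℝ) + 1) < n := by exact_mod_cast h
  have := ee_rec n w i h' k
  simp only [zz, Nat.add_sub_cancel]
  push_cast
  exact this

lemma sum_rearr (m : ℕ) (c b a E : ℕ → ℝ) (hc : c 0 = 0) (ha : a (m + 1) = 0) :
    ∑ q ∈ Finset.range m, (c (q + 1) * E (q + 2) + b (q + 1) * E (q + 1) + a (q + 1) * E q)
    = ∑ q ∈ Finset.range m, (c q + b (q + 1) + a (q + 2)) * E (q + 1)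
      + (c m * E (m + 1) + a 1 * E 0) := by
  have h1 : ∀ f : ℕ → ℝ, ∑ q ∈ Finset.range m, f (q + 1) = ∑ q ∈ Finset.range m, f q + f m - f 0 := by
    intro f
    have := Finset.sum_range_succ f m
    have := Finset.sum_range_succ' f m
    linarith
  have e1 := h1 (fun q => c q * E (q + 1))
  have e2 := h1 (fun q => a (q + 1) * E q)
  simp only [Finset.sum_add_distrib, add_mul] at *
  rw [hc] at e1
  rw [ha] at e2
  linarith

lemma cC_nonneg {n w i : ℝ} (hi : 0 ≤ i) (h : 2 * i < n) : 0 ≤ cC n w i := by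
  unfold cC
  have h1 : 0 < n - 2 * i := by linarith
  positivity

lemma cA_nonneg {n w i : ℝ} (hi : 0 ≤ i) (h : 2 * i < n) : 0 ≤ cA n w i := by
  unfold cA
  have h1 : 0 < n - 2 * i := by linarith
  positivity

lemma window {n : ℕ} (w t0 m : ℕ) (hm : 0 < m) (htw : t0 + m ≤ w) (htn : t0 + m ≤ n - w)
    (hwn : w ≤ n)
    (hn2 : 2 * (t0 + m + 1) < n)
    (θ c0 b0 : ℝ) (hθ : 0 < θ) (hc0 : 0 ≤ c0)
    (hC : ∀ q ≤ m, c0 * θ ≤ cC n w (t0 + q : ℕ))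
    (hA : ∀ q ≤ m, c0 ≤ cA n w (t0 + q + 1 : ℕ) * θ)
    (hB : ∀ q ≤ m, b0 ≤ cB n w (t0 + q : ℕ)) :
    ∃ (G : ℕ → ℝ) (g H : Finset (Fin n) → Finset (Fin n) → ℝ),
      FK (Udeg n (t0 + m)) g ∧ FK (Udeg n (t0 + m + 1)) H ∧
      (∀ x y, x.card = w → y.card = w → g x y = G (x ∩ y).card) ∧
      (∀ x y, x.card = w → y.card = w →
        H x y = ((x ∩ y).card - (b0 + 2 * c0 * (1 - 1 / m))) * G (x ∩ y).card) ∧ G w ≠ 0 := by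
  set lam := b0 + 2 * c0 * (1 - 1 / m) with hlam
  have hm' : (0 : ℝ) < m := by exact_mod_cast hm
  set s : ℕ → ℝ := fun q => q * (m + 1 - q) with hs
  have hspos : ∀ q < m, (m : ℝ) ≤ s (q + 1) := by
    intro q hq
    have h1 : (q : ℝ) + 1 ≤ m := by exact_mod_cast hq
    have h0 : (0 : ℝ) ≤ q := by positivity
    simp only [hs]; push_cast
    nlinarith
  have hsnn : ∀ q ≤ m + 1, 0 ≤ s q := by
    intro q hq
    have h1 : (q : ℝ) ≤ m + 1 := by exact_mod_cast hq
    have h0 : (0 : ℝ) ≤ q := by positivity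
    simp only [hs]
    exact mul_nonneg h0 (by linarith)
  set cc : ℕ → ℝ := fun q => cC n w (t0 + q : ℕ) * (θ ^ q * s q)
  set bb : ℕ → ℝ := fun q => (cB n w (t0 + q : ℕ) - lam) * (θ ^ q * s q)
  set aa : ℕ → ℝ := fun q => cA n w (t0 + q : ℕ) * (θ ^ q * s q)
  have hcc0 : cc 0 = 0 := by simp [cc, hs]
  have haa : aa (m + 1) = 0 := by simp [aa, hs]
  have hcoef : ∀ q < m, 0 ≤ cc q + bb (q + 1) + aa (q + 2) := by
    intro q hq
    have i1 : c0 * θ * (θ ^ q * s q) ≤ cc q :=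
      mul_le_mul_of_nonneg_right (hC q hq.le) (mul_nonneg (by positivity) (hsnn q (by omega)))
    have i2 : c0 * (θ ^ (q + 1) * s (q + 2)) ≤ aa (q + 2) := by
      have h := mul_le_mul_of_nonneg_right (hA (q + 1) hq)
        (mul_nonneg (pow_nonneg hθ.le (q + 1)) (hsnn (q + 2) (by omega)))
      refine h.trans (le_of_eq ?_)
      simp only [aa]
      rw [show t0 + (q + 1) + 1 = t0 + (q + 2) by ring]
      ring
    have i3 : (b0 - lam) * (θ ^ (q + 1) * s (q + 1)) ≤ bb (q + 1) :=
      mul_le_mul_of_nonneg_right (by linarith [hB (q + 1) hq])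
        (mul_nonneg (by positivity) (hsnn (q + 1) (by omega)))
    have i4 : s q + s (q + 2) = 2 * s (q + 1) - 2 := by
      simp only [hs]; push_cast; ring
    have i5 : 0 ≤ c0 * (s (q + 1) / m - 1) := by
      refine mul_nonneg hc0 ?_
      rw [sub_nonneg, le_div_iff₀ hm']; linarith [hspos q hq]
    have i6 : c0 * θ * (θ ^ q * s q) + c0 * (θ ^ (q + 1) * s (q + 2))
        + (b0 - lam) * (θ ^ (q + 1) * s (q + 1)) = θ ^ (q + 1) * (2 * (c0 * (s (q + 1) / m - 1))) := by
      have : s (q + 2) = 2 * s (q + 1) - 2 - s q := by linarith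
      rw [this, hlam]
      field_simp
      ring
    have i7 : 0 ≤ θ ^ (q + 1) * (2 * (c0 * (s (q + 1) / m - 1))) := by positivity
    linarith
  refine ⟨fun k => ∑ q ∈ Finset.range m, (θ ^ (q + 1) * s (q + 1)) * zz n w (t0 + (q + 1)) k,
    fun x y => ∑ q ∈ Finset.range m, (θ ^ (q + 1) * s (q + 1)) * kap (t0 + (q + 1)) Finset.univ x y,
    fun x y => ∑ q ∈ Finset.range m, (cc q + bb (q + 1) + aa (q + 2)) * kap (t0 + (q + 1)) Finset.univ x y
      + (cc m * kap (t0 + (m + 1)) Finset.univ x y + aa 1 * kap (t0 + 0) Finset.univ x y), ?_, ?_, ?_, ?_, ?_⟩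
  · refine FK.sum _ _ fun q hq => ?_
    have hq : q < m := by simpa using hq
    refine FK.smul ((kap_FK _ _).mono (Udeg_mono (by omega))) _ ?_
    exact mul_nonneg (by positivity) (hsnn _ (by omega))
  · refine FK.add _ _ (FK.sum _ _ fun q hq => ?_) (FK.add _ _ ?_ ?_)
    · have hq : q < m := by simpa using hq
      exact FK.smul ((kap_FK _ _).mono (Udeg_mono (by omega))) _ (hcoef q hq)
    · refine FK.smul ((kap_FK _ _).mono (Udeg_mono (by omega))) _ ?_
      refine mul_nonneg (cC_nonneg (by positivity) ?_) (mul_nonneg (by positivity) (hsnn _ (by omega)))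
      exact_mod_cast (by omega : 2 * (t0 + m) < n)
    · refine FK.smul ((kap_FK _ _).mono (Udeg_mono (by omega))) _ ?_
      refine mul_nonneg (cA_nonneg (by positivity) ?_) (mul_nonneg (by positivity) (hsnn _ (by omega)))
      exact_mod_cast (by omega : 2 * (t0 + 1) < n)
  · intro x y hx hy
    simp only [kap_slice _ x y hx hy]
  · intro x y hx hy
    simp only [kap_slice _ x y hx hy]
    set k := (x ∩ y).card
    rw [← sum_rearr m cc bb aa (fun q => zz n w (t0 + q) k) hcc0 haa, Finset.mul_sum]
    refine Finset.sum_congr rfl fun q hq => ?_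
    have hq : q < m := by simpa using hq
    have := zz_rec n w (t0 + (q + 1)) (by omega) (by omega) k
    rw [show t0 + (q + 1) - 1 = t0 + q by omega, show t0 + (q + 1) + 1 = t0 + (q + 2) by omega] at this
    simp only [cc, bb, aa]
    linear_combination (-(θ ^ (q + 1) * s (q + 1))) * this
  · apply ne_of_gt
    refine Finset.sum_pos (fun q hq => ?_) ⟨0, by simpa using hm⟩
    have hq : q < m := by simpa using hq
    have h1 : 0 < s (q + 1) := hm'.trans_le (hspos q hq)
    have h2 : 0 < zz n w (t0 + (q + 1)) w := by
      unfold zz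
      have e : (n : ℝ) - 2 * w + w = ((n - w : ℕ) : ℝ) := by
        rw [Nat.cast_sub hwn]; ring
      rw [sub_self, e]
      apply ee_diag_pos
      · exact_mod_cast (by omega : t0 + (q + 1) ≤ w)
      · exact_mod_cast (by omega : t0 + (q + 1) ≤ n - w)
    positivity

/-- set version of `IsB2` -/
def SB2 {n : ℕ} (C : Finset (Finset (Fin n))) : Prop :=
  ∀ x ∈ C, ∀ y ∈ C, ∀ x' ∈ C, ∀ y' ∈ C, x ≠ y → x \ y = x' \ y' → y \ x = y' \ x' → x = x' ∧ y = y'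

lemma BB_le {n : ℕ} (w : ℕ) (C : Finset (Finset (Fin n))) (hC : ∀ x ∈ C, x.card = w) (hB : SB2 C)
    (k : ℕ) (hk : k < w) :
    BB C k ≤ n.choose (2 * (w - k)) * (2 * (w - k)).choose (w - k) := by
  classical
  set j := w - k with hj
  set T : Finset (Σ _ : Finset (Fin n), Finset (Fin n)) :=
    (Finset.powersetCard (2 * j) (Finset.univ : Finset (Fin n))).sigma
      (fun S => Finset.powersetCard j S) with hT
  have hTc : T.card = n.choose (2 * j) * (2 * j).choose j := by
    rw [hT, Finset.card_sigma, Finset.sum_congr rfl (g := fun _ => (2 * j).choose j)]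
    · simp
    · intro S hS
      rw [Finset.card_powersetCard, (Finset.mem_powersetCard.mp hS).2]
  rw [← hTc, BB]
  have key : ∀ x ∈ C, ∀ y ∈ C, (x ∩ y).card = k → (x \ y).card = j ∧ (y \ x).card = j ∧ x ≠ y := by
    intro x hx y hy h
    have h1 := Finset.card_inter_add_card_sdiff x y
    have h2 := Finset.card_inter_add_card_sdiff y x
    rw [Finset.inter_comm] at h2
    rw [hC x hx] at h1
    rw [hC y hy] at h2
    refine ⟨by omega, by omega, ?_⟩
    rintro rfl
    rw [Finset.inter_self, hC x hx] at h
    omega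
  refine Finset.card_le_card_of_injOn (fun p => ⟨(p.1 \ p.2) ∪ (p.2 \ p.1), p.1 \ p.2⟩) ?_ ?_
  · rintro ⟨x, y⟩ hp
    simp only [Finset.coe_filter, Finset.mem_product, Set.mem_ofPred_eq] at hp
    obtain ⟨a, b, _⟩ := key x hp.1.1 y hp.1.2 hp.2
    simp only [hT, Finset.coe_sigma, Set.mem_sigma_iff, Finset.mem_coe, Finset.mem_powersetCard,
      Finset.subset_univ, true_and]
    refine ⟨?_, Finset.subset_union_left, a⟩
    rw [Finset.card_union_of_disjoint disjoint_sdiff_sdiff, a, b]; ring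
  · rintro ⟨x, y⟩ hp ⟨x', y'⟩ hp' h
    simp only [Finset.coe_filter, Finset.mem_product, Set.mem_ofPred_eq] at hp hp'
    obtain ⟨a, b, c⟩ := key x hp.1.1 y hp.1.2 hp.2
    simp only [Sigma.mk.injEq, heq_eq_eq] at h
    have h3 : y \ x = y' \ x' := by
      have e : ∀ u v : Finset (Fin n), v \ u = ((u \ v) ∪ (v \ u)) \ (u \ v) := by
        intro u v; ext a; simp; tauto
      rw [e x y, e x' y', h.1, h.2]
    obtain ⟨r1, r2⟩ := hB x hp.1.1 y hp.1.2 x' hp'.1.1 y' hp'.1.2 c h.2 h3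
    rw [r1, r2]

lemma finite_bound {n : ℕ} (w t0 m : ℕ) (hm : 0 < m) (htw : t0 + m ≤ w) (htn : t0 + m ≤ n - w)
    (hwn : w ≤ n)
    (hn2 : 2 * (t0 + m + 1) < n)
    (θ c0 b0 : ℝ) (hθ : 0 < θ) (hc0 : 0 ≤ c0)
    (hCc : ∀ q ≤ m, c0 * θ ≤ cC n w (t0 + q : ℕ))
    (hA : ∀ q ≤ m, c0 ≤ cA n w (t0 + q + 1 : ℕ) * θ)
    (hB : ∀ q ≤ m, b0 ≤ cB n w (t0 + q : ℕ))
    (hlam : 1 ≤ b0 + 2 * c0 * (1 - 1 / m))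
    (C : Finset (Finset (Fin n)))
    (hC : ∀ x ∈ C, x.card = w) (hne : C.Nonempty) (hB2 : SB2 C)
    (hcard : 2 * n * (Finset.univ.filter fun S : Finset (Fin n) => S.card ≤ t0 + m).card ≤ C.card) :
    ∃ j, j ≤ w ∧ w + j ≤ n ∧ (j : ℝ) < w - (b0 + 2 * c0 * (1 - 1 / m)) + 1 ∧
      (C.card : ℝ) ^ 2 * (w.choose j * (n - w).choose j)
        ≤ 4 * n * n.choose w * (n.choose (2 * j) * (2 * j).choose j) := by
  obtain ⟨G, g, H, hg, hH, hgG, hHG, hG⟩ :=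
    window w t0 m hm htw htn hwn hn2 θ c0 b0 hθ hc0 hCc hA hB
  obtain ⟨k, hkw, hkl, hpos, h⟩ := lp_core w (t0 + m) hwn (by omega) C hC hne G g H _ hlam _
    hg hH hgG hHG hG hcard
  refine ⟨w - k, by omega, ?_, ?_, ?_⟩
  · obtain ⟨⟨x, y⟩, hp⟩ := Finset.card_pos.mp hpos
    simp only [Finset.mem_filter, Finset.mem_product] at hp
    have h1 := Finset.card_union_add_card_inter x y
    rw [hC x hp.1.1, hC y hp.1.2, hp.2] at h1
    have h2 := Finset.card_le_univ (x ∪ y)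
    simp at h2
    omega
  · rw [Nat.cast_sub hkw.le]; linarith
  · have h1 := BB_le w C hC hB2 k hkw
    have h1' : (BB C k : ℝ) ≤ n.choose (2 * (w - k)) * (2 * (w - k)).choose (w - k) := by
      exact_mod_cast h1
    rw [Nat.choose_symm hkw.le]
    push_cast at h
    refine h.trans ?_
    gcongr

end B2LP

namespace B2LP

lemma binH_eq (x : ℝ) : binH x = Real.binEntropy x / Real.log 2 := by
  unfold binH Real.binEntropy Real.logb
  rw [Real.log_inv, Real.log_inv]
  ring

lemma log2_pos : 0 < Real.log 2 := Real.log_pos (by norm_num)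

@[fun_prop] lemma binH_cont : Continuous binH := by
  have : binH = fun x => Real.binEntropy x / Real.log 2 := funext binH_eq
  rw [this]; fun_prop

lemma binH_le_one (x : ℝ) : binH x ≤ 1 := by
  rw [binH_eq, div_le_one log2_pos]; exact Real.binEntropy_le_log_two

lemma binH_mono {x y : ℝ} (hx : 0 ≤ x) (hxy : x ≤ y) (hy : y ≤ 1 / 2) : binH x ≤ binH y := by
  rw [binH_eq, binH_eq]
  have h := Real.binEntropy_strictMonoOn.monotoneOn (a := x) (b := y)
    ⟨hx, by norm_num at *; linarith⟩ ⟨by linarith, by norm_num at *; linarith⟩ hxy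
  have := log2_pos
  gcongr

lemma binH_strictMono {x y : ℝ} (hx : 0 ≤ x) (hxy : x < y) (hy : y ≤ 1 / 2) : binH x < binH y := by
  rw [binH_eq, binH_eq]
  have h := Real.binEntropy_strictMonoOn (a := x) (b := y)
    ⟨hx, by norm_num at *; linarith⟩ ⟨by linarith, by norm_num at *; linarith⟩ hxy
  have := log2_pos
  gcongr

lemma binH_symm (x : ℝ) : binH (1 - x) = binH x := by
  rw [binH_eq, binH_eq, Real.binEntropy_one_sub]

lemma binH_zero : binH 0 = 0 := by simp [binH]

lemma binH_pos {x : ℝ} (h0 : 0 < x) (h1 : x < 1) : 0 < binH x := by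
  rw [binH_eq]; exact div_pos (Real.binEntropy_pos h0 h1) log2_pos

lemma fact_aux (i d : ℕ) : (i + d).factorial ≤ i.factorial * (i + d) ^ d := by
  induction d with
  | zero => simp
  | succ d ih =>
    rw [← add_assoc, Nat.factorial_succ]
    calc _ ≤ (i + d + 1) * (i.factorial * (i + d) ^ d) := by gcongr
      _ ≤ (i + d + 1) * (i.factorial * (i + d + 1) ^ d) := by
        have := Nat.pow_le_pow_left (by omega : i + d ≤ i + d + 1) d
        gcongr
      _ = _ := by ring

lemma fact_pow (i j : ℕ) : j.factorial * j ^ i ≤ i.factorial * j ^ j := by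
  rcases le_total i j with h | h
  · obtain ⟨d, rfl⟩ := Nat.exists_eq_add_of_le h
    have h2 := fact_aux i d
    calc _ ≤ i.factorial * (i + d) ^ d * (i + d) ^ i := by gcongr
      _ = _ := by ring
  · obtain ⟨d, rfl⟩ := Nat.exists_eq_add_of_le h
    have h1 : j.factorial * (j + 1) ^ d ≤ (j + d).factorial := Nat.factorial_mul_pow_le_factorial
    have h2 : j ^ d ≤ (j + 1) ^ d := Nat.pow_le_pow_left (by omega) d
    calc _ = j.factorial * j ^ d * j ^ j := by ring
      _ ≤ j.factorial * (j + 1) ^ d * j ^ j := by gcongr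
      _ ≤ _ := by gcongr

lemma term_le (n i j : ℕ) (hi : i ≤ n) (hj : j ≤ n) :
    n.choose i * (j ^ i * (n - j) ^ (n - i)) ≤ n.choose j * (j ^ j * (n - j) ^ (n - j)) := by
  have h1 := fact_pow i j
  have h2 := fact_pow (n - i) (n - j)
  have e1 := Nat.choose_mul_factorial_mul_factorial hi
  have e2 := Nat.choose_mul_factorial_mul_factorial hj
  have hp : 0 < (i.factorial * (n - i).factorial) * (j.factorial * (n - j).factorial) := by positivity
  refine Nat.le_of_mul_le_mul_left ?_ hp
  calc _ = (n.choose i * i.factorial * (n - i).factorial) *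
        ((j.factorial * j ^ i) * ((n - j).factorial * (n - j) ^ (n - i))) := by ring
    _ ≤ n.factorial * ((i.factorial * j ^ j) * ((n - i).factorial * (n - j) ^ (n - j))) := by
        rw [e1]; gcongr
    _ = (n.choose j * j.factorial * (n - j).factorial) *
        ((i.factorial * j ^ j) * ((n - i).factorial * (n - j) ^ (n - j))) := by rw [e2]
    _ = _ := by ring

lemma binom_sum (n j : ℕ) (hj : j ≤ n) :
    ∑ i ∈ Finset.range (n + 1), n.choose i * (j ^ i * (n - j) ^ (n - i)) = n ^ n := by
  have := add_pow j (n - j) n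
  rw [Nat.add_sub_cancel' hj] at this
  rw [this]
  exact Finset.sum_congr rfl fun i _ => by simp; ring

lemma ent_id (n j : ℕ) (hn : 0 < n) (hj : j ≤ n) :
    (n : ℝ) * Real.binEntropy (j / n) =
      Real.log ((n : ℝ) ^ n) - Real.log ((j : ℝ) ^ j * ((n - j : ℕ) : ℝ) ^ (n - j)) := by
  have hn' : (n : ℝ) ≠ 0 := by positivity
  rcases Nat.eq_zero_or_pos j with rfl | h0
  · simp
  rcases hj.eq_or_lt with rfl | h1
  · simp [div_self hn']
  have hj' : (j : ℝ) ≠ 0 := by positivity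
  have hd : ((n - j : ℕ) : ℝ) ≠ 0 := by
    have : 0 < n - j := by omega
    positivity
  have e : (1 : ℝ) - j / n = ((n - j : ℕ) : ℝ) / n := by
    rw [Nat.cast_sub hj]; field_simp
  rw [Real.binEntropy, e, Real.log_inv, Real.log_inv, Real.log_div hj' hn', Real.log_div hd hn',
    Real.log_mul (by positivity) (by positivity), Real.log_pow, Real.log_pow, Real.log_pow]
  field_simp
  rw [Nat.cast_sub hj]
  ring

lemma choose_le_ent (n j : ℕ) (hn : 0 < n) (hj : j ≤ n) :
    Real.logb 2 (n.choose j) ≤ n * binH (j / n) := by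
  have hc : (0 : ℝ) < n.choose j := by exact_mod_cast Nat.choose_pos hj
  have hT : n.choose j * (j ^ j * (n - j) ^ (n - j)) ≤ n ^ n := by
    rw [← binom_sum n j hj]
    exact Finset.single_le_sum (f := fun i => n.choose i * (j ^ i * (n - j) ^ (n - i)))
      (fun _ _ => Nat.zero_le _) (by simp; omega)
  have hT' : (n.choose j : ℝ) * ((j : ℝ) ^ j * ((n - j : ℕ) : ℝ) ^ (n - j)) ≤ (n : ℝ) ^ n := by
    exact_mod_cast hT
  have hp : (0 : ℝ) < (j : ℝ) ^ j * ((n - j : ℕ) : ℝ) ^ (n - j) := by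
    have := Nat.pow_self_pos (n := j)
    have := Nat.pow_self_pos (n := n - j)
    exact_mod_cast (by positivity : 0 < j ^ j * (n - j) ^ (n - j))
  have := Real.log_le_log (by positivity) hT'
  rw [Real.log_mul hc.ne' hp.ne'] at this
  rw [binH_eq, ← mul_div_assoc, ent_id n j hn hj, Real.logb]
  have := log2_pos
  gcongr
  linarith

lemma ent_le_choose (n j : ℕ) (hn : 0 < n) (hj : j ≤ n) :
    n * binH (j / n) ≤ Real.logb 2 (n.choose j) + Real.logb 2 (n + 1) := by
  have hc : (0 : ℝ) < n.choose j := by exact_mod_cast Nat.choose_pos hj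
  have hT : n ^ n ≤ (n + 1) * (n.choose j * (j ^ j * (n - j) ^ (n - j))) := by
    rw [← binom_sum n j hj]
    refine (Finset.sum_le_card_nsmul _ _ (n.choose j * (j ^ j * (n - j) ^ (n - j))) ?_).trans ?_
    · intro i hi
      exact term_le n i j (by simpa [Nat.lt_succ_iff] using hi) hj
    · simp
  have hT' : (n : ℝ) ^ n ≤ ((n : ℝ) + 1) * ((n.choose j : ℝ) * ((j : ℝ) ^ j * ((n - j : ℕ) : ℝ) ^ (n - j))) := by
    exact_mod_cast hT
  have hp : (0 : ℝ) < (j : ℝ) ^ j * ((n - j : ℕ) : ℝ) ^ (n - j) := by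
    have := Nat.pow_self_pos (n := j)
    have := Nat.pow_self_pos (n := n - j)
    exact_mod_cast (by positivity : 0 < j ^ j * (n - j) ^ (n - j))
  have := Real.log_le_log (by positivity) hT'
  rw [Real.log_mul (by positivity) (by positivity), Real.log_mul hc.ne' hp.ne'] at this
  rw [binH_eq, ← mul_div_assoc, ent_id n j hn hj, Real.logb, Real.logb, ← add_div]
  have := log2_pos
  gcongr
  linarith

lemma Psi_mono {α x y : ℝ} (h0 : 0 < α) (h1 : α < 1) (hx : 0 ≤ x) (hxy : x ≤ y)
    (hy : y ≤ α) (hy' : y ≤ 1 - α) : Psi α x ≤ Psi α y := by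
  have hM : MonotoneOn (Psi α) (Set.Icc 0 (min α (1 - α))) := by
    have hcont : Continuous (Psi α) := by
      unfold Psi; fun_prop
    refine monotoneOn_of_hasDerivWithinAt_nonneg (f' := fun ξ => (1 / 2) * ((2 * (Real.log (1 - 2 * ξ) - Real.log (2 * ξ))) / Real.log 2
        + 2 - (Real.log (1 - ξ / α) - Real.log (ξ / α)) / Real.log 2
        - (Real.log (1 - ξ / (1 - α)) - Real.log (ξ / (1 - α))) / Real.log 2))
        (convex_Icc _ _) hcont.continuousOn ?_ ?_
    · intro ξ hξ
      rw [interior_Icc, Set.mem_Ioo, lt_min_iff] at hξ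
      obtain ⟨p0, p1, p2⟩ := hξ
      have h1' : 0 < 1 - α := by linarith
      have q1 : ξ / α < 1 := by rwa [div_lt_one h0]
      have q2 : ξ / (1 - α) < 1 := by rwa [div_lt_one h1']
      have d1 : HasDerivAt (fun ξ : ℝ => binH (2 * ξ)) ((2 * (Real.log (1 - 2 * ξ) - Real.log (2 * ξ))) / Real.log 2) ξ := by
        have := (Real.hasDerivAt_binEntropy (p := 2 * ξ) (by linarith) (by linarith)).comp ξ
          ((hasDerivAt_id ξ).const_mul 2)
        have := this.div_const (Real.log 2)
        simp only [binH_eq]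
        refine this.congr_deriv ?_
        simp; ring
      have d2 : ∀ a : ℝ, 0 < a → ξ / a < 1 → HasDerivAt (fun ξ : ℝ => a * binH (ξ / a))
          ((Real.log (1 - ξ / a) - Real.log (ξ / a)) / Real.log 2) ξ := by
        intro a ha hl
        have := (Real.hasDerivAt_binEntropy (p := ξ / a) (by positivity) (by linarith)).comp ξ
          ((hasDerivAt_id ξ).div_const a)
        have := (this.div_const (Real.log 2)).const_mul a
        simp only [binH_eq]
        refine this.congr_deriv ?_
        field_simp
      have d3 : HasDerivAt (fun ξ : ℝ => 2 * ξ) 2 ξ := by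
        simpa using (hasDerivAt_id ξ).const_mul 2
      have := ((((d1.add d3).add_const (binH α)).sub (d2 α h0 q1)).sub
        (d2 (1 - α) h1' q2)).const_mul (1 / 2)
      exact this.hasDerivWithinAt
    · intro ξ hξ
      rw [interior_Icc, Set.mem_Ioo, lt_min_iff] at hξ
      obtain ⟨p0, p1, p2⟩ := hξ
      have h1' : 0 < 1 - α := by linarith
      have hL := log2_pos
      have e1 : (1 : ℝ) - ξ / α = (α - ξ) / α := by field_simp
      have e2 : (1 : ℝ) - ξ / (1 - α) = (1 - α - ξ) / (1 - α) := by field_simp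
      rw [e1, e2, Real.log_div (by linarith) h0.ne', Real.log_div (by linarith) h1'.ne',
        Real.log_div p0.ne' h0.ne', Real.log_div p0.ne' h1'.ne',
        Real.log_mul (by norm_num) p0.ne']
      have l1 := Real.log_le_log (x := α - ξ) (y := 1 - 2 * ξ) (by linarith) (by linarith)
      have l2 := Real.log_le_log (x := 1 - α - ξ) (y := 1 - 2 * ξ) (by linarith) (by linarith)
      refine mul_nonneg (by norm_num) ?_
      have : (0 : ℝ) ≤ (2 * Real.log (1 - 2 * ξ) - Real.log (α - ξ) - Real.log (1 - α - ξ)) / Real.log 2 :=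
        div_nonneg (by linarith) hL.le
      refine this.trans (le_of_eq ?_)
      field_simp
      ring
  exact hM ⟨hx, le_min (by linarith) (by linarith)⟩ ⟨by linarith, le_min hy hy'⟩ hxy

lemma rate_bound (n w j : ℕ) (c : ℝ) (hc : 0 < c) (hw : 0 < w) (hwn : w < n) (hjw : j ≤ w)
    (hjn : w + j ≤ n)
    (h : c ^ 2 * (w.choose j * (n - w).choose j)
        ≤ 4 * n * n.choose w * (n.choose (2 * j) * (2 * j).choose j)) :
    Real.logb 2 c ≤ Real.logb 2 (4 * n) + Real.logb 2 (n + 1) + n * Psi (w / n) (j / n) := by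
  have hn : 0 < n := by omega
  have hn' : (0 : ℝ) < n := by exact_mod_cast hn
  have hw' : (0 : ℝ) < w := by exact_mod_cast hw
  have hd : (0 : ℝ) < ((n - w : ℕ) : ℝ) := by exact_mod_cast (by omega : 0 < n - w)
  have p1 : (0 : ℝ) < w.choose j := by exact_mod_cast Nat.choose_pos hjw
  have p2 : (0 : ℝ) < (n - w).choose j := by exact_mod_cast Nat.choose_pos (by omega)
  have p3 : (0 : ℝ) < n.choose w := by exact_mod_cast Nat.choose_pos hwn.le
  have p4 : (0 : ℝ) < n.choose (2 * j) := by exact_mod_cast Nat.choose_pos (by omega)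
  have p5 : (0 : ℝ) < (2 * j).choose j := by exact_mod_cast Nat.choose_pos (by omega)
  have hl := Real.logb_le_logb_of_le (b := 2) (by norm_num) (by positivity) h
  rw [Real.logb_mul (by positivity) (by positivity), Real.logb_mul p1.ne' p2.ne',
    Real.logb_mul (by positivity) (by positivity), Real.logb_mul (by positivity) p3.ne',
    Real.logb_mul p4.ne' p5.ne', Real.logb_pow] at hl
  have i1 := ent_le_choose w j hw hjw
  have i2 := ent_le_choose (n - w) j (by omega) (by omega)
  have i3 := choose_le_ent n w hn hwn.le
  have i4 := choose_le_ent n (2 * j) hn (by omega)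
  have i5 : Real.logb 2 ((2 * j).choose j) ≤ 2 * j := by
    have : ((2 * j).choose j : ℝ) ≤ 2 ^ (2 * j) := by
      exact_mod_cast Nat.choose_le_two_pow (2 * j) j
    have := Real.logb_le_logb_of_le (b := 2) (by norm_num) p5 this
    rw [Real.logb_pow, Real.logb_self_eq_one (by norm_num)] at this
    simpa using this
  have m1 : Real.logb 2 (w + 1) ≤ Real.logb 2 (n + 1) := by
    refine Real.logb_le_logb_of_le (by norm_num) (by positivity) ?_
    have : (w : ℝ) ≤ n := by exact_mod_cast hwn.le
    linarith
  have m2 : Real.logb 2 ((n - w : ℕ) + 1) ≤ Real.logb 2 (n + 1) := by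
    refine Real.logb_le_logb_of_le (by norm_num) (by positivity) ?_
    have : ((n - w : ℕ) : ℝ) ≤ n := by exact_mod_cast Nat.sub_le n w
    linarith
  have e1 : (j : ℝ) / n / (w / n) = j / w := by field_simp
  have e0 : (1 : ℝ) - w / n = ((n - w : ℕ) : ℝ) / n := by
    rw [Nat.cast_sub hwn.le]; field_simp
  have e2 : (j : ℝ) / n / (((n - w : ℕ) : ℝ) / n) = j / ((n - w : ℕ) : ℝ) := by field_simp
  have e3 : 2 * ((j : ℝ) / n) = ((2 * j : ℕ) : ℝ) / n := by push_cast; ring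
  have m3 : 0 ≤ Real.logb 2 (4 * n) := by
    refine Real.logb_nonneg (by norm_num) ?_
    have : (1 : ℝ) ≤ n := by exact_mod_cast hn
    linarith
  have hPsi : n * Psi (w / n) (j / n) = (1 / 2) * (n * binH (((2 * j : ℕ) : ℝ) / n) + 2 * j
      + n * binH (w / n) - w * binH (j / w) - (n - w : ℕ) * binH (j / ((n - w : ℕ) : ℝ))) := by
    unfold Psi
    rw [e0, e1, e2, e3]
    push_cast
    field_simp
  rw [hPsi]
  push_cast at *
  linarith

end B2LP

namespace B2LP

lemma translate {n : ℕ} (C : Finset (Fin n → ℤ)) (w : ℕ)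
    (hbin : ∀ c ∈ C, ∀ j : Fin n, c j = 0 ∨ c j = 1) (hB2 : IsB2 C)
    (hw : ∀ c ∈ C, (Finset.univ.filter (fun j : Fin n => c j = 1)).card = w) :
    ∃ D : Finset (Finset (Fin n)), D.card = C.card ∧ (∀ x ∈ D, x.card = w) ∧ SB2 D := by
  have key : ∀ c ∈ C, ∀ c' ∈ C, (∀ j, c j = 1 ↔ c' j = 1) → c = c' := by
    intro c hc c' hc' h
    funext j
    have := h j
    rcases hbin c hc j with h1 | h1 <;> rcases hbin c' hc' j with h2 | h2 <;>
      simp_all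
  refine ⟨C.image (fun c => Finset.univ.filter (fun j : Fin n => c j = 1)), ?_, ?_, ?_⟩
  · refine Finset.card_image_of_injOn ?_
    intro c hc c' hc' h
    refine key c hc c' hc' fun j => ?_
    have := congrArg (fun s : Finset (Fin n) => j ∈ s) h
    simpa using this
  · intro x hx
    obtain ⟨c, hc, rfl⟩ := Finset.mem_image.1 hx
    exact hw c hc
  · unfold SB2
    intro x hx y hy x' hx' y' hy' hne h1 h2
    obtain ⟨a, ha, rfl⟩ := Finset.mem_image.1 hx
    obtain ⟨b, hb, rfl⟩ := Finset.mem_image.1 hy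
    obtain ⟨a', ha', rfl⟩ := Finset.mem_image.1 hx'
    obtain ⟨b', hb', rfl⟩ := Finset.mem_image.1 hy'
    have hsum : a + b' = a' + b := by
      funext j
      have g1 := congrArg (fun s : Finset (Fin n) => j ∈ s) h1
      have g2 := congrArg (fun s : Finset (Fin n) => j ∈ s) h2
      simp only [Finset.mem_sdiff, Finset.mem_filter, Finset.mem_univ, true_and, eq_iff_iff] at g1 g2
      simp only [Pi.add_apply]
      rcases hbin a ha j with e1 | e1 <;> rcases hbin b hb j with e2 | e2 <;>
      rcases hbin a' ha' j with e3 | e3 <;> rcases hbin b' hb' j with e4 | e4 <;>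
        simp [e1, e2, e3, e4] at g1 g2 ⊢
    rcases hB2 a ha b' hb' a' ha' b hb hsum with ⟨p, q⟩ | ⟨p, q⟩
    · subst p; subst q; exact ⟨rfl, rfl⟩
    · subst p; exact absurd rfl hne

end B2LP

namespace B2LP
open Filter Topology

noncomputable def del (α β : ℝ) : ℝ :=
  2 * (α * (1 - α) - β * (1 - β)) / (1 + 2 * Real.sqrt (β * (1 - β)))

lemma lims {α β : ℝ} (hβ : β < 1 / 2) (w i : ℕ → ℕ)
    (hw : Tendsto (fun n : ℕ => (w n : ℝ) / n) atTop (𝓝 α))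
    (hi : Tendsto (fun n : ℕ => (i n : ℝ) / n) atTop (𝓝 β)) :
    Tendsto (fun n : ℕ => (n : ℝ) * cC n (w n) (i n)) atTop (𝓝 ((1 - β) / (2 * (1 - 2 * β) ^ 2))) ∧
    Tendsto (fun n : ℕ => cA n (w n) (i n) / (n : ℝ) ^ 3) atTop
      (𝓝 (2 * β * ((α - β) * (1 - α - β)) ^ 2 / (1 - 2 * β) ^ 2)) ∧
    Tendsto (fun n : ℕ => cB n (w n) (i n) / (n : ℝ)) atTop
      (𝓝 ((α - β) ^ 2 / (1 - 2 * β) + β / 2 + β * (1 - 2 * α) ^ 2 / (2 * (1 - 2 * β) ^ 2))) := by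
  have hX : (1 - 2 * β) ≠ 0 := by linarith
  have he : Tendsto (fun n : ℕ => 1 / (n : ℝ)) atTop (𝓝 0) := tendsto_one_div_atTop_nhds_zero_nat
  have c1 : Tendsto (fun _ : ℕ => (1 : ℝ)) atTop (𝓝 1) := tendsto_const_nhds
  have c2 : Tendsto (fun _ : ℕ => (2 : ℝ)) atTop (𝓝 2) := tendsto_const_nhds
  have hx : Tendsto (fun n : ℕ => 1 - 2 * ((i n : ℝ) / n)) atTop (𝓝 (1 - 2 * β)) :=
    c1.sub (c2.mul hi)
  have hev : ∀ᶠ n : ℕ in atTop, 0 < 1 - 2 * ((i n : ℝ) / n) ∧ 0 < n := by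
    refine (hx.eventually_const_lt (by linarith : (0 : ℝ) < 1 - 2 * β)).and (eventually_gt_atTop 0)
  refine ⟨?_, ?_, ?_⟩
  · have : Tendsto (fun n : ℕ => 1 / (2 * (1 - 2 * ((i n : ℝ) / n))) + ((i n : ℝ) / n) /
        (2 * (1 - 2 * ((i n : ℝ) / n)) * (1 - 2 * ((i n : ℝ) / n) + 1 / (n : ℝ)))) atTop
        (𝓝 (1 / (2 * (1 - 2 * β)) + β / (2 * (1 - 2 * β) * (1 - 2 * β + 0)))) := by
      refine (c1.div (c2.mul hx) (by simpa using hX)).add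
        (hi.div ((c2.mul hx).mul (hx.add he)) (by simpa using hX))
    refine (this.congr' ?_).trans_eq ?_
    · filter_upwards [hev] with n ⟨h1, h2⟩
      have hn : (0 : ℝ) < n := by exact_mod_cast h2
      have h3 : (n : ℝ) - 2 * i n = n * (1 - 2 * ((i n : ℝ) / n)) := by field_simp
      have h4 : (0 : ℝ) < n - 2 * i n := by rw [h3]; positivity
      have h5 : 1 - 2 * ((i n : ℝ) / n) = (n - 2 * i n) / n := by field_simp
      have h6 : (n - 2 * i n) / n + 1 / (n : ℝ) = (n - 2 * i n + 1) / n := by field_simp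
      rw [h5, h6, cC]
      field_simp
    · congr 1; simp only [add_zero, mul_zero]; field_simp; try ring
  · have : Tendsto (fun n : ℕ => 2 * ((i n : ℝ) / n) * ((w n : ℝ) / n - (i n : ℝ) / n + 1 / (n : ℝ)) ^ 2
        * (1 - (w n : ℝ) / n - (i n : ℝ) / n + 1 / (n : ℝ)) ^ 2 /
        ((1 - 2 * ((i n : ℝ) / n) + 2 * (1 / (n : ℝ))) * (1 - 2 * ((i n : ℝ) / n) + 1 / (n : ℝ)))) atTop
        (𝓝 (2 * β * (α - β + 0) ^ 2 * (1 - α - β + 0) ^ 2 /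
          ((1 - 2 * β + 2 * 0) * (1 - 2 * β + 0)))) := by
      refine (((c2.mul hi).mul (((hw.sub hi).add he).pow 2)).mul
        ((((c1.sub hw).sub hi).add he).pow 2)).div ((hx.add (c2.mul he)).mul (hx.add he))
        (by simpa using hX)
    refine (this.congr' ?_).trans_eq ?_
    · filter_upwards [hev] with n ⟨h1, h2⟩
      have hn : (0 : ℝ) < n := by exact_mod_cast h2
      have h3 : (n : ℝ) - 2 * i n = n * (1 - 2 * ((i n : ℝ) / n)) := by field_simp
      have h4 : (0 : ℝ) < n - 2 * i n := by rw [h3]; positivity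
      have h5 : 1 - 2 * ((i n : ℝ) / n) = (n - 2 * i n) / n := by field_simp
      have h6 : (n - 2 * i n) / n + 1 / (n : ℝ) = (n - 2 * i n + 1) / n := by field_simp
      have h7 : (n - 2 * i n) / n + 2 * (1 / (n : ℝ)) = (n - 2 * i n + 2) / n := by field_simp
      rw [h5, h6, h7, cA]
      field_simp
    · congr 1; simp only [add_zero, mul_zero]; field_simp; try ring
  · have : Tendsto (fun n : ℕ => ((w n : ℝ) / n - (i n : ℝ) / n) ^ 2 / (1 - 2 * ((i n : ℝ) / n))
        + ((i n : ℝ) / n) / 2 + ((i n : ℝ) / n) * (1 - 2 * ((w n : ℝ) / n)) ^ 2 /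
        (2 * (1 - 2 * ((i n : ℝ) / n)) * (1 - 2 * ((i n : ℝ) / n) + 2 * (1 / (n : ℝ))))) atTop
        (𝓝 ((α - β) ^ 2 / (1 - 2 * β) + β / 2 + β * (1 - 2 * α) ^ 2 /
          (2 * (1 - 2 * β) * (1 - 2 * β + 2 * 0)))) := by
      refine ((((hw.sub hi).pow 2).div hx hX).add (hi.div c2 (by norm_num))).add
        ((hi.mul ((c1.sub (c2.mul hw)).pow 2)).div ((c2.mul hx).mul (hx.add (c2.mul he)))
        (by simpa using hX))
    refine (this.congr' ?_).trans_eq ?_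
    · filter_upwards [hev] with n ⟨h1, h2⟩
      have hn : (0 : ℝ) < n := by exact_mod_cast h2
      have h3 : (n : ℝ) - 2 * i n = n * (1 - 2 * ((i n : ℝ) / n)) := by field_simp
      have h4 : (0 : ℝ) < n - 2 * i n := by rw [h3]; positivity
      have h5 : 1 - 2 * ((i n : ℝ) / n) = (n - 2 * i n) / n := by field_simp
      have h7 : (n - 2 * i n) / n + 2 * (1 / (n : ℝ)) = (n - 2 * i n + 2) / n := by field_simp
      rw [h5, h7, cB]
      field_simp
    · congr 1; simp only [add_zero, mul_zero]; field_simp; try ring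

lemma limit_id {α β : ℝ} (h0 : 0 < β) (hβ : β < 1 / 2) :
    ((α - β) ^ 2 / (1 - 2 * β) + β / 2 + β * (1 - 2 * α) ^ 2 / (2 * (1 - 2 * β) ^ 2))
      + 2 * (Real.sqrt (β * (1 - β)) * ((α - β) * (1 - α - β)) / (1 - 2 * β) ^ 2)
      = α - del α β / 2 := by
  have hX : (1 - 2 * β) ≠ 0 := by linarith
  unfold del
  set r := Real.sqrt (β * (1 - β)) with hr
  have hr2 : r ^ 2 = β * (1 - β) := Real.sq_sqrt (by nlinarith)
  have hr0 : 0 ≤ r := Real.sqrt_nonneg _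
  have hr1 : 1 + 2 * r ≠ 0 := by positivity
  have hX2 : (1 - 2 * β) ^ 2 = (1 - 2 * r) * (1 + 2 * r) := by linear_combination 4 * hr2
  have hr3 : 1 - 2 * r ≠ 0 := by
    intro h; rw [h] at hX2; simp at hX2; exact hX hX2
  have hN : 2 * (α - β) ^ 2 * (1 - 2 * β) + β * (1 - 2 * β) ^ 2 + β * (1 - 2 * α) ^ 2
      + 4 * r * ((α - β) * (1 - α - β)) = 2 * (1 - 2 * r) * (α + r) ^ 2 := by
    linear_combination (4 * r - 2 + 8 * α) * hr2
  have e1 : α - 2 * (α * (1 - α) - β * (1 - β)) / (1 + 2 * r) / 2 = (α + r) ^ 2 / (1 + 2 * r) := by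
    rw [← hr2]; field_simp; ring
  have e2 : (α + r) ^ 2 / (1 + 2 * r) = 2 * (1 - 2 * r) * (α + r) ^ 2 / (2 * (1 - 2 * β) ^ 2) := by
    rw [div_eq_div_iff hr1 (by positivity), hX2]; ring
  have e3 : ∀ X a b p : ℝ, X ≠ 0 → a ^ 2 / X + β / 2 + b / (2 * X ^ 2) + 2 * (p / X ^ 2)
      = (2 * a ^ 2 * X + β * X ^ 2 + b + 4 * p) / (2 * X ^ 2) := by
    intro X a b p hX
    field_simp
    ring
  rw [e1, e2, ← hN, e3 _ _ _ _ hX]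
  ring

end B2LP

namespace B2LP
open Filter Topology

lemma tend_floor {β : ℝ} (h0 : 0 < β) (m q : ℕ) :
    Tendsto (fun n : ℕ => ((⌊β * n⌋₊ - m + q : ℕ) : ℝ) / n) atTop (𝓝 β) := by
  have h1 : Tendsto (fun n : ℕ => (⌊β * (n : ℝ)⌋₊ : ℝ) / (n : ℝ)) atTop (𝓝 β) :=
    (tendsto_nat_floor_mul_div_atTop h0.le).comp tendsto_natCast_atTop_atTop
  have h2 : Tendsto (fun n : ℕ => ((q : ℝ) - m) / (n : ℝ)) atTop (𝓝 0) :=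
    tendsto_const_div_atTop_nhds_zero_nat _
  have h3 := h1.add h2
  rw [add_zero] at h3
  refine h3.congr' ?_
  have h4 : Tendsto (fun n : ℕ => ⌊β * (n : ℝ)⌋₊) atTop atTop :=
    tendsto_nat_floor_atTop.comp (tendsto_natCast_atTop_atTop.const_mul_atTop h0)
  filter_upwards [h4.eventually_ge_atTop m] with n hn
  push_cast [Nat.cast_sub hn]
  ring

set_option maxHeartbeats 1000000 in
lemma asym {α β y : ℝ} (h0 : 0 < β) (h1 : β < α) (h2 : β < 1 - α) (hy : del α β / 2 < y)
    (w : ℕ → ℕ) (hw : Tendsto (fun n : ℕ => (w n : ℝ) / n) atTop (𝓝 α)) :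
    ∃ m : ℕ, 0 < m ∧ ∀ᶠ n : ℕ in atTop, ∃ t0 : ℕ, ((t0 + m : ℕ) : ℝ) ≤ β * n ∧ t0 + m ≤ w n ∧
      t0 + m ≤ n - w n ∧ 0 < w n ∧ w n < n ∧ 2 * (t0 + m + 1) < n ∧ ∃ θ c0 b0 : ℝ, 0 < θ ∧ 0 ≤ c0 ∧
      (∀ q ≤ m, c0 * θ ≤ cC n (w n) (t0 + q : ℕ)) ∧
      (∀ q ≤ m, c0 ≤ cA n (w n) (t0 + q + 1 : ℕ) * θ) ∧
      (∀ q ≤ m, b0 ≤ cB n (w n) (t0 + q : ℕ)) ∧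
      1 ≤ b0 + 2 * c0 * (1 - 1 / m) ∧
      w n - (b0 + 2 * c0 * (1 - 1 / m)) + 1 ≤ n * y := by
  have hβ : β < 1 / 2 := by linarith
  set r := Real.sqrt (β * (1 - β)) with hr
  have hr2 : r ^ 2 = β * (1 - β) := Real.sq_sqrt (by nlinarith)
  have hr0 : 0 < r := Real.sqrt_pos.2 (by nlinarith)
  set P := (α - β) * (1 - α - β) with hP
  have hP0 : 0 < P := mul_pos (by linarith) (by linarith)
  have hX : 0 < 1 - 2 * β := by linarith
  set cI := r * P / (1 - 2 * β) ^ 2 with hcI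
  have hcI0 : 0 < cI := by positivity
  set BI := ((α - β) ^ 2 / (1 - 2 * β) + β / 2 + β * (1 - 2 * α) ^ 2 / (2 * (1 - 2 * β) ^ 2)) with hBI
  set CI := (1 - β) / (2 * (1 - 2 * β) ^ 2) with hCI
  set AI := 2 * β * P ^ 2 / (1 - 2 * β) ^ 2 with hAI
  set θ0 := r / (2 * β * P) with hθ
  have hθ0 : 0 < θ0 := by positivity
  have hid : BI + 2 * cI = α - del α β / 2 := limit_id h0 hβ
  have hBI0 : 0 < BI := by
    have : 0 ≤ β * (1 - 2 * α) ^ 2 / (2 * (1 - 2 * β) ^ 2) := by positivity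
    have : 0 < (α - β) ^ 2 / (1 - 2 * β) := by
      have : 0 < α - β := by linarith
      positivity
    linarith
  have hC1 : cI * θ0 = CI := by
    rw [hcI, hθ, hCI]
    field_simp
    rw [hr2]
  have hA1 : AI * θ0 = cI := by
    rw [hcI, hθ, hAI]
    field_simp
  obtain ⟨ε, hε, e1, e2, e3⟩ : ∃ ε : ℝ, 0 < ε ∧ ε ≤ cI ∧ 6 * ε ≤ y - del α β / 2 ∧ 2 * ε ≤ BI := by
    refine ⟨min cI (min ((y - del α β / 2) / 6) (BI / 2)), ?_, min_le_left _ _, ?_, ?_⟩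
    · refine lt_min hcI0 (lt_min (by linarith) (by linarith))
    · have := (min_le_right cI (min ((y - del α β / 2) / 6) (BI / 2))).trans (min_le_left _ _)
      linarith
    · have := (min_le_right cI (min ((y - del α β / 2) / 6) (BI / 2))).trans (min_le_right _ _)
      linarith
  obtain ⟨m, hm⟩ := exists_nat_gt (max 1 (2 * cI / ε))
  have hm1 : (1 : ℝ) < m := lt_of_le_of_lt (le_max_left _ _) hm
  have hm2 : 2 * cI / ε < m := lt_of_le_of_lt (le_max_right _ _) hm
  have hm0 : 0 < m := by
    have : (0 : ℝ) < m := by linarith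
    exact_mod_cast this
  have hm3 : 2 * cI * (1 / m) ≤ ε := by
    rw [div_lt_iff₀ hε] at hm2
    rw [mul_one_div, div_le_iff₀ (by linarith)]; linarith
  have hm4 : (1 : ℝ) / m ≤ 1 := by rw [div_le_one (by linarith)]; exact hm1.le
  have hm5 : (0 : ℝ) ≤ 1 / m := by positivity
  refine ⟨m, hm0, ?_⟩
  have ev1 : ∀ᶠ n : ℕ in atTop, ∀ q ∈ Finset.range (m + 1),
      CI - θ0 * ε < n * cC n (w n) ((⌊β * n⌋₊ - m + q : ℕ) : ℝ) ∧
      BI - ε < cB n (w n) ((⌊β * n⌋₊ - m + q : ℕ) : ℝ) / n ∧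
      AI - ε / θ0 < cA n (w n) ((⌊β * n⌋₊ - m + (q + 1) : ℕ) : ℝ) / n ^ 3 := by
    rw [Filter.eventually_all_finset]
    intro q _
    obtain ⟨a1, _, a3⟩ := lims hβ w (fun n => ⌊β * n⌋₊ - m + q) hw (tend_floor h0 m q)
    obtain ⟨_, b2, _⟩ := lims hβ w (fun n => ⌊β * n⌋₊ - m + (q + 1)) hw (tend_floor h0 m (q + 1))
    refine (a1.eventually_const_lt ?_).and ((a3.eventually_const_lt ?_).and (b2.eventually_const_lt ?_))
    · have := mul_pos hθ0 hε; linarith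
    · linarith
    · have := div_pos hε hθ0; linarith
  have h4 : Tendsto (fun n : ℕ => ⌊β * (n : ℝ)⌋₊) atTop atTop :=
    tendsto_nat_floor_atTop.comp (tendsto_natCast_atTop_atTop.const_mul_atTop h0)
  have he : Tendsto (fun n : ℕ => 1 / (n : ℝ)) atTop (𝓝 0) := tendsto_one_div_atTop_nhds_zero_nat
  filter_upwards [ev1, h4.eventually_ge_atTop m, eventually_gt_atTop 0,
    hw.eventually_const_lt h1, hw.eventually_lt_const (by linarith : α < 1 - β),
    hw.eventually_lt_const (by linarith : α < α + ε),
    he.eventually_lt_const (by linarith : 0 < ε),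
    he.eventually_lt_const (by linarith : 0 < 1 / 2 - β)] with n g1 g2 g3 g4 g5 g6 g7 g8
  have hn : (0 : ℝ) < n := by exact_mod_cast g3
  rw [lt_div_iff₀ hn] at g4
  rw [div_lt_iff₀ hn] at g5 g6 g7 g8
  have hf : (⌊β * (n : ℝ)⌋₊ : ℝ) ≤ β * n := Nat.floor_le (by positivity)
  have hfm : ⌊β * (n : ℝ)⌋₊ - m + m = ⌊β * (n : ℝ)⌋₊ := by omega
  have hwpos : (0 : ℝ) < w n := lt_trans (by positivity) g4
  have hwn : (w n : ℝ) < n := by nlinarith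
  have hwn' : w n < n := by exact_mod_cast hwn
  refine ⟨⌊β * (n : ℝ)⌋₊ - m, ?_, ?_, ?_, by exact_mod_cast hwpos, hwn', ?_, θ0 / n ^ 2, n * (cI - ε),
    n * (BI - ε), by positivity, mul_nonneg hn.le (by linarith), ?_, ?_, ?_, ?_, ?_⟩
  · rw [hfm]; exact hf
  · rw [hfm]
    have : (⌊β * (n : ℝ)⌋₊ : ℝ) ≤ w n := by linarith
    exact_mod_cast this
  · rw [hfm]
    have : (⌊β * (n : ℝ)⌋₊ : ℝ) ≤ (n - w n : ℕ) := by rw [Nat.cast_sub hwn'.le]; linarith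
    exact_mod_cast this
  · rw [hfm]
    have : (2 : ℝ) * (⌊β * (n : ℝ)⌋₊ + 1) < n := by linarith
    exact_mod_cast this
  · intro q hq
    have := (g1 q (by simp; omega)).1
    have e : n * (cI - ε) * (θ0 / n ^ 2) = (CI - θ0 * ε) / n := by
      rw [← hC1]; field_simp
    rw [e, div_le_iff₀ hn]
    linarith
  · intro q hq
    have := (g1 q (by simp; omega)).2.2
    rw [lt_div_iff₀ (by positivity)] at this
    rw [add_assoc]
    have e : n * (cI - ε) = ((AI - ε / θ0) * n ^ 3) * (θ0 / n ^ 2) := by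
      rw [← hA1]; field_simp
    rw [e]
    have : 0 < θ0 / (n : ℝ) ^ 2 := by positivity
    gcongr
  · intro q hq
    have := (g1 q (by simp; omega)).2.1
    rw [lt_div_iff₀ hn] at this
    linarith
  · have a1 : 0 ≤ 2 * (n * (cI - ε)) * (1 - 1 / (m : ℝ)) := by
      refine mul_nonneg (mul_nonneg (by norm_num) (mul_nonneg hn.le (by linarith))) (by linarith)
    have a2 : (n : ℝ) * ε ≤ n * (BI - ε) := mul_le_mul_of_nonneg_left (by linarith) hn.le
    linarith
  · have a1 : BI - ε + 2 * (cI - ε) * (1 - 1 / (m : ℝ)) ≥ α - del α β / 2 - 4 * ε := by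
      have : 0 ≤ ε * (1 / (m : ℝ)) := by positivity
      linarith
    have a2 : n * (BI - ε) + 2 * (n * (cI - ε)) * (1 - 1 / (m : ℝ)) ≥ n * (α - del α β / 2 - 4 * ε) := by
      calc _ = n * (BI - ε + 2 * (cI - ε) * (1 - 1 / (m : ℝ))) := by ring
        _ ≥ _ := by gcongr
    have a3 : (n : ℝ) * (6 * ε) ≤ n * (y - del α β / 2) := by gcongr
    linarith

end B2LP

namespace B2LP
open Filter Topology

lemma log_small {η : ℝ} (hη : 0 < η) :
    ∀ᶠ n : ℕ in atTop, 2 + 2 * Real.logb 2 ((n : ℝ) + 1) ≤ η * n := by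
  have h1 := (Real.tendsto_pow_log_div_mul_add_atTop 1 (-1) 1 one_ne_zero).comp
    (tendsto_atTop_add_const_right atTop (1 : ℝ) (tendsto_natCast_atTop_atTop (R := ℝ)))
  have h2 : Tendsto (fun n : ℕ => 2 * (1 / (n : ℝ)) + 2 / Real.log 2 * (Real.log ((n : ℝ) + 1) / n)) atTop
      (𝓝 (2 * 0 + 2 / Real.log 2 * 0)) := by
    refine (tendsto_const_nhds.mul tendsto_one_div_atTop_nhds_zero_nat).add
      (tendsto_const_nhds.mul (h1.congr fun n => ?_))
    simp
  rw [mul_zero, mul_zero, add_zero] at h2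
  filter_upwards [h2.eventually_lt_const hη, eventually_gt_atTop 0] with n h3 h4
  have hn : (0 : ℝ) < n := by exact_mod_cast h4
  have : 2 * (1 / (n : ℝ)) + 2 / Real.log 2 * (Real.log ((n : ℝ) + 1) / n)
      = (2 + 2 * Real.logb 2 ((n : ℝ) + 1)) / n := by
    rw [Real.logb]; ring
  rw [this, div_lt_iff₀ hn] at h3
  exact h3.le

lemma dim_bound {n t : ℕ} {β : ℝ} (hn : 0 < n) (hβ : β ≤ 1 / 2) (ht : (t : ℝ) ≤ β * n) :
    ((Finset.univ.filter fun S : Finset (Fin n) => S.card ≤ t).card : ℝ)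
      ≤ (n + 1) * (2 : ℝ) ^ (n * binH β) := by
  have hn' : (0 : ℝ) < n := by exact_mod_cast hn
  have htn : (t : ℝ) ≤ n := by nlinarith
  have htn' : t ≤ n := by exact_mod_cast htn
  have h1 : (Finset.univ.filter fun S : Finset (Fin n) => S.card ≤ t).card
      ≤ ∑ k ∈ Finset.range (t + 1), n.choose k := by
    rw [Finset.card_eq_sum_card_fiberwise (f := Finset.card) (t := Finset.range (t + 1))]
    · refine Finset.sum_le_sum fun k _ => ?_
      calc _ ≤ (Finset.powersetCard k (Finset.univ : Finset (Fin n))).card := by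
            refine Finset.card_le_card fun S hS => ?_
            simp at hS ⊢; exact hS.2
        _ = _ := by simp
    · intro S hS
      simp at hS ⊢; omega
  have h2 : ∀ k ∈ Finset.range (t + 1), (n.choose k : ℝ) ≤ (2 : ℝ) ^ (n * binH β) := by
    intro k hk
    have hk' : k ≤ t := by simpa [Nat.lt_succ_iff] using hk
    have hkn : k ≤ n := by omega
    have hp : (0 : ℝ) < n.choose k := by exact_mod_cast Nat.choose_pos hkn
    rw [← Real.logb_le_iff_le_rpow (by norm_num) hp]
    refine (choose_le_ent n k hn hkn).trans ?_
    have : (k : ℝ) ≤ t := by exact_mod_cast hk'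
    have : binH (k / n) ≤ binH β := by
      refine binH_mono (by positivity) ?_ hβ
      rw [div_le_iff₀ hn']; linarith
    gcongr
  calc _ ≤ ((∑ k ∈ Finset.range (t + 1), n.choose k : ℕ) : ℝ) := by exact_mod_cast h1
    _ = ∑ k ∈ Finset.range (t + 1), (n.choose k : ℝ) := by push_cast; rfl
    _ ≤ ∑ k ∈ Finset.range (t + 1), (2 : ℝ) ^ (n * binH β) := Finset.sum_le_sum h2
    _ = (t + 1) * (2 : ℝ) ^ (n * binH β) := by simp
    _ ≤ _ := by gcongr

lemma key_claim {α β y L : ℝ} (h0 : 0 < β) (h1 : β < α) (h2 : β < 1 - α) (hy : del α β / 2 < y)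
    (hyα : y < α) (hyα' : y < 1 - α) (hL : binH β < L)
    (C : (n : ℕ) → Finset (Fin n → ℤ)) (w : ℕ → ℕ)
    (hbin : ∀ n : ℕ, ∀ c ∈ C n, ∀ j : Fin n, c j = 0 ∨ c j = 1)
    (hB2 : ∀ n : ℕ, IsB2 (C n))
    (hw : ∀ n : ℕ, ∀ c ∈ C n,
      (Finset.univ.filter (fun j : Fin n => c j = 1)).card = w n)
    (hwα : Tendsto (fun n : ℕ => (w n : ℝ) / (n : ℝ)) atTop (𝓝 α))
    (hf : ∃ᶠ n : ℕ in atTop, L < (1 / (n : ℝ)) * Real.logb 2 ((C n).card)) :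
    L ≤ Psi α y := by
  by_contra hcon
  push Not at hcon
  have hα0 : 0 < α := by linarith
  have hα1 : α < 1 := by linarith
  set M := (L + Psi α y) / 2 with hM
  have hcont : ContinuousAt (fun a : ℝ => Psi a y) α := by
    unfold Psi
    have k1 : ContinuousAt (fun a : ℝ => binH (y / a)) α :=
      binH_cont.continuousAt.comp (continuousAt_const.div continuousAt_id hα0.ne')
    have k2 : ContinuousAt (fun a : ℝ => binH (y / (1 - a))) α :=
      binH_cont.continuousAt.comp (continuousAt_const.div
        (continuousAt_const.sub continuousAt_id) (by linarith))
    have k3 : ContinuousAt (fun a : ℝ => binH a) α := binH_cont.continuousAt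
    exact continuousAt_const.mul ((((continuousAt_const.add continuousAt_const).add k3).sub
      (continuousAt_id.mul k1)).sub ((continuousAt_const.sub continuousAt_id).mul k2))
  have hPs : Tendsto (fun n : ℕ => Psi ((w n : ℝ) / n) y) atTop (𝓝 (Psi α y)) := hcont.tendsto.comp hwα
  obtain ⟨m, hm, hev⟩ := asym h0 h1 h2 hy w hwα
  have hb0 : 0 < binH β := binH_pos h0 (by linarith)
  refine hf ?_
  filter_upwards [hev, hPs.eventually_lt_const (by linarith : Psi α y < M), log_small (by linarith : 0 < L - M),
    log_small (by linarith : 0 < L - binH β), hwα.eventually_const_lt hyα,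
    hwα.eventually_lt_const (by linarith : α < 1 - y), eventually_gt_atTop 0] with n g1 g2 g3 g4 g5 g6 g7 hlt
  obtain ⟨t0, a1, a2, a3, a4, a5, a6, θ, c0, b0, a7, a8, a9, a10, a11, a12, a13⟩ := g1
  have hn : (0 : ℝ) < n := by exact_mod_cast g7
  have hn1 : (1 : ℝ) ≤ n := by exact_mod_cast g7
  rw [one_div_mul_eq_div, lt_div_iff₀ hn] at hlt
  obtain ⟨D, d1, d2, d3⟩ := translate (C n) (w n) (hbin n) (hB2 n) (hw n)
  have hlog0 : 0 < Real.logb 2 ((C n).card) := lt_trans (mul_pos (by linarith) hn) hlt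
  have hcpos : (0 : ℝ) < (C n).card := by
    rcases Nat.eq_zero_or_pos (C n).card with h | h
    · rw [h] at hlog0; simp at hlog0
    · exact_mod_cast h
  have l2n : Real.logb 2 (2 * n) ≤ 1 + Real.logb 2 ((n : ℝ) + 1) := by
    rw [Real.logb_mul (by norm_num) hn.ne', Real.logb_self_eq_one (by norm_num)]
    have := Real.logb_le_logb_of_le (b := 2) (by norm_num) hn (by linarith : (n : ℝ) ≤ n + 1)
    linarith
  have l4n : Real.logb 2 (4 * n) ≤ 2 + Real.logb 2 ((n : ℝ) + 1) := by
    have e : (4 : ℝ) * n = 2 * (2 * n) := by ring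
    rw [e, Real.logb_mul (by norm_num) (by positivity), Real.logb_self_eq_one (by norm_num)]
    linarith
  have hcard : 2 * n * (Finset.univ.filter fun S : Finset (Fin n) => S.card ≤ t0 + m).card ≤ D.card := by
    have k1 := dim_bound (β := β) g7 (by linarith) a1
    have k2 : (2 * n : ℝ) * ((n + 1) * (2 : ℝ) ^ (n * binH β)) ≤ (C n).card := by
      rw [← Real.logb_le_logb (b := 2) (by norm_num) (by positivity) hcpos,
        Real.logb_mul (x := 2 * (n : ℝ)) (by positivity) (by positivity),
        Real.logb_mul (x := (n : ℝ) + 1) (by positivity) (by positivity),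
        Real.logb_rpow (by norm_num) (by norm_num)]
      linarith
    rw [d1]
    have : (2 * n : ℝ) * ((Finset.univ.filter fun S : Finset (Fin n) => S.card ≤ t0 + m).card : ℝ) ≤ (C n).card :=
      le_trans (by gcongr) k2
    exact_mod_cast this
  have hDne : D.Nonempty := by
    rw [← Finset.card_pos, d1]; exact_mod_cast hcpos
  obtain ⟨j, j1, j2, j3, j4⟩ := finite_bound (w n) t0 m hm a2 a3 a5.le a6 θ c0 b0 a7 a8 a9 a10 a11 a12 D d2
    hDne d3 hcard
  rw [d1] at j4
  have hr := rate_bound n (w n) j _ hcpos a4 a5 j1 j2 j4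
  have hjy : (j : ℝ) / n ≤ y := by rw [div_le_iff₀ hn]; linarith
  have hmono : Psi ((w n : ℝ) / n) (j / n) ≤ Psi ((w n : ℝ) / n) y := by
    refine Psi_mono ?_ ?_ (by positivity) hjy g5.le (by linarith)
    · have : (0 : ℝ) < w n := by exact_mod_cast a4
      positivity
    · rw [div_lt_one hn]; exact_mod_cast a5
  have : n * Psi ((w n : ℝ) / n) (j / n) ≤ n * M := by
    gcongr; linarith
  linarith

end B2LP

namespace B2LP
open Filter Topology

lemma del_cont (α : ℝ) : Continuous (del α) := by
  unfold del
  refine Continuous.div (by fun_prop) (by fun_prop) fun β => ?_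
  have := Real.sqrt_nonneg (β * (1 - β))
  positivity

lemma Psi_cont (α : ℝ) : Continuous (Psi α) := by
  unfold Psi; fun_prop

lemma del_nonneg {α β : ℝ} (h1 : β ≤ α) (h2 : β ≤ 1 - α) : 0 ≤ del α β := by
  unfold del
  have := Real.sqrt_nonneg (β * (1 - β))
  refine div_nonneg ?_ (by positivity)
  have : 0 ≤ (α - β) * (1 - α - β) := mul_nonneg (by linarith) (by linarith)
  nlinarith

lemma del_le {α β : ℝ} (h0 : 0 ≤ β) (h1 : β ≤ α) (h2 : β ≤ 1 - α) : del α β / 2 ≤ α * (1 - α) := by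
  unfold del
  have hs := Real.sqrt_nonneg (β * (1 - β))
  have : 0 ≤ (α - β) * (1 - α - β) := mul_nonneg (by linarith) (by linarith)
  have hb : 0 ≤ β * (1 - β) := mul_nonneg h0 (by linarith)
  rw [div_div, div_le_iff₀ (by positivity)]
  have : 0 ≤ α * (1 - α) * Real.sqrt (β * (1 - β)) :=
    mul_nonneg (mul_nonneg (by linarith) (by linarith)) hs
  nlinarith

lemma Psi_zero (α : ℝ) : Psi α 0 = binH α / 2 := by
  simp [Psi, binH_zero]; ring

lemma deltaLP_eq {α β : ℝ} (hα1 : α < 1) (h0 : 0 ≤ β) (h1 : β ≤ α) (h2 : β ≤ 1 - α) :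
    deltaLP (binH β) α = del α β := by
  have hβ : β ≤ 1 / 2 := by linarith
  have inj : ∀ x : ℝ, 0 ≤ x → x ≤ 1 / 2 → binH x = binH β → x = β := by
    intro x hx hx' h
    rcases lt_trichotomy x β with hl | hl | hl
    · exact absurd h (binH_strictMono hx hl hβ).ne
    · exact hl
    · exact absurd h (binH_strictMono h0 hl hx').ne'
  have : {v : ℝ | ∃ b : ℝ, 0 ≤ b ∧ b ≤ α ∧ binH b = binH β ∧
      v = 2 * (α * (1 - α) - b * (1 - b)) / (1 + 2 * Real.sqrt (b * (1 - b)))} = {del α β} := by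
    ext v
    simp only [Set.mem_ofPred_eq, Set.mem_singleton_iff]
    constructor
    · rintro ⟨b, b0, b1, b2, rfl⟩
      rcases le_total b (1 / 2) with hb | hb
      · rw [inj b b0 hb b2]; rfl
      · have := inj (1 - b) (by linarith) (by linarith) (by rw [binH_symm, b2])
        unfold del
        have e : b * (1 - b) = β * (1 - β) := by rw [← this]; ring
        rw [e]
    · rintro rfl
      exact ⟨β, h0, h1, rfl, rfl⟩
  unfold deltaLP
  rw [this, csInf_singleton]

lemma rho_bdd (α : ℝ) : BddAbove {R : ℝ | R = Psi α (deltaLP R α / 2)} := by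
  refine ⟨1, ?_⟩
  intro R hR
  simp only [Set.mem_ofPred_eq] at hR
  by_contra hc
  push Not at hc
  have : deltaLP R α = 0 := by
    unfold deltaLP
    convert Real.sInf_empty
    ext v
    simp only [Set.mem_ofPred_eq, Set.mem_empty_iff_false, iff_false]
    rintro ⟨b, _, _, b2, _⟩
    have := binH_le_one b
    linarith
  rw [this, zero_div, Psi_zero] at hR
  have := binH_le_one α
  linarith

lemma le_rho {α β : ℝ} (hα1 : α < 1) (h0 : 0 ≤ β) (h1 : β ≤ α) (h2 : β ≤ 1 - α)
    (h : Psi α (del α β / 2) = binH β) : binH β ≤ rho α := by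
  refine le_csSup (rho_bdd α) ?_
  simp only [Set.mem_ofPred_eq]
  rw [deltaLP_eq hα1 h0 h1 h2, h]

lemma exists_root {α β : ℝ} (hα0 : 0 < α) (hα1 : α < 1) (h0 : 0 ≤ β) (h1 : β ≤ min α (1 - α))
    (h : binH β ≤ Psi α (del α β / 2)) : binH β ≤ rho α := by
  set b := min α (1 - α) with hb
  have hbα : b ≤ α := min_le_left _ _
  have hbα' : b ≤ 1 - α := min_le_right _ _
  have hb2 : b ≤ 1 / 2 := by linarith
  have hHb : binH b = binH α := by
    rcases min_choice α (1 - α) with e | e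
    · rw [hb, e]
    · rw [hb, e, binH_symm]
  have hdb : del α b = 0 := by
    unfold del
    have : α * (1 - α) - b * (1 - b) = 0 := by
      rcases min_choice α (1 - α) with e | e <;> rw [hb, e] <;> ring
    rw [this]; simp
  have hc : ContinuousOn (fun x => Psi α (del α x / 2) - binH x) (Set.Icc β b) := by
    have := del_cont α
    have := Psi_cont α
    have := binH_cont
    exact Continuous.continuousOn (by fun_prop)
  have hα := binH_pos hα0 hα1
  obtain ⟨x, hx, hx'⟩ := intermediate_value_Icc' h1 hc (show (0 : ℝ) ∈ _ from
    ⟨by simp only [hdb, hHb, zero_div, Psi_zero]; linarith, by simpa using h⟩)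
  have : binH β ≤ binH x := binH_mono h0 hx.1 (hx.2.trans hb2)
  refine this.trans (le_rho hα1 (h0.trans hx.1) (hx.2.trans hbα) (hx.2.trans hbα') ?_)
  simp only at hx'
  linarith

lemma rho_nonneg {α : ℝ} (hα0 : 0 < α) (hα1 : α < 1) : 0 ≤ rho α := by
  have h := binH_pos hα0 hα1
  rw [← binH_zero]
  refine exists_root hα0 hα1 le_rfl (le_min hα0.le (by linarith)) ?_
  have d0 := del_nonneg (α := α) (β := 0) hα0.le (by linarith)
  have d1 := del_le (α := α) (β := 0) le_rfl hα0.le (by linarith)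
  have := Psi_mono (α := α) (x := 0) (y := del α 0 / 2) hα0 hα1 le_rfl (by linarith)
    (by nlinarith) (by nlinarith)
  rw [Psi_zero] at this
  rw [binH_zero]; linarith

theorem main
    (α : ℝ) (hα0 : 0 < α) (hα1 : α < 1)
    (C : (n : ℕ) → Finset (Fin n → ℤ)) (w : ℕ → ℕ)
    (hbin : ∀ n : ℕ, ∀ c ∈ C n, ∀ j : Fin n, c j = 0 ∨ c j = 1)
    (hB2 : ∀ n : ℕ, IsB2 (C n))
    (hw : ∀ n : ℕ, ∀ c ∈ C n,
      (Finset.univ.filter (fun j : Fin n => c j = 1)).card = w n)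
    (hwα : Tendsto (fun n : ℕ => (w n : ℝ) / (n : ℝ)) atTop (𝓝 α)) :
    limsup (fun n : ℕ => (1 / (n : ℝ)) * Real.logb 2 ((C n).card)) atTop ≤ rho α := by
  have hr0 := rho_nonneg hα0 hα1
  refine le_of_forall_gt_imp_ge_of_dense fun L hL => ?_
  have hnn : ∀ n : ℕ, 0 ≤ (1 / (n : ℝ)) * Real.logb 2 ((C n).card) := by
    intro n
    refine mul_nonneg (by positivity) ?_
    rcases Nat.eq_zero_or_pos (C n).card with h | h
    · rw [h]; simp
    · exact Real.logb_nonneg (by norm_num) (by exact_mod_cast h)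
  refine limsup_le_of_le ((isBoundedUnder_of ⟨0, fun n => hnn n⟩).isCoboundedUnder_le) ?_
  by_contra hcon
  rw [not_eventually] at hcon
  have hf : ∃ᶠ n : ℕ in atTop, L < (1 / (n : ℝ)) * Real.logb 2 ((C n).card) :=
    hcon.mono fun n hn => not_le.1 hn
  have hL0 : 0 < L := by linarith
  have key : ∀ β : ℝ, 0 < β → β < α → β < 1 - α → binH β < L → L ≤ Psi α (del α β / 2) := by
    intro β b0 b1 b2 bL
    have d1 := del_le b0.le b1.le b2.le
    have k1 : del α β / 2 < min α (1 - α) := lt_min (by nlinarith) (by nlinarith)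
    refine ge_of_tendsto (((Psi_cont α).tendsto _).mono_left nhdsWithin_le_nhds) (x := 𝓝[>] (del α β / 2)) ?_
    filter_upwards [Ioo_mem_nhdsGT k1] with y hy
    exact key_claim b0 b1 b2 hy.1 (hy.2.trans_le (min_le_left _ _)) (hy.2.trans_le (min_le_right _ _)) bL
      C w hbin hB2 hw hwα hf
  set b := min α (1 - α) with hb
  have hb0 : 0 < b := lt_min hα0 (by linarith)
  have hbα : b ≤ α := min_le_left _ _
  have hbα' : b ≤ 1 - α := min_le_right _ _
  have hb2 : b ≤ 1 / 2 := by linarith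
  have hHb : binH b = binH α := by
    rcases min_choice α (1 - α) with e | e
    · rw [hb, e]
    · rw [hb, e, binH_symm]
  have hα := binH_pos hα0 hα1
  -- left limits
  have lim : ∀ β0 : ℝ, 0 < β0 → β0 ≤ b → binH β0 ≤ L → L ≤ Psi α (del α β0 / 2) := by
    intro β0 p0 p1 p2
    have hc : Continuous fun x => Psi α (del α x / 2) := by
      have := del_cont α
      have := Psi_cont α
      fun_prop
    refine ge_of_tendsto ((hc.tendsto β0).mono_left nhdsWithin_le_nhds) (x := 𝓝[<] β0) ?_
    filter_upwards [Ioo_mem_nhdsLT p0] with x hx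
    exact key x hx.1 (by linarith [hx.2]) (by linarith [hx.2])
      ((binH_strictMono hx.1.le hx.2 (p1.trans hb2)).trans_le p2)
  have hdb : del α b = 0 := by
    unfold del
    have : α * (1 - α) - b * (1 - b) = 0 := by
      rcases min_choice α (1 - α) with e | e <;> rw [hb, e] <;> ring
    rw [this]; simp
  rcases le_total (binH α) L with hc | hc
  · have := lim b hb0 le_rfl (by rw [hHb]; exact hc)
    rw [hdb, zero_div, Psi_zero] at this
    linarith
  · obtain ⟨x, hx, hx'⟩ := intermediate_value_Icc hb0.le binH_cont.continuousOn
      (show L ∈ _ from ⟨by rw [binH_zero]; exact hL0.le, by rw [hHb]; exact hc⟩)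
    have hx0 : 0 < x := by
      rcases hx.1.eq_or_lt with h | h
      · rw [← h, binH_zero] at hx'; linarith
      · exact h
    have h1 := lim x hx0 hx.2 hx'.le
    rw [← hx'] at h1
    have := exists_root hα0 hα1 hx.1 hx.2 h1
    linarith

end B2LP

open scoped Classical in
/-- Let `α ∈ (0,1)` and let `(C_n)` be a sequence of binary `B₂` codes of length `n` and
constant Hamming weight `w_n` with `w_n/n → α`.  Then
`limsup_{n→∞} (1/n) log₂ |C_n| ≤ ρ(α)`. -/
theorem constant_weight_B2_rate_upper_bound
    (α : ℝ) (hα0 : 0 < α) (hα1 : α < 1)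
    (C : (n : ℕ) → Finset (Fin n → ℤ)) (w : ℕ → ℕ)
    (hbin : ∀ n : ℕ, ∀ c ∈ C n, ∀ j : Fin n, c j = 0 ∨ c j = 1)
    (hB2 : ∀ n : ℕ, IsB2 (C n))
    (hw : ∀ n : ℕ, ∀ c ∈ C n,
      (Finset.univ.filter (fun j : Fin n => c j = 1)).card = w n)
    (hwα : Filter.Tendsto (fun n : ℕ => (w n : ℝ) / (n : ℝ)) Filter.atTop (nhds α)) :
    Filter.limsup (fun n : ℕ => (1 / (n : ℝ)) * Real.logb 2 ((C n).card))
        Filter.atTop ≤ rho α := by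
  exact B2LP.main α hα0 hα1 C w hbin hB2 (fun n c hc => by convert hw n c hc) hwα
end
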